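/- arXiv:2204.02576 — 4 statements merged into one kernel-verified Lean document; each statement's English description precedes it below -/
import Mathlib

section
/- There is an absolute constant C > 0 such that for every positive integer r, every non-principal Dirichlet character χ modulo r, and all real σ, t with 1/2 ≤ σ ≤ 1, one has |L(σ + it, χ)| ≤ C·d(r)·(r(|t| + 2))^{(1−σ)/2}·log(r(|t| + 2)), where L(·,χ) is the Dirichlet L-function of χ and d(r) is the number of positive divisors of r. -/
open Set MeasureTheory in
/-- The Mellin transform attached to a strong FE-pair is bounded on vertical strips. -/
lemma IsStrongFEPair.exists_norm_mellin_le {P : WeakFEPair ℂ} (hP : IsStrongFEPair P) (a b : ℝ) :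
    ∃ K : ℝ, ∀ s : ℂ, a ≤ s.re → s.re ≤ b → ‖mellin P.f s‖ ≤ K := by
  have ha := (hP.hasMellin a).1.norm
  have hb := (hP.hasMellin b).1.norm
  refine ⟨∫ t in Ioi (0 : ℝ), (‖(t : ℂ) ^ ((a : ℂ) - 1) • P.f t‖ +
    ‖(t : ℂ) ^ ((b : ℂ) - 1) • P.f t‖), fun s hsa hsb ↦ ?_⟩
  refine norm_integral_le_of_norm_le (ha.add hb) ?_
  filter_upwards [ae_restrict_mem measurableSet_Ioi] with t (ht : 0 < t)
  simp only [norm_smul, Complex.norm_cpow_eq_rpow_re_of_pos ht, Complex.sub_re, Complex.one_re,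
    Complex.ofReal_re, ← add_mul]
  refine mul_le_mul_of_nonneg_right ?_ (norm_nonneg _)
  rcases le_total t 1 with h | h
  · exact (Real.rpow_le_rpow_of_exponent_ge ht h (by linarith)).trans
      (le_add_of_nonneg_right (by positivity))
  · exact (Real.rpow_le_rpow_of_exponent_le h (by linarith)).trans
      (le_add_of_nonneg_left (by positivity))

open HurwitzZeta in
/-- Away from the real axis, the even completed Hurwitz zeta function is bounded on
`0 ≤ re s ≤ 1`. -/
lemma HurwitzZeta.exists_norm_completedHurwitzZetaEven_le (a : UnitAddCircle) :
    ∃ K : ℝ, ∀ s : ℂ, 0 ≤ s.re → s.re ≤ 1 → 1 ≤ |s.im| → ‖completedHurwitzZetaEven a s‖ ≤ K := by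
  obtain ⟨K, hK⟩ :=
    (hurwitzEvenFEPair a).isStrongFEPair_toStrongFEPair.exists_norm_mellin_le 0 (1 / 2)
  refine ⟨K / 2 + 1 + 1, fun s h0 h1 him ↦ ?_⟩
  have hs : 1 ≤ ‖s‖ := him.trans (Complex.abs_im_le_norm s)
  have hs' : 1 ≤ ‖1 - s‖ := him.trans (by simpa using Complex.abs_im_le_norm (1 - s))
  have hre : (s / 2).re = s.re / 2 := by simp
  rw [completedHurwitzZetaEven_eq]
  refine (norm_sub_le _ _).trans (add_le_add ((norm_sub_le _ _).trans (add_le_add ?_ ?_)) ?_)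
  · rw [completedHurwitzZetaEven₀, norm_div, Complex.norm_two]
    gcongr
    exact hK (s / 2) (by rw [hre]; linarith) (by rw [hre]; linarith)
  · rw [norm_div]
    refine div_le_one_of_le₀ (le_trans ?_ hs) (norm_nonneg _)
    split_ifs <;> simp
  · rw [norm_div, norm_one]
    exact div_le_one_of_le₀ hs' (norm_nonneg _)

open HurwitzZeta in
/-- The odd completed Hurwitz zeta function is bounded on `0 ≤ re s ≤ 1`. -/
lemma HurwitzZeta.exists_norm_completedHurwitzZetaOdd_le (a : UnitAddCircle) :
    ∃ K : ℝ, ∀ s : ℂ, 0 ≤ s.re → s.re ≤ 1 → ‖completedHurwitzZetaOdd a s‖ ≤ K := by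
  obtain ⟨K, hK⟩ := (isStrong_hurwitzOddFEPair a).exists_norm_mellin_le (1 / 2) 1
  refine ⟨K / 2, fun s h0 h1 ↦ ?_⟩
  have hre : ((s + 1) / 2).re = (s.re + 1) / 2 := by simp
  rw [completedHurwitzZetaOdd, norm_div, Complex.norm_two, (isStrong_hurwitzOddFEPair a).Λ_eq]
  gcongr
  exact hK _ (by rw [hre]; linarith) (by rw [hre]; linarith)

namespace DirichletCharacter

open HurwitzZeta in
/-- Away from the real axis, completed Dirichlet L-functions are bounded on `0 ≤ re s ≤ 1`. -/
lemma exists_norm_completedLFunction_le {N : ℕ} [NeZero N] (χ : DirichletCharacter ℂ N) :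
    ∃ K : ℝ, ∀ s : ℂ, 0 ≤ s.re → s.re ≤ 1 → 1 ≤ |s.im| → ‖completedLFunction χ s‖ ≤ K := by
  choose K hK using exists_norm_completedHurwitzZetaEven_le
  choose K' hK' using exists_norm_completedHurwitzZetaOdd_le
  refine ⟨∑ j : ZMod N, K (ZMod.toAddCircle j) + ∑ j : ZMod N, K' (ZMod.toAddCircle j),
    fun s h0 h1 him ↦ ?_⟩
  have hN : ‖(N : ℂ) ^ (-s)‖ ≤ 1 := by
    rw [Complex.norm_natCast_cpow_of_pos (NeZero.pos N)]
    exact Real.rpow_le_one_of_one_le_of_nonpos (by exact_mod_cast NeZero.one_le) (by simpa)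
  have key (g : ZMod N → ℂ) (B : ZMod N → ℝ) (h : ∀ j, ‖g j‖ ≤ B j) :
      ‖(N : ℂ) ^ (-s) * ∑ j, χ j * g j‖ ≤ ∑ j, B j := by
    rw [norm_mul]
    refine (mul_le_of_le_one_left (norm_nonneg _) hN).trans ?_
    refine (norm_sum_le _ _).trans (Finset.sum_le_sum fun j _ ↦ ?_)
    rw [norm_mul]
    exact (mul_le_of_le_one_left (norm_nonneg _) (χ.norm_le_one j)).trans (h j)
  rw [completedLFunction, ZMod.completedLFunction]
  exact (norm_add_le _ _).trans (add_le_add (key _ _ fun j ↦ hK _ s h0 h1 him)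
    (key _ _ fun j ↦ hK' _ s h0 h1))

end DirichletCharacter

open Complex in
lemma Complex.norm_sin_le_exp (z : ℂ) : ‖sin z‖ ≤ Real.exp |z.im| := by
  have h1 : ‖exp (-z * I)‖ ≤ Real.exp |z.im| := by
    rw [norm_exp]; gcongr; simpa using le_abs_self z.im
  have h2 : ‖exp (z * I)‖ ≤ Real.exp |z.im| := by
    rw [norm_exp]; gcongr; simpa using neg_le_abs z.im
  rw [sin, norm_div, norm_mul, norm_I, Complex.norm_two, mul_one]
  have := norm_sub_le (exp (-z * I)) (exp (z * I))
  linarith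

open Complex in
lemma Complex.norm_Gamma_le_Gamma_re {z : ℂ} (hz : 0 < z.re) : ‖Gamma z‖ ≤ Real.Gamma z.re := by
  rw [Gamma_eq_integral hz, GammaIntegral, Real.Gamma_eq_integral hz]
  refine (MeasureTheory.norm_integral_le_integral_norm _).trans_eq ?_
  refine MeasureTheory.setIntegral_congr_fun measurableSet_Ioi fun t (ht : 0 < t) ↦ ?_
  simp [Complex.norm_cpow_eq_rpow_re_of_pos ht, norm_exp]

open Complex in
lemma Complex.norm_inv_Gamma_le {z : ℂ} (h0 : 0 ≤ z.re) (h1 : z.re ≤ 1) (him : 1 / 2 ≤ |z.im|) :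
    ‖(Gamma z)⁻¹‖ ≤ Real.exp (Real.pi * |z.im|) := by
  have hz : z ≠ 0 := by rintro rfl; norm_num at him
  have hz1 : 1 / 2 ≤ ‖1 - z‖ := him.trans (by simpa using Complex.abs_im_le_norm (1 - z))
  have hz1' : 1 - z ≠ 0 := by intro h; rw [h] at hz1; norm_num at hz1
  have him' : z.im ≠ 0 := by intro h; rw [h] at him; norm_num at him
  have hG : Gamma z ≠ 0 := by
    refine Gamma_ne_zero fun m h ↦ him' ?_
    rw [h]; simp
  have hsin : sin (Real.pi * z) ≠ 0 := by
    refine sin_ne_zero_iff.2 fun k h ↦ him' ?_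
    have : z = k := by
      have hpi : (Real.pi : ℂ) ≠ 0 := by exact_mod_cast Real.pi_ne_zero
      apply mul_left_cancel₀ hpi; rw [h]; ring
    rw [this]; simp
  have hG1 : ‖Gamma (1 - z)‖ ≤ 2 := by
    have h2 : ‖Gamma (1 - z + 1)‖ ≤ 1 := by
      have hre : (1 - z + 1).re = 2 - z.re := by simp; ring
      refine (norm_Gamma_le_Gamma_re (by rw [hre]; linarith)).trans ?_
      rw [hre]
      have := Real.convexOn_Gamma.2 (show (1 : ℝ) ∈ Set.Ioi 0 by simp)
        (show (2 : ℝ) ∈ Set.Ioi 0 by simp) h0 (show 0 ≤ 1 - z.re by linarith) (by ring)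
      simp only [smul_eq_mul, Real.Gamma_one, Real.Gamma_two] at this
      calc _ = Real.Gamma (z.re * 1 + (1 - z.re) * 2) := by ring_nf
        _ ≤ _ := this
        _ = 1 := by ring
    rw [Gamma_add_one _ hz1', norm_mul] at h2
    nlinarith [norm_nonneg (Gamma (1 - z))]
  have hrefl := Gamma_mul_Gamma_one_sub z
  have heq : (Gamma z)⁻¹ = Gamma (1 - z) * sin (Real.pi * z) / Real.pi := by
    have hpi : (Real.pi : ℂ) ≠ 0 := by exact_mod_cast Real.pi_ne_zero
    rw [eq_div_iff hsin] at hrefl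
    rw [eq_div_iff hpi, inv_mul_eq_iff_eq_mul₀ hG]
    linear_combination -hrefl
  rw [heq, norm_div, norm_mul, norm_real, Real.norm_of_nonneg Real.pi_pos.le,
    div_le_iff₀ Real.pi_pos]
  have hs := norm_sin_le_exp (Real.pi * z)
  rw [im_ofReal_mul, abs_mul, abs_of_pos Real.pi_pos] at hs
  calc _ ≤ 2 * Real.exp (Real.pi * |z.im|) := by gcongr
    _ ≤ _ := by rw [mul_comm]; gcongr; linarith [Real.pi_gt_three]

open Complex in
lemma Complex.norm_inv_Gammaℝ_le {s : ℂ} (h0 : 0 ≤ s.re) (h2 : s.re ≤ 2) (him : 1 ≤ |s.im|) :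
    ‖(Gammaℝ s)⁻¹‖ ≤ Real.pi * Real.exp (Real.pi / 2 * |s.im|) := by
  have hre : (s / 2).re = s.re / 2 := by simp
  have him2 : (s / 2).im = s.im / 2 := by simp
  have habs : |(s / 2).im| = |s.im| / 2 := by rw [him2, abs_div, abs_two]
  have h := norm_inv_Gamma_le (z := s / 2) (by rw [hre]; linarith) (by rw [hre]; linarith)
    (by rw [habs]; linarith)
  rw [habs] at h
  rw [Gammaℝ_def, mul_inv, norm_mul]
  refine mul_le_mul ?_ (h.trans_eq (by ring_nf)) (norm_nonneg _) Real.pi_pos.le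
  rw [norm_inv, norm_cpow_eq_rpow_re_of_pos Real.pi_pos, ← Real.rpow_neg Real.pi_pos.le]
  conv_rhs => rw [← Real.rpow_one Real.pi]
  refine Real.rpow_le_rpow_of_exponent_le (by linarith [Real.pi_gt_three]) ?_
  simp; linarith

open Complex ComplexConjugate in
lemma Complex.norm_Gamma_half_add_sq (y : ℝ) :
    ‖Gamma (1 / 2 + y * I)‖ ^ 2 = Real.pi / Real.cosh (Real.pi * y) := by
  have h := Gamma_mul_Gamma_one_sub (1 / 2 + y * I)
  have hc : 1 - (1 / 2 + y * I) = conj (1 / 2 + y * I) := by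
    apply Complex.ext <;> simp; norm_num
  have hs : sin (Real.pi * (1 / 2 + y * I)) = Real.cosh (Real.pi * y) := by
    rw [show Real.pi * (1 / 2 + y * I) = ((Real.pi * y : ℝ) : ℂ) * I + Real.pi / 2 by
      push_cast; ring, sin_add_pi_div_two, cos_mul_I, ofReal_cosh]
  rw [hc, Gamma_conj, mul_conj, normSq_eq_norm_sq, hs] at h
  exact_mod_cast h

open Complex ComplexConjugate in
lemma Complex.norm_Gamma_one_add_sq {y : ℝ} (hy : y ≠ 0) :
    ‖Gamma (1 + y * I)‖ ^ 2 = Real.pi * y / Real.sinh (Real.pi * y) := by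
  have hyI : (y : ℂ) * I ≠ 0 := by simp [hy]
  have h := Gamma_mul_Gamma_one_sub (y * I)
  have hc : 1 - y * I = conj (1 + y * I) := by
    apply Complex.ext <;> simp
  have hs : sin (Real.pi * (y * I)) = Real.sinh (Real.pi * y) * I := by
    rw [show Real.pi * (y * I) = ((Real.pi * y : ℝ) : ℂ) * I by push_cast; ring, sin_mul_I,
      ofReal_sinh]
  have hmul : (y * I) * (Gamma (y * I) * conj (Gamma (1 + y * I))) =
      Gamma (1 + y * I) * conj (Gamma (1 + y * I)) := by
    rw [add_comm 1, Gamma_add_one _ hyI]; ring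
  rw [hc, Gamma_conj, hs] at h
  rw [h, mul_conj, normSq_eq_norm_sq] at hmul
  have hsne : (Real.sinh (Real.pi * y) : ℂ) ≠ 0 := by
    exact_mod_cast fun h ↦ hy (by simpa [Real.pi_ne_zero] using h)
  have hmul' : ((‖Gamma (1 + y * I)‖ ^ 2 : ℝ) : ℂ) =
      ((Real.pi * y / Real.sinh (Real.pi * y) : ℝ) : ℂ) := by
    rw [← hmul]; push_cast at hsne ⊢; field_simp
  exact_mod_cast hmul'

lemma Real.mul_cosh_le_mul_sinh {y : ℝ} (hy : 0 ≤ y) :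
    Real.pi * y * Real.cosh (Real.pi * y) ≤ (Real.pi * y + 1) * Real.sinh (Real.pi * y) := by
  have hu : 0 ≤ Real.pi * y := by positivity
  have h1 : Real.cosh (Real.pi * y) - Real.sinh (Real.pi * y) ≤ 1 := by
    rw [Real.cosh_sub_sinh]; exact Real.exp_le_one_iff.2 (by linarith)
  have h2 : Real.pi * y ≤ Real.sinh (Real.pi * y) := Real.self_le_sinh_iff.2 hu
  nlinarith [mul_le_mul_of_nonneg_left h1 hu]

open Complex ComplexConjugate in
lemma Complex.norm_Gamma_half_sub (y : ℝ) :
    ‖Gamma (1 / 2 - y * I)‖ = ‖Gamma (1 / 2 + y * I)‖ := by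
  have hc : (1 / 2 - y * I) = conj (1 / 2 + y * I) := by
    apply Complex.ext <;> simp
  rw [hc, Gamma_conj, norm_conj]

open Complex ComplexConjugate in
lemma Complex.norm_Gamma_one_sub (y : ℝ) :
    ‖Gamma (1 - y * I)‖ = ‖Gamma (1 + y * I)‖ := by
  have hc : (1 - y * I) = conj (1 + y * I) := by
    apply Complex.ext <;> simp
  rw [hc, Gamma_conj, norm_conj]

open Complex in
/-- Comparison of `Γ(1/2 - iy)` and `Γ(iy)`. -/
lemma Complex.norm_Gamma_half_sub_le {y : ℝ} (hy : y ≠ 0) :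
    ‖Gamma (1 / 2 - y * I)‖ ≤ √|y| * ‖Gamma (y * I)‖ := by
  have hB : ‖Gamma (1 + y * I)‖ = |y| * ‖Gamma (y * I)‖ := by
    rw [add_comm, Gamma_add_one _ (by simp [hy])]
    simp
  have hB2 := norm_Gamma_one_add_sq hy
  have hy' : 0 < |y| := abs_pos.2 hy
  have hsinh : 0 < Real.sinh (Real.pi * |y|) := Real.sinh_pos_iff.2 (by positivity)
  have heven : y / Real.sinh (Real.pi * y) = |y| / Real.sinh (Real.pi * |y|) := by
    rcases abs_choice y with h | h <;> rw [h]
    simp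
  rw [hB, mul_div_assoc, mul_pow, heven] at hB2
  have hG : |y| * ‖Gamma (y * I)‖ ^ 2 = Real.pi / Real.sinh (Real.pi * |y|) := by
    apply mul_left_cancel₀ hy'.ne'
    rw [← mul_assoc, ← sq, hB2]
    ring
  refine (sq_le_sq₀ (norm_nonneg _) (by positivity)).1 ?_
  rw [norm_Gamma_half_sub, norm_Gamma_half_add_sq, mul_pow, Real.sq_sqrt hy'.le, hG,
    ← Real.cosh_abs, abs_mul, abs_of_pos Real.pi_pos]
  gcongr
  exact (Real.sinh_lt_cosh _).le

open Complex in
/-- Comparison of `Γ(1 - iy)` and `Γ(1/2 + iy)`. -/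
lemma Complex.norm_Gamma_one_sub_le (y : ℝ) :
    ‖Gamma (1 - y * I)‖ ≤ √(|y| + 1) * ‖Gamma (1 / 2 + y * I)‖ := by
  rw [norm_Gamma_one_sub]
  refine (sq_le_sq₀ (norm_nonneg _) (by positivity)).1 ?_
  rw [mul_pow, Real.sq_sqrt (by positivity), norm_Gamma_half_add_sq]
  rcases eq_or_ne y 0 with rfl | hy
  · simpa using by linarith [Real.pi_gt_three]
  have hy' : 0 < |y| := abs_pos.2 hy
  have hsinh : 0 < Real.sinh (Real.pi * |y|) := Real.sinh_pos_iff.2 (by positivity)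
  have heven : y / Real.sinh (Real.pi * y) = |y| / Real.sinh (Real.pi * |y|) := by
    rcases abs_choice y with h | h <;> rw [h]
    simp
  have heven' : Real.cosh (Real.pi * y) = Real.cosh (Real.pi * |y|) := by
    rw [← Real.cosh_abs, abs_mul, abs_of_pos Real.pi_pos]
  rw [norm_Gamma_one_add_sq hy, mul_div_assoc, heven, heven', ← mul_div_assoc, ← mul_div_assoc,
    div_le_div_iff₀ hsinh (Real.cosh_pos _)]
  have := Real.mul_cosh_le_mul_sinh hy'.le
  nlinarith [Real.pi_gt_three]

open Complex in
lemma Complex.norm_Gammaℝ (s : ℂ) :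
    ‖Gammaℝ s‖ = Real.pi ^ (-(s.re / 2)) * ‖Gamma (s / 2)‖ := by
  rw [Gammaℝ_def, norm_mul, norm_cpow_eq_rpow_re_of_pos Real.pi_pos]
  simp [neg_div]

open Complex in
lemma Complex.norm_Gammaℝ_one_sub_le {t : ℝ} (ht : t ≠ 0) :
    ‖Gammaℝ (1 - t * I)‖ ≤ √(|t| + 2) * ‖Gammaℝ (t * I)‖ := by
  have h := norm_Gamma_half_sub_le (y := t / 2) (by simpa using ht)
  have e1 : (1 - t * I) / 2 = 1 / 2 - (t / 2 : ℝ) * I := by push_cast; ring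
  have e2 : t * I / 2 = (t / 2 : ℝ) * I := by push_cast; ring
  have ht := abs_nonneg t
  rw [norm_Gammaℝ, norm_Gammaℝ, e1, e2]
  calc _ ≤ 1 * ‖Gamma (1 / 2 - (t / 2 : ℝ) * I)‖ := by
        gcongr
        exact Real.rpow_le_one_of_one_le_of_nonpos (by linarith [Real.pi_gt_three]) (by simp)
    _ ≤ √|t / 2| * ‖Gamma ((t / 2 : ℝ) * I)‖ := by rwa [one_mul]
    _ ≤ √(|t| + 2) * ‖Gamma ((t / 2 : ℝ) * I)‖ := by
        gcongr
        rw [abs_div, abs_two]; linarith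
    _ = _ := by simp

open Complex in
lemma Complex.norm_Gammaℝ_two_sub_le (t : ℝ) :
    ‖Gammaℝ (1 - t * I + 1)‖ ≤ √(|t| + 2) * ‖Gammaℝ (t * I + 1)‖ := by
  have h := norm_Gamma_one_sub_le (t / 2)
  have e1 : (1 - t * I + 1) / 2 = 1 - (t / 2 : ℝ) * I := by push_cast; ring
  have e2 : (t * I + 1) / 2 = 1 / 2 + (t / 2 : ℝ) * I := by push_cast; ring
  have ht := abs_nonneg t
  rw [norm_Gammaℝ, norm_Gammaℝ, e1, e2]
  calc _ ≤ Real.pi ^ (-((t * I + 1 : ℂ).re / 2)) * ‖Gamma (1 - (t / 2 : ℝ) * I)‖ := by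
        refine mul_le_mul_of_nonneg_right (Real.rpow_le_rpow_of_exponent_le
          (by linarith [Real.pi_gt_three]) ?_) (norm_nonneg _)
        simp; norm_num
    _ ≤ Real.pi ^ (-((t * I + 1 : ℂ).re / 2)) *
          (√(|t| + 2) * ‖Gamma (1 / 2 + (t / 2 : ℝ) * I)‖) := by
        gcongr
        refine h.trans ?_
        refine mul_le_mul_of_nonneg_right (Real.sqrt_le_sqrt ?_) (norm_nonneg _)
        rw [abs_div, abs_two]; linarith
    _ = _ := by ring

namespace DirichletCharacter

lemma sum_range_eq_zero {r : ℕ} [NeZero r] {χ : DirichletCharacter ℂ r} (hχ : χ ≠ 1) :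
    ∑ k ∈ Finset.range r, χ (k : ZMod r) = 0 := by
  rw [← χ.sum_eq_zero_of_ne_one hχ]
  refine Finset.sum_nbij' (fun k ↦ (k : ZMod r)) (fun a ↦ a.val) (by simp) ?_ ?_ (by simp) (by simp)
  · intro a _; simpa using ZMod.val_lt a
  · intro k hk; exact ZMod.val_cast_of_lt (by simpa using hk)

/-- Partial sums of a non-principal character are bounded by the modulus. -/
lemma norm_sum_range_le {r : ℕ} [NeZero r] {χ : DirichletCharacter ℂ r} (hχ : χ ≠ 1) (n : ℕ) :
    ‖∑ k ∈ Finset.range n, χ (k : ZMod r)‖ ≤ r := by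
  have hper : Function.Periodic (fun n ↦ ∑ k ∈ Finset.range n, χ (k : ZMod r)) r := by
    intro n
    induction n with
    | zero => simpa using sum_range_eq_zero hχ
    | succ n ih =>
      have : n + 1 + r = (n + r) + 1 := by ring
      simp only [this, Finset.sum_range_succ] at ih ⊢
      rw [ih]; simp
  rw [← hper.map_mod_nat n]
  refine (norm_sum_le _ _).trans ?_
  refine (Finset.sum_le_card_nsmul _ _ 1 fun k _ ↦ χ.norm_le_one _).trans ?_
  simpa using (Nat.mod_lt n (NeZero.pos r)).le

lemma norm_sum_Ioc_le {r : ℕ} [NeZero r] {χ : DirichletCharacter ℂ r} (hχ : χ ≠ 1) (N n : ℕ) :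
    ‖∑ k ∈ Finset.Ioc N n, χ (k : ZMod r)‖ ≤ 2 * r := by
  rcases le_total N n with h | h
  · have : ∑ k ∈ Finset.Ioc N n, χ (k : ZMod r) =
        ∑ k ∈ Finset.range (n + 1), χ (k : ZMod r) - ∑ k ∈ Finset.range (N + 1), χ (k : ZMod r) := by
      rw [← Finset.sum_Ico_eq_sub _ (by omega)]
      congr 1; ext; simp
    rw [this]
    refine (norm_sub_le _ _).trans ?_
    linarith [norm_sum_range_le hχ (n + 1), norm_sum_range_le hχ (N + 1)]
  · simp [Finset.Ioc_eq_empty_of_le h]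

open Finset in
lemma norm_LSeries_indicator_Ioi_le {r : ℕ} [NeZero r] {χ : DirichletCharacter ℂ r} (hχ : χ ≠ 1)
    {N : ℕ} (hN : 0 < N) {s : ℂ} (hs : 1 < s.re) :
    ‖LSeries ((Set.Ioi N).indicator fun n ↦ χ n) s‖ ≤ ‖s‖ * (2 * r / N) := by
  set g : ℕ → ℂ := (Set.Ioi N).indicator fun n ↦ χ n with hg
  have hsum (n : ℕ) : ∑ k ∈ Icc 1 n, g k = ∑ k ∈ Ioc N n, χ (k : ZMod r) := by
    rw [hg, Finset.sum_indicator_eq_sum_filter]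
    congr 1; ext; simp; omega
  have hsmb : LSeriesSummable g s := by
    refine LSeriesSummable_of_bounded_of_one_lt_re (m := 1) (fun n _ ↦ ?_) hs
    rw [hg]
    exact (norm_indicator_le_norm_self _ _).trans (χ.norm_le_one _)
  rw [LSeries_eq_mul_integral g le_rfl (by linarith) hsmb, norm_mul]
  · have hN1 : (0 : ℝ) < N := by exact_mod_cast hN
    gcongr
    have hint : MeasureTheory.IntegrableOn (fun t : ℝ ↦ 2 * (r : ℝ) * t ^ (-2 : ℝ))
        (Set.Ioi (N : ℝ)) :=
      (integrableOn_Ioi_rpow_of_lt (by norm_num) hN1).const_mul _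
    calc _ ≤ ∫ t in Set.Ioi (1 : ℝ),
          (Set.Ioi (N : ℝ)).indicator (fun t : ℝ ↦ 2 * (r : ℝ) * t ^ (-2 : ℝ)) t := by
          refine MeasureTheory.norm_integral_le_of_norm_le
            (hint.integrable_indicator measurableSet_Ioi).integrableOn ?_
          filter_upwards [MeasureTheory.ae_restrict_mem measurableSet_Ioi] with t (ht : 1 < t)
          rw [hsum, norm_mul]
          have ht0 : 0 < t := by linarith
          by_cases htN : (N : ℝ) < t
          · rw [Set.indicator_of_mem (show t ∈ Set.Ioi (N : ℝ) from htN)]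
            gcongr
            · exact norm_sum_Ioc_le hχ _ _
            · rw [Complex.norm_cpow_eq_rpow_re_of_pos ht0]
              exact Real.rpow_le_rpow_of_exponent_le ht.le (by simp; linarith)
          · rw [Set.indicator_of_notMem (show t ∉ Set.Ioi (N : ℝ) from htN),
              Ioc_eq_empty_of_le (Nat.floor_le_of_le (not_lt.1 htN))]
            simp
      _ ≤ ∫ t in Set.Ioi (N : ℝ), 2 * (r : ℝ) * t ^ (-2 : ℝ) := by
          rw [MeasureTheory.setIntegral_indicator measurableSet_Ioi]
          refine MeasureTheory.setIntegral_mono_set hint ?_ (Filter.Eventually.of_forall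
            fun t ht ↦ ht.2)
          filter_upwards [MeasureTheory.ae_restrict_mem measurableSet_Ioi] with t (ht : N < t)
          have : 0 < t := hN1.trans ht
          simp only [Pi.zero_apply]; positivity
      _ = 2 * r / N := by
          rw [MeasureTheory.integral_const_mul, integral_Ioi_rpow_of_lt (by norm_num) hN1]
          norm_num [Real.rpow_neg_one]
          ring
  · refine Asymptotics.IsBigO.of_bound (2 * r) (Filter.Eventually.of_forall fun n ↦ ?_)
    rw [hsum]
    simpa using norm_sum_Ioc_le hχ N n

open Finset in
lemma norm_LSeries_indicator_Iic_le {r : ℕ} (χ : DirichletCharacter ℂ r)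
    (N : ℕ) {s : ℂ} (hs : 1 < s.re) :
    ‖LSeries ((Set.Iic N).indicator fun n ↦ χ n) s‖ ≤ 1 + Real.log N := by
  have : LSeries ((Set.Iic N).indicator fun n ↦ χ n) s =
      ∑ n ∈ Icc 1 N, LSeries.term (fun n ↦ χ n) s n := by
    rw [LSeries, tsum_eq_sum (s := Icc 1 N)]
    · refine Finset.sum_congr rfl fun n hn ↦ ?_
      rw [mem_Icc] at hn
      simp [LSeries.term, Set.indicator, hn.2]
    · intro n hn
      rcases Nat.eq_zero_or_pos n with rfl | h
      · simp
      · have : ¬ n ≤ N := by rw [mem_Icc] at hn; omega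
        simp [LSeries.term, Set.indicator, this]
  rw [this]
  refine (norm_sum_le _ _).trans ?_
  have h := harmonic_le_one_add_log N
  rw [harmonic_eq_sum_Icc] at h
  push_cast at h
  refine le_trans (Finset.sum_le_sum fun n hn ↦ ?_) h
  rw [mem_Icc] at hn
  have hn1 : (1 : ℝ) ≤ n := by exact_mod_cast hn.1
  rw [LSeries.norm_term_eq, if_neg (by omega), inv_eq_one_div]
  gcongr
  · exact χ.norm_le_one _
  · exact Real.self_le_rpow_of_one_le hn1 hs.le

lemma _root_.Real.half_le_log_of_two_le {x : ℝ} (hx : 2 ≤ x) : 1 / 2 ≤ Real.log x := by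
  have := Real.log_le_log (by norm_num) hx
  linarith [Real.log_two_gt_d9]

lemma norm_LFunction_one_add_le {r : ℕ} [NeZero r] {χ : DirichletCharacter ℂ r} (hχ : χ ≠ 1)
    (t : ℝ) : ‖LFunction χ (1 + t * Complex.I)‖ ≤ 9 * Real.log (r * (|t| + 2)) := by
  have hr : (1 : ℝ) ≤ r := by exact_mod_cast NeZero.one_le
  have ht := abs_nonneg t
  have hX : 2 ≤ (r : ℝ) * (|t| + 2) := by nlinarith
  have key (σ : ℝ) (h1 : 1 < σ) (h2 : σ < 2) :
      ‖LFunction χ (σ + t * Complex.I)‖ ≤ 9 * Real.log (r * (|t| + 2)) := by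
    set s : ℂ := σ + t * Complex.I with hs
    have hsre : s.re = σ := by simp [hs]
    set N : ℕ := r * (⌈|t|⌉₊ + 2) with hN
    have hN0 : 0 < N := Nat.mul_pos (NeZero.pos r) (by omega)
    have hs1 : 1 < s.re := by rwa [hsre]
    have hsum (S : Set ℕ) : LSeriesSummable (S.indicator fun n ↦ χ n) s := by
      refine LSeriesSummable_of_bounded_of_one_lt_re (m := 1) (fun n _ ↦ ?_) hs1
      exact (norm_indicator_le_norm_self _ _).trans (χ.norm_le_one _)
    have hsplit : (fun n : ℕ ↦ χ n) =
        (Set.Iic N).indicator (fun n ↦ χ n) + (Set.Ioi N).indicator (fun n ↦ χ n) := by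
      rw [← Set.compl_Iic, Set.indicator_self_add_compl]
    rw [LFunction_eq_LSeries χ hs1, hsplit, LSeries_add (hsum _) (hsum _)]
    have hA := norm_LSeries_indicator_Iic_le χ N hs1
    have hB := norm_LSeries_indicator_Ioi_le hχ hN0 hs1
    have hnorm : ‖s‖ ≤ |t| + 2 := by
      refine (norm_add_le _ _).trans ?_
      rw [norm_mul, Complex.norm_I, Complex.norm_real, Complex.norm_real, Real.norm_eq_abs,
        Real.norm_eq_abs, abs_of_pos (by linarith)]
      linarith
    have hNle : (N : ℝ) ≤ 2 * (r * (|t| + 2)) := by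
      have := (Nat.ceil_lt_add_one ht).le
      rw [hN]; push_cast; nlinarith
    have hNge : r * (|t| + 2) ≤ (N : ℝ) := by
      have := Nat.le_ceil |t|
      rw [hN]; push_cast; gcongr
    have hlog : Real.log N ≤ Real.log 2 + Real.log (r * (|t| + 2)) := by
      rw [← Real.log_mul (by norm_num) (by positivity)]
      exact Real.log_le_log (by exact_mod_cast hN0) hNle
    have hB' : ‖s‖ * (2 * r / N) ≤ 2 := by
      have hNpos : (0 : ℝ) < N := by exact_mod_cast hN0
      rw [← mul_div_assoc, div_le_iff₀ hNpos]
      nlinarith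
    have := Real.half_le_log_of_two_le hX
    refine (norm_add_le _ _).trans ?_
    linarith [Real.log_two_lt_d9]
  have hcont : Continuous fun σ : ℝ ↦ ‖LFunction χ (σ + t * Complex.I)‖ :=
    ((differentiable_LFunction hχ).continuous.comp (by fun_prop)).norm
  have hlim : Filter.Tendsto (fun σ : ℝ ↦ ‖LFunction χ (σ + t * Complex.I)‖)
      (nhdsWithin 1 (Set.Ioi 1)) (nhds ‖LFunction χ (1 + t * Complex.I)‖) := by
    have := (hcont.tendsto 1).mono_left (nhdsWithin_le_nhds (s := Set.Ioi 1))
    simpa using this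
  refine le_of_tendsto hlim ?_
  filter_upwards [Ioo_mem_nhdsGT (show (1 : ℝ) < 2 by norm_num)] with σ hσ using key σ hσ.1 hσ.2

lemma Even.inv {N : ℕ} {χ : DirichletCharacter ℂ N} (h : χ.Even) : χ⁻¹.Even := by
  have h' : χ (-1) = 1 := h
  rw [DirichletCharacter.Even, MulChar.inv_apply_eq_inv', h', inv_one]

lemma Odd.inv {N : ℕ} {χ : DirichletCharacter ℂ N} (h : χ.Odd) : χ⁻¹.Odd := by
  have h' : χ (-1) = -1 := h
  rw [DirichletCharacter.Odd, MulChar.inv_apply_eq_inv', h', inv_neg, inv_one]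

lemma IsPrimitive.inv {N : ℕ} {χ : DirichletCharacter ℂ N} (h : χ.IsPrimitive) :
    χ⁻¹.IsPrimitive := by
  rwa [isPrimitive_def, conductor_inv]

open ZMod in
lemma norm_gaussSum_inv {N : ℕ} [NeZero N] (χ : DirichletCharacter ℂ N) :
    ‖gaussSum χ⁻¹ (stdAddChar (N := N))‖ = ‖gaussSum χ (stdAddChar (N := N))‖ := by
  have h1 : χ (-1) * gaussSum χ (stdAddChar (N := N))⁻¹ = gaussSum χ stdAddChar := by
    rw [AddChar.inv_mulShift, ← Units.coe_neg_one]
    exact gaussSum_mulShift χ _ (-1)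
  have h2 : ‖χ (-1)‖ = 1 := by
    rw [← Units.coe_neg_one]; exact χ.unit_norm_eq_one _
  have h3 := star_gaussSum_eq χ⁻¹ (stdAddChar (N := N))
  rw [inv_inv] at h3
  rw [← h1, norm_mul, h2, one_mul, ← h3, norm_star]

lemma norm_rootNumber {N : ℕ} [NeZero N] (χ : DirichletCharacter ℂ N) :
    ‖rootNumber χ‖ = ‖gaussSum χ (ZMod.stdAddChar (N := N))‖ / ‖(N : ℂ) ^ (1 / 2 : ℂ)‖ := by
  rw [rootNumber, norm_div, norm_div, norm_pow, Complex.norm_I, one_pow, div_one]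

/-- The completed L-function does not vanish at `2`. -/
lemma completedLFunction_two_ne_zero {N : ℕ} [NeZero N] (χ : DirichletCharacter ℂ N) :
    completedLFunction χ 2 ≠ 0 := by
  intro h
  have h1 := LFunction_eq_completed_div_gammaFactor χ 2 (Or.inl two_ne_zero)
  rw [h, zero_div] at h1
  exact LFunction_ne_zero_of_one_le_re χ (s := 2) (Or.inr (by norm_num)) (by norm_num) h1

/-- The root number of a primitive character has absolute value one. -/
lemma IsPrimitive.norm_rootNumber_eq_one {N : ℕ} [NeZero N] {χ : DirichletCharacter ℂ N}
    (h : χ.IsPrimitive) : ‖rootNumber χ‖ = 1 := by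
  have h1 := h.completedLFunction_one_sub 2
  have h2 := h.inv.completedLFunction_one_sub (1 - 2)
  rw [sub_sub_cancel, inv_inv, h1, ← mul_assoc] at h2
  have hN : (N : ℂ) ≠ 0 := by exact_mod_cast NeZero.ne N
  have h3 : (N : ℂ) ^ (1 - 2 - 1 / 2 : ℂ) * (N : ℂ) ^ (2 - 1 / 2 : ℂ) = 1 := by
    rw [← Complex.cpow_add _ _ hN]; norm_num
  have h4 : rootNumber χ⁻¹ * rootNumber χ = 1 := by
    apply mul_right_cancel₀ (completedLFunction_two_ne_zero χ⁻¹)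
    linear_combination -h2 - rootNumber χ⁻¹ * rootNumber χ * completedLFunction χ⁻¹ 2 * h3
  have h5 := congrArg norm h4
  rw [norm_mul, norm_rootNumber χ⁻¹, norm_gaussSum_inv, ← norm_rootNumber, norm_one] at h5
  nlinarith [norm_nonneg (rootNumber χ)]

/-- The functional equation as an inequality relating the lines `re s = 0` and `re s = 1`. -/
lemma IsPrimitive.norm_LFunction_mul_I_le {N : ℕ} [NeZero N] {χ : DirichletCharacter ℂ N}
    (h : χ.IsPrimitive) (hN : N ≠ 1) (t : ℝ) :
    ‖LFunction χ (t * Complex.I)‖ ≤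
      √(N * (|t| + 2)) * ‖LFunction χ⁻¹ (1 - t * Complex.I)‖ := by
  have hfe := h.completedLFunction_one_sub (1 - t * Complex.I)
  have hNpos : (0 : ℝ) < N := by exact_mod_cast NeZero.pos N
  have hpow : ‖(N : ℂ) ^ (1 - t * Complex.I - 1 / 2 : ℂ)‖ = √N := by
    rw [Complex.norm_natCast_cpow_of_pos (NeZero.pos N), Real.sqrt_eq_rpow]
    norm_num
  rw [sub_sub_cancel] at hfe
  have hL := LFunction_eq_completed_div_gammaFactor χ (t * Complex.I) (Or.inr hN)
  have hL' := LFunction_eq_completed_div_gammaFactor χ⁻¹ (1 - t * Complex.I) (Or.inr hN)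
  have main (g g' : ℂ) (hg : g ≠ 0) (hg' : g' ≠ 0) (hle : ‖g'‖ ≤ √(|t| + 2) * ‖g‖)
      (e : LFunction χ (t * Complex.I) = completedLFunction χ (t * Complex.I) / g)
      (e' : LFunction χ⁻¹ (1 - t * Complex.I) = completedLFunction χ⁻¹ (1 - t * Complex.I) / g') :
      ‖LFunction χ (t * Complex.I)‖ ≤
        √(N * (|t| + 2)) * ‖LFunction χ⁻¹ (1 - t * Complex.I)‖ := by
    rw [eq_div_iff hg'] at e'
    rw [e, hfe, ← e', norm_div, norm_mul, norm_mul, norm_mul, hpow, h.norm_rootNumber_eq_one,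
      mul_one, div_le_iff₀ (norm_pos_iff.2 hg), Real.sqrt_mul hNpos.le]
    calc _ ≤ √N * (‖LFunction χ⁻¹ (1 - t * Complex.I)‖ * (√(|t| + 2) * ‖g‖)) := by gcongr
      _ = _ := by ring
  rcases χ.even_or_odd with hχ | hχ
  · rw [hχ.gammaFactor_def] at hL
    rw [hχ.inv.gammaFactor_def] at hL'
    rcases eq_or_ne t 0 with rfl | ht
    · have : Complex.Gammaℝ ((0 : ℝ) * Complex.I) = 0 :=
        Complex.Gammaℝ_eq_zero_iff.2 ⟨0, by simp⟩
      rw [hL, this, div_zero, norm_zero]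
      positivity
    · refine main _ _ ?_ (Complex.Gammaℝ_ne_zero_of_re_pos (by simp))
        (Complex.norm_Gammaℝ_one_sub_le ht) hL hL'
      rw [Ne, Complex.Gammaℝ_eq_zero_iff]
      rintro ⟨n, hn⟩
      have := congrArg Complex.im hn
      simp at this
      exact ht this
  · rw [hχ.gammaFactor_def] at hL
    rw [hχ.inv.gammaFactor_def] at hL'
    exact main _ _ (Complex.Gammaℝ_ne_zero_of_re_pos (by simp))
      (Complex.Gammaℝ_ne_zero_of_re_pos (by simp))
      (Complex.norm_Gammaℝ_two_sub_le t) hL hL'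

lemma IsPrimitive.norm_LFunction_mul_I_le_log {N : ℕ} [NeZero N] {χ : DirichletCharacter ℂ N}
    (h : χ.IsPrimitive) (hχ : χ ≠ 1) (t : ℝ) :
    ‖LFunction χ (t * Complex.I)‖ ≤
      √(N * (|t| + 2)) * (9 * Real.log (N * (|t| + 2))) := by
  refine (h.norm_LFunction_mul_I_le (fun hN ↦ hχ (level_one' _ hN)) t).trans ?_
  gcongr
  have := norm_LFunction_one_add_le (inv_ne_one.2 hχ) (-t)
  rw [abs_neg] at this
  simpa [sub_eq_add_neg] using this

/-- A Dirichlet L-function grows at most exponentially on `0 ≤ re s ≤ 1`. -/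
lemma exists_norm_LFunction_le_exp {N : ℕ} [NeZero N] (χ : DirichletCharacter ℂ N) :
    ∃ K : ℝ, ∀ s : ℂ, 0 ≤ s.re → s.re ≤ 1 → 1 ≤ |s.im| →
      ‖LFunction χ s‖ ≤ K * Real.exp (Real.pi / 2 * |s.im|) := by
  obtain ⟨K, hK⟩ := exists_norm_completedLFunction_le χ
  refine ⟨K * Real.pi, fun s h0 h1 him ↦ ?_⟩
  have hs : s ≠ 0 := by rintro rfl; norm_num at him
  have hg : ‖(gammaFactor χ s)⁻¹‖ ≤ Real.pi * Real.exp (Real.pi / 2 * |s.im|) := by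
    rcases χ.even_or_odd with hχ | hχ <;> rw [hχ.gammaFactor_def]
    · exact Complex.norm_inv_Gammaℝ_le h0 (by linarith) him
    · have := Complex.norm_inv_Gammaℝ_le (s := s + 1) (by simp; linarith) (by simp; linarith)
        (by simpa)
      simpa using this
  rw [LFunction_eq_completed_div_gammaFactor χ s (Or.inl hs), div_eq_mul_inv, norm_mul, mul_assoc]
  have := hK s h0 h1 him
  exact mul_le_mul this hg (norm_nonneg _) ((norm_nonneg _).trans this)

/-- Change of height: with `X = N (|t₀| + 2)`, the analytic conductor at height `t` is at most
`X (1 + |t - t₀|)`. -/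
lemma conductor_height_le {N : ℝ} (hN : 1 ≤ N) (t t₀ : ℝ) :
    N * (|t| + 2) ≤ N * (|t₀| + 2) * (1 + |t - t₀|) := by
  have h : |t| ≤ |t₀| + |t - t₀| := by
    calc |t| = |t₀ + (t - t₀)| := by ring_nf
      _ ≤ _ := abs_add_le _ _
  rw [mul_assoc]
  gcongr
  nlinarith [abs_nonneg t₀, abs_nonneg (t - t₀), mul_nonneg (abs_nonneg t₀) (abs_nonneg (t - t₀))]

lemma log_conductor_height_le {N : ℝ} (hN : 1 ≤ N) (t t₀ : ℝ) :
    Real.log (N * (|t| + 2)) ≤ Real.log (N * (|t₀| + 2)) * (1 + 2 * |t - t₀|) := by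
  have hX : 2 ≤ N * (|t₀| + 2) := by nlinarith [abs_nonneg t₀]
  have h1 := Real.half_le_log_of_two_le hX
  have hu := abs_nonneg (t - t₀)
  calc _ ≤ Real.log (N * (|t₀| + 2) * (1 + |t - t₀|)) :=
        Real.log_le_log (by positivity) (conductor_height_le hN t t₀)
    _ = Real.log (N * (|t₀| + 2)) + Real.log (1 + |t - t₀|) :=
        Real.log_mul (by positivity) (by positivity)
    _ ≤ Real.log (N * (|t₀| + 2)) + |t - t₀| := by
        gcongr
        linarith [Real.log_le_sub_one_of_pos (show 0 < 1 + |t - t₀| by positivity)]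
    _ ≤ _ := by nlinarith

/-- Polynomial factors are absorbed by a Gaussian. -/
lemma mul_exp_neg_sq_le (u : ℝ) : (1 + |u|) * (1 + 2 * |u|) * Real.exp (-u ^ 2) ≤ 4 := by
  have h : u ^ 2 + 1 ≤ Real.exp (u ^ 2) := Real.add_one_le_exp _
  rw [Real.exp_neg, ← div_eq_mul_inv, div_le_iff₀ (Real.exp_pos _)]
  nlinarith [sq_nonneg (|u| - 1), sq_abs u, sq_nonneg (2 * |u| - 1), sq_nonneg (2 * |u| - 3)]

/-- The Gaussian factor `exp ((z - s)²)` on the critical strip. -/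
lemma norm_exp_sub_sq_le {z s : ℂ} (hz0 : 0 ≤ z.re) (hz1 : z.re ≤ 1) (hs0 : 0 ≤ s.re)
    (hs1 : s.re ≤ 1) :
    ‖Complex.exp ((z - s) ^ 2)‖ ≤ 3 * Real.exp (-(z.im - s.im) ^ 2) := by
  have h1 : ((z - s) ^ 2).re = (z.re - s.re) ^ 2 + -(z.im - s.im) ^ 2 := by
    rw [sq, Complex.mul_re, Complex.sub_re, Complex.sub_im]; ring
  rw [Complex.norm_exp, h1, Real.exp_add]
  gcongr
  refine le_trans (Real.exp_le_exp.2 (?_ : _ ≤ (1 : ℝ))) Real.exp_one_lt_three.le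
  nlinarith

/-- The convexity bound for primitive characters. -/
lemma IsPrimitive.norm_LFunction_le {N : ℕ} [NeZero N] {χ : DirichletCharacter ℂ N}
    (h : χ.IsPrimitive) (hχ : χ ≠ 1) {s : ℂ} (h0 : 0 ≤ s.re) (h1 : s.re ≤ 1) :
    ‖LFunction χ s‖ ≤ 108 * (N * (|s.im| + 2)) ^ ((1 - s.re) / 2) *
      Real.log (N * (|s.im| + 2)) := by
  have hN : (1 : ℝ) ≤ N := by exact_mod_cast NeZero.one_le
  set X : ℝ := N * (|s.im| + 2) with hXdef
  have hX : 2 ≤ X := by nlinarith [abs_nonneg s.im]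
  have hX0 : 0 < X := by linarith
  have hlog : 0 ≤ Real.log X := by linarith [Real.half_le_log_of_two_le hX]
  set F : ℂ → ℂ := fun z ↦
    LFunction χ z * (Complex.exp ((z - s) ^ 2) * (X : ℂ) ^ ((z - 1) / 2)) with hF
  have hnX (z : ℂ) : ‖(X : ℂ) ^ ((z - 1) / 2)‖ = X ^ ((z.re - 1) / 2) := by
    rw [Complex.norm_cpow_eq_rpow_re_of_pos hX0]; simp
  have hdiff : Differentiable ℂ F := by
    refine (differentiable_LFunction hχ).mul (Differentiable.mul (by fun_prop) ?_)
    exact Differentiable.const_cpow (by fun_prop) (Or.inl (by exact_mod_cast hX0.ne'))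
  have hgrowth : ∃ c < Real.pi / (1 - 0), ∃ B,
      F =O[Filter.comap (_root_.abs ∘ Complex.im) Filter.atTop ⊓
        Filter.principal (Complex.re ⁻¹' Set.Ioo 0 1)]
        fun z ↦ Real.exp (B * Real.exp (c * |z.im|)) := by
    obtain ⟨K, hK⟩ := exists_norm_LFunction_le_exp χ
    refine ⟨Real.pi / 2, by linarith [Real.pi_pos], 1, Asymptotics.IsBigO.of_bound (K * 3) ?_⟩
    rw [Filter.eventually_inf_principal]
    filter_upwards [Filter.preimage_mem_comap (Filter.Ici_mem_atTop 1)] with z hz hz'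
    replace hz : 1 ≤ |z.im| := hz
    obtain ⟨hz0, hz1⟩ : 0 < z.re ∧ z.re < 1 := hz'
    have hL := hK z hz0.le hz1.le hz
    have hE : ‖Complex.exp ((z - s) ^ 2)‖ ≤ 3 := by
      refine (norm_exp_sub_sq_le hz0.le hz1.le h0 h1).trans ?_
      have : Real.exp (-(z.im - s.im) ^ 2) ≤ 1 :=
        Real.exp_le_one_iff.2 (by nlinarith [sq_nonneg (z.im - s.im)])
      linarith
    have hP : ‖(X : ℂ) ^ ((z - 1) / 2)‖ ≤ 1 := by
      rw [hnX]
      exact Real.rpow_le_one_of_one_le_of_nonpos (by linarith) (by linarith)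
    have hK0 : 0 ≤ K * Real.exp (Real.pi / 2 * |z.im|) := (norm_nonneg _).trans hL
    have hK1 : 0 ≤ K := nonneg_of_mul_nonneg_left hK0 (Real.exp_pos _)
    rw [hF, norm_mul, norm_mul, one_mul, Real.norm_of_nonneg (Real.exp_pos _).le]
    calc _ ≤ K * Real.exp (Real.pi / 2 * |z.im|) * (3 * 1) := by gcongr
      _ = K * 3 * Real.exp (Real.pi / 2 * |z.im|) := by ring
      _ ≤ _ := by
        gcongr
        linarith [Real.add_one_le_exp (Real.pi / 2 * |z.im|),
          Real.add_one_le_exp (Real.exp (Real.pi / 2 * |z.im|))]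
  have hu (z : ℂ) := abs_nonneg (z.im - s.im)
  have hleft (z : ℂ) (hz : z.re = 0) : ‖F z‖ ≤ 108 * Real.log X := by
    have hL := h.norm_LFunction_mul_I_le_log hχ z.im
    have hzeq : (z.im : ℂ) * Complex.I = z := by
      apply Complex.ext <;> simp [hz]
    rw [hzeq] at hL
    have hE := norm_exp_sub_sq_le hz.ge (by linarith) h0 h1
    have hP : ‖(X : ℂ) ^ ((z - 1) / 2)‖ = (√X)⁻¹ := by
      rw [hnX, hz, Real.sqrt_eq_rpow, ← Real.rpow_neg hX0.le]; norm_num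
    have hsq : √(N * (|z.im| + 2)) ≤ √X * (1 + |z.im - s.im|) := by
      have h1u : √(1 + |z.im - s.im|) ≤ 1 + |z.im - s.im| :=
        Real.sqrt_le_iff.2 ⟨by linarith [hu z], by nlinarith [hu z]⟩
      calc _ ≤ √(X * (1 + |z.im - s.im|)) := Real.sqrt_le_sqrt (conductor_height_le hN _ _)
        _ = √X * √(1 + |z.im - s.im|) := Real.sqrt_mul hX0.le _
        _ ≤ _ := by gcongr
    have hlg := log_conductor_height_le hN z.im s.im
    have hsX : √X ≠ 0 := (Real.sqrt_pos.2 hX0).ne'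
    rw [hF, norm_mul, norm_mul, hP]
    calc _ ≤ (√X * (1 + |z.im - s.im|) * (9 * (Real.log X * (1 + 2 * |z.im - s.im|)))) *
          (3 * Real.exp (-(z.im - s.im) ^ 2) * (√X)⁻¹) := by
          have := hu z
          have := Real.half_le_log_of_two_le (x := N * (|z.im| + 2)) (by nlinarith [abs_nonneg z.im])
          gcongr
          refine hL.trans ?_
          gcongr
      _ = 27 * Real.log X * ((1 + |z.im - s.im|) * (1 + 2 * |z.im - s.im|) *
          Real.exp (-(z.im - s.im) ^ 2)) := by field_simp; ring
      _ ≤ 27 * Real.log X * 4 := by gcongr; exact mul_exp_neg_sq_le _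
      _ = _ := by ring
  have hright (z : ℂ) (hz : z.re = 1) : ‖F z‖ ≤ 108 * Real.log X := by
    have hL := norm_LFunction_one_add_le hχ z.im
    have hzeq : 1 + (z.im : ℂ) * Complex.I = z := by
      apply Complex.ext <;> simp [hz]
    rw [hzeq] at hL
    have hE := norm_exp_sub_sq_le (by linarith) hz.le h0 h1
    have hP : ‖(X : ℂ) ^ ((z - 1) / 2)‖ = 1 := by
      rw [hnX, hz]; simp
    have hlg := log_conductor_height_le hN z.im s.im
    rw [hF, norm_mul, norm_mul, hP]
    calc _ ≤ 9 * (Real.log X * (1 + 2 * |z.im - s.im|)) *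
          (3 * Real.exp (-(z.im - s.im) ^ 2) * 1) := by
          have := hu z
          gcongr
          refine hL.trans ?_
          gcongr
      _ ≤ (1 + |z.im - s.im|) * (9 * (Real.log X * (1 + 2 * |z.im - s.im|)) *
          (3 * Real.exp (-(z.im - s.im) ^ 2) * 1)) := by
          have := hu z
          exact le_mul_of_one_le_left (by positivity) (by linarith)
      _ = 27 * Real.log X * ((1 + |z.im - s.im|) * (1 + 2 * |z.im - s.im|) *
          Real.exp (-(z.im - s.im) ^ 2)) := by ring
      _ ≤ 27 * Real.log X * 4 := by gcongr; exact mul_exp_neg_sq_le _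
      _ = _ := by ring
  have hmain := PhragmenLindelof.vertical_strip hdiff.diffContOnCl hgrowth hleft hright h0 h1
  rw [hF, norm_mul, norm_mul, hnX, sub_self, zero_pow two_ne_zero, Complex.exp_zero, norm_one,
    one_mul, show (s.re - 1) / 2 = -((1 - s.re) / 2) by ring, Real.rpow_neg hX0.le,
    ← div_eq_mul_inv, div_le_iff₀ (by positivity)] at hmain
  linarith

/-- The Euler factors at the primes dividing the modulus contribute at most `d(r)`. -/
lemma norm_prod_one_sub_le {N M : ℕ} (hN : N ≠ 0) (χ : DirichletCharacter ℂ M) {s : ℂ}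
    (hs : 0 ≤ s.re) :
    ‖∏ p ∈ N.primeFactors, (1 - χ p * (p : ℂ) ^ (-s))‖ ≤ N.divisors.card := by
  have h2 : (2 : ℝ) ^ N.primeFactors.card ≤ N.divisors.card := by
    rw [Nat.card_divisors hN]
    have : 2 ^ N.primeFactors.card ≤ ∏ x ∈ N.primeFactors, (N.factorization x + 1) := by
      rw [← Finset.prod_const]
      refine Finset.prod_le_prod' fun p hp ↦ ?_
      have := (Nat.prime_of_mem_primeFactors hp).factorization_pos_of_dvd hN
        (Nat.dvd_of_mem_primeFactors hp)
      omega
    exact_mod_cast this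
  refine le_trans ?_ h2
  rw [norm_prod, ← Finset.prod_const]
  refine Finset.prod_le_prod (fun _ _ ↦ norm_nonneg _) fun p hp ↦ ?_
  have hp := Nat.prime_of_mem_primeFactors hp
  have hpow : ‖(p : ℂ) ^ (-s)‖ ≤ 1 := by
    rw [Complex.norm_natCast_cpow_of_pos hp.pos]
    exact Real.rpow_le_one_of_one_le_of_nonpos (by exact_mod_cast hp.one_le) (by simpa)
  calc _ ≤ ‖(1 : ℂ)‖ + ‖χ p * (p : ℂ) ^ (-s)‖ := norm_sub_le _ _
    _ ≤ 1 + 1 * 1 := by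
      rw [norm_one, norm_mul]
      gcongr
      exact χ.norm_le_one _
    _ = 2 := by norm_num

/-- The convexity bound for non-principal characters. -/
lemma norm_LFunction_le {r : ℕ} [NeZero r] {χ : DirichletCharacter ℂ r} (hχ : χ ≠ 1) {s : ℂ}
    (h0 : 0 ≤ s.re) (h1 : s.re ≤ 1) :
    ‖LFunction χ s‖ ≤ 108 * (r.divisors.card : ℝ) * (r * (|s.im| + 2)) ^ ((1 - s.re) / 2) *
      Real.log (r * (|s.im| + 2)) := by
  have : NeZero χ.conductor := ⟨conductor_ne_zero χ⟩
  have hne : χ.primitiveCharacter ≠ 1 := fun h ↦ hχ <| by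
    rw [← changeLevel_primitiveCharacter χ, h, map_one]
  have hq : (1 : ℝ) ≤ χ.conductor := by exact_mod_cast NeZero.one_le
  have hqr : (χ.conductor : ℝ) ≤ r := by
    exact_mod_cast Nat.le_of_dvd (NeZero.pos r) χ.conductor_dvd_level
  have hX : 2 ≤ (χ.conductor : ℝ) * (|s.im| + 2) := by nlinarith [abs_nonneg s.im]
  have hlog := Real.half_le_log_of_two_le hX
  have hprim := χ.primitiveCharacter_isPrimitive.norm_LFunction_le hne h0 h1
  have hprod := norm_prod_one_sub_le (NeZero.ne r) χ.primitiveCharacter h0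
  have hL := LFunction_changeLevel χ.conductor_dvd_level χ.primitiveCharacter (s := s) (Or.inl hne)
  rw [changeLevel_primitiveCharacter] at hL
  rw [hL, norm_mul]
  calc _ ≤ 108 * (χ.conductor * (|s.im| + 2)) ^ ((1 - s.re) / 2) *
        Real.log (χ.conductor * (|s.im| + 2)) * r.divisors.card := by gcongr
    _ ≤ 108 * (r * (|s.im| + 2)) ^ ((1 - s.re) / 2) * Real.log (r * (|s.im| + 2)) *
        r.divisors.card := by gcongr
    _ = _ := by ring

end DirichletCharacter

theorem LFunction_convexity_bound :
    ∃ C : ℝ, 0 < C ∧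
      ∀ (r : ℕ) [NeZero r] (χ : DirichletCharacter ℂ r), χ ≠ 1 →
        ∀ σ t : ℝ, 1 / 2 ≤ σ → σ ≤ 1 →
          ‖DirichletCharacter.LFunction χ (σ + t * Complex.I)‖ ≤
            C * (r.divisors.card : ℝ) * ((r : ℝ) * (|t| + 2)) ^ ((1 - σ) / 2) *
              Real.log ((r : ℝ) * (|t| + 2)) := by
  refine ⟨108, by norm_num, fun r _ χ hχ σ t hσ hσ1 ↦ ?_⟩
  have hre : (σ + t * Complex.I).re = σ := by simp
  have him : (σ + t * Complex.I).im = t := by simp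
  have h := DirichletCharacter.norm_LFunction_le hχ (s := σ + t * Complex.I)
    (by linarith) (by linarith)
  rwa [hre, him] at h
end

section
/- There is an absolute constant C > 0 such that for every positive integer r and every real T ≥ 2, Σ_{χ mod r} ∫_1^T |L(1/2 + it, χ)|² dt ≤ C·φ(r)·T·log(rT), where the sum runs over all Dirichlet characters χ modulo r, L(·,χ) is the Dirichlet L-function of χ, and φ is Euler's totient function. -/
open MeasureTheory FourierTransform

theorem fourier_ae_eq_Lp_fourier {f : ℝ → ℂ} (hf : Integrable f) (hf2 : MemLp f 2) :
    ((𝓕 (hf2.toLp f) : Lp ℂ 2 (volume : Measure ℝ)) : ℝ → ℂ) =ᵐ[volume] 𝓕 f := by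
  have hcont : Continuous (𝓕 f) :=
    VectorFourier.fourierIntegral_continuous Real.continuous_fourierChar continuous_inner hf
  refine ae_eq_of_integral_contDiff_smul_eq
    ((Lp.memLp _).locallyIntegrable one_le_two) hcont.locallyIntegrable fun g hg hgc ↦ ?_
  have hg₁ : HasCompactSupport (Complex.ofRealCLM ∘ g) := hgc.comp_left rfl
  have hg₂ : ContDiff ℝ (⊤ : ℕ∞) (Complex.ofRealCLM ∘ g) := by fun_prop
  let G : SchwartzMap ℝ ℂ := hg₁.toSchwartzMap hg₂
  have hG : ∀ x, G x = (g x : ℂ) := fun x ↦ rfl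
  have h1 := congrArg (fun D ↦ D G) (Lp.fourier_toTemperedDistribution_eq (hf2.toLp f))
  simp only [TemperedDistribution.fourier_apply, Lp.toTemperedDistribution_apply] at h1
  have h2 : ∫ x, (𝓕 G) x • (hf2.toLp f : ℝ → ℂ) x = ∫ x, (𝓕 G) x • f x := by
    refine integral_congr_ae ?_
    filter_upwards [hf2.coeFn_toLp] with x hx
    rw [hx]
  have h3 : ∫ x, (𝓕 (G : ℝ → ℂ)) x • f x = ∫ x, G x • 𝓕 f x := by
    have := VectorFourier.integral_fourierIntegral_smul_eq_flip (μ := volume) (ν := volume)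
      (L := innerₗ ℝ) (f := (G : ℝ → ℂ)) (g := f) Real.continuous_fourierChar continuous_inner
      G.integrable hf
    simpa only [flip_innerₗ] using! this
  rw [SchwartzMap.fourier_coe] at h2
  simp only [hG, Complex.real_smul, smul_eq_mul] at *
  rw [← h1, SchwartzMap.fourier_coe, h2, h3]

theorem eLpNorm_fourier_eq {f : ℝ → ℂ} (hf : Integrable f) (hf2 : MemLp f 2) :
    eLpNorm (𝓕 f) 2 = eLpNorm f 2 := by
  rw [← eLpNorm_congr_ae (fourier_ae_eq_Lp_fourier hf hf2), ← eLpNorm_congr_ae hf2.coeFn_toLp,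
    ← ENNReal.toReal_eq_toReal_iff' (Lp.eLpNorm_ne_top _) (Lp.eLpNorm_ne_top _), ← Lp.norm_def,
    ← Lp.norm_def, Lp.norm_fourier_eq]

theorem integrableOn_Ioi_iff_integrable_exp_neg {E : Type*} [NormedAddCommGroup E]
    [NormedSpace ℝ E] (f : ℝ → E) :
    IntegrableOn f (Set.Ioi 0) ↔ Integrable fun u : ℝ ↦ Real.exp (-u) • f (Real.exp (-u)) := by
  have himg : (Real.exp ∘ Neg.neg) '' Set.univ = Set.Ioi 0 := by
    rw [Set.image_comp, Set.image_univ_of_surjective neg_surjective, Set.image_univ,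
      Real.range_exp]
  rw [← himg, integrableOn_image_iff_integrableOn_abs_deriv_smul (f' := fun x ↦ -Real.exp (-x))
    MeasurableSet.univ (fun x _ ↦ mul_neg_one (Real.exp (-x)) ▸
      ((Real.hasDerivAt_exp (-x)).comp x (hasDerivAt_neg x)).hasDerivWithinAt)
    (Real.exp_injective.injOn.comp neg_injective.injOn (Set.univ.mapsTo_univ _))]
  simp

theorem integral_Ioi_eq_integral_exp_neg {E : Type*} [NormedAddCommGroup E]
    [NormedSpace ℝ E] (f : ℝ → E) :
    ∫ y in Set.Ioi 0, f y = ∫ u : ℝ, Real.exp (-u) • f (Real.exp (-u)) := by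
  have himg : (Real.exp ∘ Neg.neg) '' Set.univ = Set.Ioi 0 := by
    rw [Set.image_comp, Set.image_univ_of_surjective neg_surjective, Set.image_univ,
      Real.range_exp]
  rw [← himg, integral_image_eq_integral_abs_deriv_smul (f' := fun x ↦ -Real.exp (-x))
    MeasurableSet.univ (fun x _ ↦ mul_neg_one (Real.exp (-x)) ▸
      ((Real.hasDerivAt_exp (-x)).comp x (hasDerivAt_neg x)).hasDerivWithinAt)
    (Real.exp_injective.injOn.comp neg_injective.injOn (Set.univ.mapsTo_univ _))]
  simp

/-- The Plancherel theorem for the Mellin transform on the line `re s = 1 / 2`. -/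
theorem integral_norm_mellin_sq {f : ℝ → ℂ} (hf : MellinConvergent f (1 / 2))
    (hf2 : IntegrableOn (fun y ↦ ‖f y‖ ^ 2) (Set.Ioi 0)) :
    Integrable (fun t : ℝ ↦ ‖mellin f (1 / 2 + t * Complex.I)‖ ^ 2) ∧
      ∫ t : ℝ, ‖mellin f (1 / 2 + t * Complex.I)‖ ^ 2 =
        2 * Real.pi * ∫ y in Set.Ioi 0, ‖f y‖ ^ 2 := by
  set g : ℝ → ℂ := fun u ↦ Real.exp (-(1 / 2) * u) • f (Real.exp (-u)) with hg
  have hgint : Integrable g := by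
    rw [MellinConvergent, integrableOn_Ioi_iff_integrable_exp_neg] at hf
    refine hf.congr (ae_of_all _ fun u ↦ ?_)
    simp only [hg, Complex.real_smul, smul_eq_mul]
    rw [← mul_assoc]
    congr 1
    rw [show (1 / 2 - 1 : ℂ) = ((-(1 / 2) : ℝ) : ℂ) by push_cast; ring,
      ← Complex.ofReal_cpow (Real.exp_pos _).le, ← Complex.ofReal_mul, ← Real.exp_mul,
      ← Real.exp_add]
    congr 2
    ring
  have hsq : ∀ u, ‖g u‖ ^ 2 = Real.exp (-u) • ‖f (Real.exp (-u))‖ ^ 2 := fun u ↦ by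
    simp only [hg, norm_smul, mul_pow, Real.norm_eq_abs, Real.abs_exp, smul_eq_mul]
    rw [← Real.exp_nat_mul]
    congr 2
    push_cast
    ring
  have hg2 : MemLp g 2 := by
    rw [memLp_two_iff_integrable_sq_norm hgint.1]
    rw [integrableOn_Ioi_iff_integrable_exp_neg] at hf2
    exact hf2.congr (ae_of_all _ fun u ↦ (hsq u).symm)
  have hF2 : MemLp (𝓕 g) 2 :=
    ⟨(VectorFourier.fourierIntegral_continuous Real.continuous_fourierChar continuous_inner
      hgint).aestronglyMeasurable, by rw [eLpNorm_fourier_eq hgint hg2]; exact hg2.2⟩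
  have hmel : ∀ t : ℝ, mellin f (1 / 2 + t * Complex.I) = 𝓕 g (t / (2 * Real.pi)) := fun t ↦ by
    rw [mellin_eq_fourier]
    simp [hg]
  have hFint : Integrable fun v ↦ ‖𝓕 g v‖ ^ 2 :=
    (memLp_two_iff_integrable_sq_norm hF2.1).1 hF2
  simp only [hmel]
  refine ⟨hFint.comp_div (by positivity), ?_⟩
  rw [Measure.integral_comp_div (fun v ↦ ‖𝓕 g v‖ ^ 2), integral_Ioi_eq_integral_exp_neg,
    abs_of_pos (by positivity), smul_eq_mul]
  congr 1
  simp only [← hsq]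
  have key : ∀ {h : ℝ → ℂ}, MemLp h 2 → ∫ v, ‖h v‖ ^ 2 = (eLpNorm h 2).toReal ^ 2 := by
    intro h hh
    rw [hh.eLpNorm_eq_integral_rpow_norm (by simp) (by simp)]
    have h0 : 0 ≤ ∫ v, ‖h v‖ ^ 2 := integral_nonneg fun _ ↦ by positivity
    simp only [ENNReal.toReal_ofNat, Real.rpow_ofNat]
    rw [ENNReal.toReal_ofReal (by positivity), ← Real.rpow_natCast, ← Real.rpow_mul h0]
    simp
  rw [key hF2, key hg2, eLpNorm_fourier_eq hgint hg2]

/-- The number of integers `n ≥ 1` such that `n + a ≤ 1 / y`. -/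
noncomputable def shiftedCount (a y : ℝ) : ℕ := ⌊y⁻¹ - a⌋₊

theorem measurable_shiftedCount (a : ℝ) : Measurable (shiftedCount a) :=
  Nat.measurable_floor.comp (measurable_inv.sub_const a)

theorem succ_le_shiftedCount_iff {a y : ℝ} (hy : 0 < y) (n : ℕ) :
    n + 1 ≤ shiftedCount a y ↔ (n + 1 + a) * y ≤ 1 := by
  rw [shiftedCount, Nat.le_floor_iff' n.succ_ne_zero, le_sub_iff_add_le, ← one_div,
    le_div_iff₀ hy]
  push_cast
  rfl

theorem shiftedCount_eq_zero {a y : ℝ} (hy : 1 < y) (ha : 0 ≤ a) : shiftedCount a y = 0 := by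
  rw [shiftedCount, Nat.floor_eq_zero]
  linarith [inv_lt_one_of_one_lt₀ hy]

theorem shiftedCount_le {a y : ℝ} (hy : 0 < y) (hy1 : y ≤ 1) (ha : 0 ≤ a) (ha1 : a ≤ 1) :
    (shiftedCount a y : ℝ) ≤ y⁻¹ := by
  have := Nat.floor_le (a := y⁻¹ - a) (by linarith [(one_le_inv₀ hy).2 hy1])
  rw [shiftedCount]
  linarith

theorem le_shiftedCount {a y : ℝ} (ha1 : a ≤ 1) :
    y⁻¹ - 2 ≤ (shiftedCount a y : ℝ) := by
  have := Nat.lt_floor_add_one (y⁻¹ - a)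
  rw [shiftedCount]
  linarith

theorem tsum_indicator_eq_shiftedCount {a y : ℝ} (hy : 0 < y) (ha : 0 ≤ a) :
    ∑' n : ℕ, (Set.Ioc 0 1).indicator (fun _ ↦ (1 : ℂ)) ((n + 1 + a) * y) =
      (shiftedCount a y : ℂ) := by
  have hmem : ∀ n : ℕ, (n + 1 + a) * y ∈ Set.Ioc (0 : ℝ) 1 ↔ n ∈ Finset.range (shiftedCount a y) :=
    fun n ↦ by
      rw [Finset.mem_range, ← Nat.succ_le_iff, succ_le_shiftedCount_iff hy, Set.mem_Ioc,
        and_iff_right (by positivity)]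
  rw [tsum_eq_sum (s := Finset.range (shiftedCount a y))
    fun n hn ↦ Set.indicator_of_notMem (fun h ↦ hn ((hmem n).1 h)) _,
    Finset.sum_congr rfl fun n hn ↦ Set.indicator_of_mem ((hmem n).2 hn) _]
  simp

/-- The Hurwitz zeta function without its first term: the continuation of `∑ (n + a) ^ (-s)`, the
sum being over `n ≥ 1`. -/
noncomputable def hurwitzZetaTail (a : ℝ) (s : ℂ) : ℂ :=
  HurwitzZeta.hurwitzZeta (a : UnitAddCircle) s - (a : ℂ) ^ (-s)

theorem differentiableAt_hurwitzZetaTail (a : ℝ) {s : ℂ} (hs : s ≠ 1) (hs0 : s ≠ 0) :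
    DifferentiableAt ℂ (hurwitzZetaTail a) s :=
  (HurwitzZeta.differentiableAt_hurwitzZeta _ hs).sub
    (differentiableAt_id.neg.const_cpow (Or.inr (neg_ne_zero.2 hs0)))

theorem hasSum_hurwitzZetaTail {a : ℝ} (ha : a ∈ Set.Icc 0 1) {s : ℂ} (hs : 1 < s.re) :
    HasSum (fun n : ℕ ↦ ((n + 1 + a : ℝ) : ℂ) ^ (-s)) (hurwitzZetaTail a s) := by
  have h := HurwitzZeta.hasSum_hurwitzZeta_of_one_lt_re ha hs
  rw [← hasSum_nat_add_iff' 1] at h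
  simpa [hurwitzZetaTail, Complex.cpow_neg, one_div] using h

theorem hasMellin_indicator_mul {b : ℝ} (hb : 0 < b) {s : ℂ} (hs : 0 < s.re) :
    HasMellin (fun y ↦ (Set.Ioc 0 1).indicator (fun _ ↦ (1 : ℂ)) (b * y)) s
      ((b : ℂ) ^ (-s) * (1 / s)) := by
  have h := hasMellin_one_Ioc hs
  exact ⟨(MellinConvergent.comp_mul_left hb).2 h.1, by rw [mellin_comp_mul_left _ _ hb, h.2]; rfl⟩

theorem mellin_shiftedCount {a : ℝ} (ha : a ∈ Set.Icc 0 1) {s : ℂ} (hs : 1 < s.re) :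
    mellin (fun y ↦ (shiftedCount a y : ℂ)) s = hurwitzZetaTail a s / s := by
  have hpos : ∀ n : ℕ, 0 < (n + 1 + a : ℝ) := fun n ↦ by have := ha.1; positivity
  have hs0 : 0 < s.re := by linarith
  set F : ℕ → ℝ → ℂ := fun n y ↦
    (y : ℂ) ^ (s - 1) • (Set.Ioc 0 1).indicator (fun _ ↦ (1 : ℂ)) ((n + 1 + a) * y) with hF
  have hnorm : ∀ n, ((∫ y in Set.Ioi 0, ‖F n y‖ : ℝ) : ℂ) =
      ((n + 1 + a : ℝ) : ℂ) ^ (-(s.re : ℂ)) * (1 / (s.re : ℂ)) := fun n ↦ by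
    rw [← (hasMellin_indicator_mul (hpos n) (s := (s.re : ℂ)) (by simpa using hs0)).2, mellin,
      ← integral_complex_ofReal]
    refine setIntegral_congr_fun measurableSet_Ioi fun y hy ↦ ?_
    simp only [hF, norm_smul, Complex.norm_cpow_eq_rpow_re_of_pos hy]
    by_cases h : (n + 1 + a) * y ∈ Set.Ioc (0 : ℝ) 1
    · simp [h, Complex.ofReal_cpow (le_of_lt hy)]
    · simp [h]
  have hsum : Summable fun n ↦ ∫ y in Set.Ioi 0, ‖F n y‖ := by
    rw [← Complex.summable_ofReal]
    simp only [hnorm]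
    exact ((hasSum_hurwitzZetaTail ha (s := (s.re : ℂ)) (by simpa using hs)).summable).mul_right _
  have h1 := hasSum_integral_of_summable_integral_norm (μ := volume.restrict (Set.Ioi 0))
    (F := F) (fun n ↦ (hasMellin_indicator_mul (hpos n) hs0).1) hsum
  have h2 : ∀ n, ∫ y in Set.Ioi 0, F n y = ((n + 1 + a : ℝ) : ℂ) ^ (-s) * (1 / s) := fun n ↦
    (hasMellin_indicator_mul (hpos n) hs0).2
  simp only [h2] at h1
  rw [div_eq_mul_one_div, ((hasSum_hurwitzZetaTail ha hs).mul_right (1 / s)).unique h1, mellin]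
  refine setIntegral_congr_fun measurableSet_Ioi fun y hy ↦ ?_
  simp only [hF, tsum_const_smul'', tsum_indicator_eq_shiftedCount hy ha.1]

/-- The discrepancy between `shiftedCount` and its main term, restricted to `(0, 1]`. -/
noncomputable def truncatedDiscrepancy (a y : ℝ) : ℂ :=
  (Set.Ioc 0 1).indicator (fun y ↦ (shiftedCount a y : ℂ) - (y : ℂ) ^ (-1 : ℂ)) y

theorem norm_truncatedDiscrepancy_le {a : ℝ} (ha : a ∈ Set.Icc 0 1) (y : ℝ) :
    ‖truncatedDiscrepancy a y‖ ≤ 2 := by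
  rw [truncatedDiscrepancy]
  by_cases hy : y ∈ Set.Ioc (0 : ℝ) 1
  · have h1 := shiftedCount_le hy.1 hy.2 ha.1 ha.2
    have h2 := le_shiftedCount (y := y) ha.2
    rw [Set.indicator_of_mem hy, Complex.cpow_neg_one, ← Complex.ofReal_inv,
      ← Complex.ofReal_natCast, ← Complex.ofReal_sub, Complex.norm_real, Real.norm_eq_abs, abs_le]
    constructor <;> linarith
  · simp [Set.indicator_of_notMem hy]

theorem measurable_truncatedDiscrepancy (a : ℝ) : Measurable (truncatedDiscrepancy a) := by
  refine Measurable.indicator ?_ measurableSet_Ioc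
  have := measurable_shiftedCount a
  fun_prop

theorem locallyIntegrableOn_truncatedDiscrepancy {a : ℝ} (ha : a ∈ Set.Icc 0 1) :
    LocallyIntegrableOn (truncatedDiscrepancy a) (Set.Ioi 0) :=
  LocallyIntegrable.locallyIntegrableOn
    ((locallyIntegrable_const (2 : ℝ)).mono (measurable_truncatedDiscrepancy a).aestronglyMeasurable
      (ae_of_all _ fun y ↦ by simpa using norm_truncatedDiscrepancy_le ha y)) _

theorem truncatedDiscrepancy_isBigO_atTop (a b : ℝ) :
    truncatedDiscrepancy a =O[Filter.atTop] (· ^ (-b)) := by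
  refine (Asymptotics.isBigO_zero (E' := ℂ) _ _).congr' ?_ .rfl
  filter_upwards [Filter.eventually_gt_atTop 1] with y hy
  exact (Set.indicator_of_notMem (fun h ↦ absurd h.2 (not_le.2 hy)) _).symm

theorem truncatedDiscrepancy_isBigO_zero {a : ℝ} (ha : a ∈ Set.Icc 0 1) :
    truncatedDiscrepancy a =O[nhdsWithin 0 (Set.Ioi 0)] (· ^ (-(0 : ℝ))) := by
  refine Asymptotics.IsBigO.of_bound 2 (Filter.Eventually.of_forall fun y ↦ ?_)
  simpa using norm_truncatedDiscrepancy_le ha y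

theorem mellinConvergent_truncatedDiscrepancy {a : ℝ} (ha : a ∈ Set.Icc 0 1) {s : ℂ}
    (hs : 0 < s.re) : MellinConvergent (truncatedDiscrepancy a) s :=
  mellinConvergent_of_isBigO_rpow (locallyIntegrableOn_truncatedDiscrepancy ha)
    (truncatedDiscrepancy_isBigO_atTop a _) (lt_add_one _) (truncatedDiscrepancy_isBigO_zero ha) hs

theorem differentiableAt_mellin_truncatedDiscrepancy {a : ℝ} (ha : a ∈ Set.Icc 0 1) {s : ℂ}
    (hs : 0 < s.re) : DifferentiableAt ℂ (mellin (truncatedDiscrepancy a)) s :=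
  mellin_differentiableAt_of_isBigO_rpow (locallyIntegrableOn_truncatedDiscrepancy ha)
    (truncatedDiscrepancy_isBigO_atTop a _) (lt_add_one _) (truncatedDiscrepancy_isBigO_zero ha) hs

theorem mellin_truncatedDiscrepancy_of_one_lt_re {a : ℝ} (ha : a ∈ Set.Icc 0 1) {s : ℂ}
    (hs : 1 < s.re) :
    mellin (truncatedDiscrepancy a) s = hurwitzZetaTail a s / s - 1 / (s - 1) := by
  have hI := hasMellin_cpow_Ioc (-1) (s := s) (by simpa using hs)
  have hT := mellinConvergent_truncatedDiscrepancy ha (s := s) (by linarith)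
  have hadd := hasMellin_add hT hI.1
  have heq : Set.EqOn (fun y : ℝ ↦ (y : ℂ) ^ (s - 1) • (truncatedDiscrepancy a y +
      (Set.Ioc 0 1).indicator (fun t : ℝ ↦ (t : ℂ) ^ (-1 : ℂ)) y))
      (fun y ↦ (y : ℂ) ^ (s - 1) • (shiftedCount a y : ℂ)) (Set.Ioi 0) := fun y hy ↦ by
    by_cases h1 : y ≤ 1
    · have hm : y ∈ Set.Ioc (0 : ℝ) 1 := ⟨hy, h1⟩
      simp [truncatedDiscrepancy, Set.indicator_of_mem hm]
    · have hm : y ∉ Set.Ioc (0 : ℝ) 1 := fun h ↦ h1 h.2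
      simp [truncatedDiscrepancy, Set.indicator_of_notMem hm,
        shiftedCount_eq_zero (not_le.1 h1) ha.1]
  have h := hadd.2
  rw [mellin, setIntegral_congr_fun measurableSet_Ioi heq, ← mellin, mellin_shiftedCount ha hs,
    hI.2] at h
  rw [h]
  ring

theorem mellin_truncatedDiscrepancy {a : ℝ} (ha : a ∈ Set.Icc 0 1) {s : ℂ}
    (hs : 0 < s.re) (hs' : 0 < s.im) :
    mellin (truncatedDiscrepancy a) s = hurwitzZetaTail a s / s - 1 / (s - 1) := by
  set U : Set ℂ := {z | 0 < z.re} ∩ {z | 0 < z.im} with hU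
  have hUo : IsOpen U := (isOpen_lt continuous_const Complex.continuous_re).inter
    (isOpen_lt continuous_const Complex.continuous_im)
  have hUc : IsPreconnected U :=
    ((convex_halfSpace_re_gt 0).inter (convex_halfSpace_im_gt 0)).isPreconnected
  have hne : ∀ z ∈ U, z ≠ 0 ∧ z ≠ 1 := fun z hz ↦
    ⟨fun h ↦ by simp [hU, h] at hz, fun h ↦ by simp [hU, h] at hz⟩
  have h1 : AnalyticOnNhd ℂ (mellin (truncatedDiscrepancy a)) U :=
    DifferentiableOn.analyticOnNhd (fun z hz ↦
      (differentiableAt_mellin_truncatedDiscrepancy ha hz.1).differentiableWithinAt) hUo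
  have h2 : AnalyticOnNhd ℂ (fun z ↦ hurwitzZetaTail a z / z - 1 / (z - 1)) U := by
    refine DifferentiableOn.analyticOnNhd (fun z hz ↦ ?_) hUo
    have hz' := hne z hz
    exact (((differentiableAt_hurwitzZetaTail a hz'.2 hz'.1).div differentiableAt_id hz'.1).sub
      ((differentiableAt_const _).div (differentiableAt_id.sub_const 1)
        (sub_ne_zero.2 hz'.2))).differentiableWithinAt
  refine h1.eqOn_of_preconnected_of_eventuallyEq h2 hUc (z₀ := 2 + Complex.I) (by simp [hU]) ?_
    ⟨hs, hs'⟩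
  filter_upwards [(isOpen_lt continuous_const Complex.continuous_re).mem_nhds
    (show (2 + Complex.I) ∈ {z : ℂ | 1 < z.re} by simp)] with z hz
  exact mellin_truncatedDiscrepancy_of_one_lt_re ha hz

/-- The Mellin transform of the discrepancy `#{n ≥ 1 | n + a ≤ 1 / y} - 1 / y`. -/
theorem hasMellin_shiftedCount_sub_inv {a : ℝ} (ha : a ∈ Set.Icc 0 1) {s : ℂ}
    (hs : 0 < s.re) (hs1 : s.re < 1) (hs' : 0 < s.im) :
    HasMellin (fun y ↦ (shiftedCount a y : ℂ) - (y : ℂ)⁻¹) s (hurwitzZetaTail a s / s) := by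
  set J : ℝ → ℂ := (Set.Ioi 1).indicator fun y : ℝ ↦ (y : ℂ)⁻¹ with hJ
  have hJeq : Set.EqOn (fun y : ℝ ↦ (y : ℂ) ^ (s - 1) • J y)
      ((Set.Ioi 1).indicator fun y : ℝ ↦ (y : ℂ) ^ (s - 2)) (Set.Ioi 0) := fun y hy ↦ by
    by_cases h : y ∈ Set.Ioi (1 : ℝ)
    · have hy0 : (y : ℂ) ≠ 0 := Complex.ofReal_ne_zero.2 (ne_of_gt hy)
      simp only [hJ, Set.indicator_of_mem h, smul_eq_mul]
      rw [← Complex.cpow_neg_one, ← Complex.cpow_add _ _ hy0]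
      ring_nf
    · simp [hJ, Set.indicator_of_notMem h]
  have hre : (s - 2).re < -1 := by
    rw [Complex.sub_re, Complex.re_ofNat]
    linarith
  have hJM : HasMellin J s (1 / (1 - s)) := by
    constructor
    · rw [MellinConvergent, integrableOn_congr_fun hJeq measurableSet_Ioi,
        integrableOn_indicator_iff measurableSet_Ioi]
      exact (integrableOn_Ioi_cpow_of_lt hre one_pos).mono_set Set.inter_subset_left
    · rw [mellin, setIntegral_congr_fun measurableSet_Ioi hJeq,
        setIntegral_indicator measurableSet_Ioi,
        Set.inter_eq_right.2 (Set.Ioi_subset_Ioi zero_le_one),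
        integral_Ioi_cpow_of_lt hre one_pos]
      rw [Complex.ofReal_one, Complex.one_cpow, show s - 2 + 1 = -(1 - s) by ring, neg_div_neg_eq]
  have hsub := hasMellin_sub (mellinConvergent_truncatedDiscrepancy ha hs) hJM.1
  have heq : Set.EqOn (fun y : ℝ ↦ (y : ℂ) ^ (s - 1) • (truncatedDiscrepancy a y - J y))
      (fun y : ℝ ↦ (y : ℂ) ^ (s - 1) • ((shiftedCount a y : ℂ) - (y : ℂ)⁻¹)) (Set.Ioi 0) :=
    fun y hy ↦ by
    by_cases h1 : y ≤ 1
    · have hm : y ∈ Set.Ioc (0 : ℝ) 1 := ⟨hy, h1⟩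
      have hm' : y ∉ Set.Ioi (1 : ℝ) := not_lt.2 h1
      simp [truncatedDiscrepancy, hJ, Set.indicator_of_mem hm, Set.indicator_of_notMem hm',
        Complex.cpow_neg_one]
    · have hm : y ∉ Set.Ioc (0 : ℝ) 1 := fun h ↦ h1 h.2
      have hm' : y ∈ Set.Ioi (1 : ℝ) := not_le.1 h1
      simp [truncatedDiscrepancy, hJ, Set.indicator_of_notMem hm, Set.indicator_of_mem hm',
        shiftedCount_eq_zero (not_le.1 h1) ha.1]
  refine ⟨(integrableOn_congr_fun heq measurableSet_Ioi).1 hsub.1, ?_⟩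
  rw [mellin, ← setIntegral_congr_fun measurableSet_Ioi heq, ← mellin, hsub.2, hJM.2,
    mellin_truncatedDiscrepancy ha hs hs', ← neg_sub 1 s, div_neg]
  ring

/-- The increment, between `y` and `c * y`, of the discrepancy of `shiftedCount`. -/
noncomputable def discrepancyIncrement (a c y : ℝ) : ℂ :=
  ((shiftedCount a y : ℂ) - (y : ℂ)⁻¹) - ((shiftedCount a (c * y) : ℂ) - ((c * y : ℝ) : ℂ)⁻¹)

theorem hasMellin_discrepancyIncrement {a c : ℝ} (ha : a ∈ Set.Icc 0 1) (hc : 0 < c) {s : ℂ}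
    (hs : 0 < s.re) (hs1 : s.re < 1) (hs' : 0 < s.im) :
    HasMellin (discrepancyIncrement a c) s ((1 - (c : ℂ) ^ (-s)) * (hurwitzZetaTail a s / s)) := by
  have h := hasMellin_shiftedCount_sub_inv ha hs hs1 hs'
  have h2 := hasMellin_sub h.1 ((MellinConvergent.comp_mul_left hc).2 h.1)
  have h3 := mellin_comp_mul_left (fun y : ℝ ↦ (shiftedCount a y : ℂ) - (y : ℂ)⁻¹) s hc
  refine ⟨h2.1, h2.2.trans ?_⟩
  rw [h3, h.2, smul_eq_mul, ← one_sub_mul]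

theorem measurable_discrepancyIncrement (a c : ℝ) : Measurable (discrepancyIncrement a c) := by
  have h1 := measurable_shiftedCount a
  have h2 : Measurable fun y ↦ shiftedCount a (c * y) := h1.comp (measurable_const_mul c)
  unfold discrepancyIncrement
  fun_prop

/-- A majorant for the square of `discrepancyIncrement a (exp δ)`. -/
noncomputable def incrementMajorant (a δ : ℝ) (N : ℕ) (y : ℝ) : ℝ :=
  2 * ∑ n ∈ Finset.range N, (Set.Ioc (Real.exp (-δ) / (n + 1 + a)) (1 / (n + 1 + a))).indicator
    (fun _ ↦ (1 : ℝ)) y + (Set.Ioc 0 δ).indicator (fun _ ↦ 4) y +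
    2 * δ ^ 2 * (Set.Ioi δ).indicator (fun y ↦ y ^ (-2 : ℝ)) y

theorem shiftedCount_sub_le_sum {a δ y : ℝ} (ha : a ∈ Set.Icc 0 1) (hδ : 0 < δ) (hy : δ < y)
    {N : ℕ} (hN : δ⁻¹ ≤ N) :
    shiftedCount a (Real.exp δ * y) ≤ shiftedCount a y ∧
    shiftedCount a y ≤ shiftedCount a (Real.exp δ * y) + 1 ∧
    ((shiftedCount a y : ℝ) - shiftedCount a (Real.exp δ * y)) ≤
      ∑ n ∈ Finset.range N, (Set.Ioc (Real.exp (-δ) / (n + 1 + a)) (1 / (n + 1 + a))).indicator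
        (fun _ ↦ (1 : ℝ)) y := by
  have hy0 : 0 < y := hδ.trans hy
  have hinv : y⁻¹ * δ < 1 := by rw [inv_mul_lt_iff₀ hy0]; linarith
  have hexp : (Real.exp δ * y)⁻¹ = Real.exp (-δ) * y⁻¹ := by rw [mul_inv, Real.exp_neg]
  have hyinv : 0 < y⁻¹ := inv_pos.2 hy0
  have hlow : y⁻¹ - 1 < (Real.exp δ * y)⁻¹ := by
    have := Real.add_one_le_exp (-δ)
    rw [hexp]
    nlinarith
  have hup : (Real.exp δ * y)⁻¹ ≤ y⁻¹ := by
    have := Real.exp_le_one_iff.2 (neg_nonpos.2 hδ.le)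
    rw [hexp]
    nlinarith
  have hmono : shiftedCount a (Real.exp δ * y) ≤ shiftedCount a y :=
    Nat.floor_mono (by linarith)
  have hle : shiftedCount a y ≤ shiftedCount a (Real.exp δ * y) + 1 := by
    rw [← Nat.lt_succ_iff, shiftedCount, Nat.floor_lt' (Nat.succ_ne_zero _)]
    have := Nat.lt_floor_add_one ((Real.exp δ * y)⁻¹ - a)
    rw [shiftedCount]
    push_cast
    linarith
  refine ⟨hmono, hle, ?_⟩
  have hnonneg : ∀ n : ℕ, 0 ≤ (Set.Ioc (Real.exp (-δ) / (n + 1 + a)) (1 / (n + 1 + a))).indicator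
        (fun _ ↦ (1 : ℝ)) y := fun n ↦ Set.indicator_nonneg (fun _ _ ↦ zero_le_one) _
  rcases hmono.eq_or_lt with heq | hlt
  · rw [heq, sub_self]
    exact Finset.sum_nonneg fun n _ ↦ hnonneg n
  obtain ⟨n, hn⟩ := Nat.exists_eq_succ_of_ne_zero (Nat.ne_zero_of_lt hlt)
  have hb : 0 < (n + 1 + a : ℝ) := by have := ha.1; positivity
  have h1 : (n + 1 + a) * y ≤ 1 := (succ_le_shiftedCount_iff hy0 n).1 hn.ge
  have h2 : 1 < (n + 1 + a) * (Real.exp δ * y) := by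
    rw [← not_le, ← succ_le_shiftedCount_iff (by positivity) n]
    omega
  have hmem : y ∈ Set.Ioc (Real.exp (-δ) / (n + 1 + a)) (1 / (n + 1 + a)) := by
    constructor
    · rw [div_lt_iff₀ hb, Real.exp_neg, inv_lt_iff_one_lt_mul₀ (Real.exp_pos _)]
      linarith
    · rw [le_div_iff₀ hb]
      linarith
  have hnN : n < N := by
    have h3 : (n + 1 : ℝ) * y ≤ 1 := by nlinarith [ha.1]
    have h4 : (n + 1 : ℝ) ≤ y⁻¹ := by rwa [← one_div, le_div_iff₀ hy0]
    have h5 : y⁻¹ ≤ δ⁻¹ := inv_anti₀ hδ hy.le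
    exact_mod_cast (by linarith : (n : ℝ) < N)
  refine le_trans ?_ (Finset.single_le_sum (fun n _ ↦ hnonneg n) (Finset.mem_range.2 hnN))
  rw [Set.indicator_of_mem hmem]
  have : (shiftedCount a y : ℝ) ≤ shiftedCount a (Real.exp δ * y) + 1 := by exact_mod_cast hle
  linarith

theorem norm_discrepancyIncrement_sq_le {a δ y : ℝ} (ha : a ∈ Set.Icc 0 1) (hδ : 0 < δ)
    (hδ1 : δ ≤ 1 / 4) (hy : 0 < y) {N : ℕ} (hN : δ⁻¹ ≤ N) :
    ‖discrepancyIncrement a (Real.exp δ) y‖ ^ 2 ≤ incrementMajorant a δ N y := by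
  have hcast : discrepancyIncrement a (Real.exp δ) y = (((shiftedCount a y : ℝ) - y⁻¹ -
      ((shiftedCount a (Real.exp δ * y) : ℝ) - (Real.exp δ * y)⁻¹) : ℝ) : ℂ) := by
    simp [discrepancyIncrement]
  rw [hcast, Complex.norm_real, Real.norm_eq_abs, sq_abs, incrementMajorant]
  have hnonneg : 0 ≤ ∑ n ∈ Finset.range N,
      (Set.Ioc (Real.exp (-δ) / (n + 1 + a)) (1 / (n + 1 + a))).indicator
        (fun _ ↦ (1 : ℝ)) y :=
    Finset.sum_nonneg fun n _ ↦ Set.indicator_nonneg (fun _ _ ↦ zero_le_one) _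
  rcases le_or_gt y δ with h | h
  · have hm : y ∈ Set.Ioc 0 δ := ⟨hy, h⟩
    have hm' : y ∉ Set.Ioi δ := not_lt.2 h
    rw [Set.indicator_of_mem hm, Set.indicator_of_notMem hm']
    have hexp : Real.exp δ ≤ 3 :=
      (Real.exp_le_exp.2 (by linarith)).trans (Real.exp_one_lt_d9.le.trans (by norm_num))
    have hey : Real.exp δ * y ≤ 1 := by nlinarith
    have h1 := shiftedCount_le hy (by linarith) ha.1 ha.2
    have h2 := le_shiftedCount (y := y) ha.2
    have h3 := shiftedCount_le (y := Real.exp δ * y) (by positivity) hey ha.1 ha.2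
    have h4 := le_shiftedCount (y := Real.exp δ * y) ha.2
    nlinarith
  · have hm : y ∉ Set.Ioc 0 δ := fun h' ↦ absurd h'.2 (not_le.2 h)
    have hm' : y ∈ Set.Ioi δ := h
    obtain ⟨h1, h2, h3⟩ := shiftedCount_sub_le_sum ha hδ h hN
    rw [Set.indicator_of_notMem hm, Set.indicator_of_mem hm']
    have h1' : (shiftedCount a (Real.exp δ * y) : ℝ) ≤ shiftedCount a y := by exact_mod_cast h1
    have h2' : (shiftedCount a y : ℝ) ≤ shiftedCount a (Real.exp δ * y) + 1 := by exact_mod_cast h2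
    set d : ℝ := (shiftedCount a y : ℝ) - shiftedCount a (Real.exp δ * y) with hd
    have hdd : d ^ 2 ≤ d := by nlinarith
    set e : ℝ := (1 - Real.exp (-δ)) * y⁻¹ with he
    have he2 : e ^ 2 ≤ δ ^ 2 * y ^ (-2 : ℝ) := by
      rw [he, mul_pow, Real.rpow_neg hy.le, Real.rpow_two, inv_pow]
      gcongr
      · linarith [Real.exp_le_one_iff.2 (neg_nonpos.2 hδ.le)]
      · linarith [Real.add_one_le_exp (-δ)]
    have hde : (shiftedCount a y : ℝ) - y⁻¹ -
        ((shiftedCount a (Real.exp δ * y) : ℝ) - (Real.exp δ * y)⁻¹) = d - e := by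
      rw [hd, he, mul_inv, Real.exp_neg]
      ring
    rw [hde]
    nlinarith [sq_nonneg (d + e)]

theorem integrable_incrementMajorant {a δ : ℝ} (hδ : 0 < δ) (N : ℕ) :
    Integrable (incrementMajorant a δ N) := by
  refine Integrable.add (Integrable.add (Integrable.const_mul ?_ _) ?_) (Integrable.const_mul ?_ _)
  · exact integrable_finsetSum _ fun n _ ↦
      (integrable_indicator_iff measurableSet_Ioc).2 (integrableOn_const (by simp))
  · exact (integrable_indicator_iff measurableSet_Ioc).2 (integrableOn_const (by simp))
  · exact (integrable_indicator_iff measurableSet_Ioi).2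
      (integrableOn_Ioi_rpow_of_lt (by norm_num) hδ)

theorem integral_incrementMajorant_le {a δ : ℝ} (ha : 0 ≤ a) (hδ : 0 < δ) (N : ℕ) :
    ∫ y, incrementMajorant a δ N y ≤ δ * (8 + 2 * Real.log N) := by
  have hI : ∀ n : ℕ, Integrable fun y ↦
      (Set.Ioc (Real.exp (-δ) / (n + 1 + a)) (1 / (n + 1 + a))).indicator (fun _ ↦ (1 : ℝ)) y :=
    fun n ↦ (integrable_indicator_iff measurableSet_Ioc).2 (integrableOn_const (by simp))
  have hJ : Integrable ((Set.Ioc 0 δ).indicator fun _ ↦ (4 : ℝ)) :=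
    (integrable_indicator_iff measurableSet_Ioc).2 (integrableOn_const (by simp))
  have hK : Integrable ((Set.Ioi δ).indicator fun y : ℝ ↦ y ^ (-2 : ℝ)) :=
    (integrable_indicator_iff measurableSet_Ioi).2
      (integrableOn_Ioi_rpow_of_lt (by norm_num) hδ)
  have hS := integrable_finsetSum (Finset.range N) fun n _ ↦ hI n
  have hA : Integrable fun y ↦ 2 * ∑ n ∈ Finset.range N,
      (Set.Ioc (Real.exp (-δ) / (n + 1 + a)) (1 / (n + 1 + a))).indicator (fun _ ↦ (1 : ℝ)) y +
        (Set.Ioc 0 δ).indicator (fun _ ↦ 4) y := (hS.const_mul 2).add hJ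
  simp only [incrementMajorant]
  rw [integral_add hA (hK.const_mul _), integral_add (hS.const_mul _) hJ,
    integral_const_mul, integral_const_mul, integral_finsetSum _ fun n _ ↦ hI n,
    integral_indicator measurableSet_Ioc, integral_indicator measurableSet_Ioi,
    integral_Ioi_rpow_of_lt (by norm_num) hδ]
  have hterm : ∀ n ∈ Finset.range N,
      ∫ y, (Set.Ioc (Real.exp (-δ) / (n + 1 + a)) (1 / (n + 1 + a))).indicator
        (fun _ ↦ (1 : ℝ)) y ≤ δ * ((n + 1 : ℕ) : ℝ)⁻¹ := fun n _ ↦ by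
    have hexp1 := Real.exp_le_one_iff.2 (neg_nonpos.2 hδ.le)
    have hexp2 := Real.add_one_le_exp (-δ)
    rw [integral_indicator measurableSet_Ioc, setIntegral_const, smul_eq_mul, mul_one,
      Real.volume_real_Ioc_of_le (div_le_div_of_nonneg_right hexp1 (by positivity)), ← sub_div,
      div_eq_mul_inv]
    push_cast
    exact mul_le_mul (by linarith) (inv_anti₀ (by positivity) (by linarith)) (by positivity) hδ.le
  have hH := harmonic_le_one_add_log N
  rw [harmonic] at hH
  push_cast at hH
  have hsum := Finset.sum_le_sum hterm
  rw [← Finset.mul_sum] at hsum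
  have h2 : (2 * δ ^ 2) * (-δ ^ (-2 + 1 : ℝ) / (-2 + 1)) = 2 * δ := by
    rw [show (-2 + 1 : ℝ) = -1 by norm_num, Real.rpow_neg_one]
    field_simp
  rw [h2, setIntegral_const, Real.volume_real_Ioc_of_le hδ.le, smul_eq_mul]
  push_cast at hsum
  nlinarith [mul_le_mul_of_nonneg_left hH hδ.le]

theorem integral_norm_discrepancyIncrement_sq_le {a δ : ℝ} (ha : a ∈ Set.Icc 0 1) (hδ : 0 < δ)
    (hδ1 : δ ≤ 1 / 4) :
    IntegrableOn (fun y ↦ ‖discrepancyIncrement a (Real.exp δ) y‖ ^ 2) (Set.Ioi 0) ∧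
      ∫ y in Set.Ioi 0, ‖discrepancyIncrement a (Real.exp δ) y‖ ^ 2 ≤
        δ * (8 + 2 * Real.log (2 / δ)) := by
  set N := ⌈δ⁻¹⌉₊ with hNdef
  have hN : δ⁻¹ ≤ N := Nat.le_ceil _
  have hint := integrable_incrementMajorant (a := a) hδ N
  have hle : ∀ᵐ y ∂volume.restrict (Set.Ioi 0),
      ‖discrepancyIncrement a (Real.exp δ) y‖ ^ 2 ≤ incrementMajorant a δ N y := by
    filter_upwards [ae_restrict_mem measurableSet_Ioi] with y hy
    exact norm_discrepancyIncrement_sq_le ha hδ hδ1 hy hN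
  have hint' : IntegrableOn (fun y ↦ ‖discrepancyIncrement a (Real.exp δ) y‖ ^ 2) (Set.Ioi 0) := by
    refine hint.integrableOn.mono'
      ((measurable_discrepancyIncrement a _).norm.pow_const 2).aestronglyMeasurable ?_
    filter_upwards [hle] with y hy
    rwa [Real.norm_of_nonneg (by positivity)]
  refine ⟨hint', (integral_mono_ae hint' hint.integrableOn hle).trans
    ((setIntegral_le_integral hint (ae_of_all _ fun y ↦ ?_)).trans
      ((integral_incrementMajorant_le ha.1 hδ N).trans ?_))⟩
  · have h1 : ∀ n : ℕ, 0 ≤ (Set.Ioc (Real.exp (-δ) / (n + 1 + a)) (1 / (n + 1 + a))).indicator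
        (fun _ ↦ (1 : ℝ)) y := fun n ↦ Set.indicator_nonneg (fun _ _ ↦ zero_le_one) _
    have h2 : 0 ≤ (Set.Ioc 0 δ).indicator (fun _ ↦ (4 : ℝ)) y :=
      Set.indicator_nonneg (fun _ _ ↦ by norm_num) _
    have h3 : 0 ≤ (Set.Ioi δ).indicator (fun y : ℝ ↦ y ^ (-2 : ℝ)) y :=
      Set.indicator_nonneg (fun y hy ↦ Real.rpow_nonneg (hδ.trans hy).le _) _
    have h4 := Finset.sum_nonneg fun n (_ : n ∈ Finset.range N) ↦ h1 n
    simp only [incrementMajorant, Pi.zero_apply]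
    positivity
  · have hδinv : 4 ≤ δ⁻¹ := by rw [le_inv_comm₀ (by norm_num) hδ]; linarith
    have hlt := Nat.ceil_lt_add_one (inv_pos.2 hδ).le
    rw [← hNdef] at hlt
    gcongr
    rw [div_eq_mul_inv]
    linarith

theorem mellinConvergent_of_re_eq {f : ℝ → ℂ} (hf : Measurable f) {s s' : ℂ} (h : s.re = s'.re)
    (hs : MellinConvergent f s) : MellinConvergent f s' := by
  refine Integrable.mono hs ?_ ?_
  · have hpow : Measurable fun y : ℝ ↦ (y : ℂ) ^ (s' - 1) := by fun_prop
    exact (hpow.smul hf).aestronglyMeasurable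
  · filter_upwards [ae_restrict_mem measurableSet_Ioi] with y hy
    rw [norm_smul, norm_smul, Complex.norm_cpow_eq_rpow_re_of_pos hy,
      Complex.norm_cpow_eq_rpow_re_of_pos hy, Complex.sub_re, Complex.sub_re, h]

theorem continuous_hurwitzZetaTail_half_add (a : ℝ) :
    Continuous fun t : ℝ ↦ hurwitzZetaTail a (1 / 2 + t * Complex.I) := by
  refine continuous_iff_continuousAt.2 fun t ↦ ?_
  have h := (differentiableAt_hurwitzZetaTail a (s := 1 / 2 + t * Complex.I)
    (fun h ↦ by simpa using congrArg Complex.re h)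
    (fun h ↦ by simpa using congrArg Complex.re h)).continuousAt
  exact ContinuousAt.comp (f := fun t : ℝ ↦ (1 / 2 + t * Complex.I : ℂ)) h (by fun_prop)

theorem norm_hurwitzZetaTail_sq_le {a T t : ℝ} (ha : a ∈ Set.Icc 0 1) (hT : 2 ≤ T) (ht : 1 ≤ t)
    (htT : t ≤ T) :
    ‖hurwitzZetaTail a (1 / 2 + t * Complex.I)‖ ^ 2 ≤ 64 * T ^ 2 *
      ‖mellin (discrepancyIncrement a (Real.exp (1 / (4 * T)))) (1 / 2 + t * Complex.I)‖ ^ 2 := by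
  set s : ℂ := 1 / 2 + t * Complex.I with hs
  have hre : s.re = 1 / 2 := by simp [hs]
  have him : s.im = t := by simp [hs]
  have hs0 : s ≠ 0 := fun h ↦ by simp [h] at hre
  have hspos : 0 < ‖s‖ := norm_pos_iff.2 hs0
  have hsle : ‖s‖ ≤ 2 * T := by
    have := Complex.norm_le_abs_re_add_abs_im s
    rw [hre, him, abs_of_nonneg (by norm_num), abs_of_nonneg (by linarith)] at this
    linarith
  have hM := (hasMellin_discrepancyIncrement ha (Real.exp_pos (1 / (4 * T))) (s := s)
    (by rw [hre]; norm_num) (by rw [hre]; norm_num) (by rw [him]; linarith)).2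
  have hcpow : (Real.exp (1 / (4 * T)) : ℂ) ^ (-s) = Complex.exp (-((1 / (4 * T) : ℝ) * s)) := by
    rw [Complex.cpow_def_of_ne_zero (by exact_mod_cast (Real.exp_pos _).ne'),
      ← Complex.ofReal_log (Real.exp_pos _).le, Real.log_exp, mul_neg]
  set z : ℂ := -((1 / (4 * T) : ℝ) * s) with hz
  have hznorm : ‖z‖ = ‖s‖ / (4 * T) := by
    rw [hz, norm_neg, norm_mul, Complex.norm_real, Real.norm_of_nonneg (by positivity)]
    ring
  have hz2 : ‖z‖ ≤ 1 / 2 := by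
    rw [hznorm, div_le_iff₀ (by linarith)]
    linarith
  have hlow : ‖z‖ / 2 ≤ ‖1 - Complex.exp z‖ := by
    have h1 := Complex.norm_exp_sub_one_sub_id_le (hz2.trans (by norm_num))
    have h2 : ‖z‖ ≤ ‖1 - Complex.exp z‖ + ‖Complex.exp z - 1 - z‖ := by
      rw [← norm_neg z]
      refine le_trans (le_of_eq ?_) (norm_add_le _ _)
      congr 1
      ring
    nlinarith [norm_nonneg z]
  rw [hM, hcpow, norm_mul, norm_div]
  have hkey : ‖hurwitzZetaTail a s‖ ≤
      8 * T * (‖1 - Complex.exp z‖ * (‖hurwitzZetaTail a s‖ / ‖s‖)) := by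
    have h3 : 8 * T * (‖z‖ / 2 * (‖hurwitzZetaTail a s‖ / ‖s‖)) = ‖hurwitzZetaTail a s‖ := by
      rw [hznorm]
      field_simp
      norm_num
    rw [← h3]
    gcongr
    rw [h3]
  refine (pow_le_pow_left₀ (norm_nonneg _) hkey 2).trans_eq ?_
  ring

theorem integral_norm_hurwitzZetaTail_sq_le {a T : ℝ} (ha : a ∈ Set.Icc 0 1) (hT : 2 ≤ T) :
    ∫ t in (1 : ℝ)..T, ‖hurwitzZetaTail a (1 / 2 + t * Complex.I)‖ ^ 2 ≤
      32 * Real.pi * T * (8 + 2 * Real.log (8 * T)) := by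
  have hδ : 0 < 1 / (4 * T) := by positivity
  have hδ1 : 1 / (4 * T) ≤ 1 / 4 := by gcongr; linarith
  obtain ⟨hL2, hle⟩ := integral_norm_discrepancyIncrement_sq_le ha hδ hδ1
  have hconv : MellinConvergent (discrepancyIncrement a (Real.exp (1 / (4 * T)))) (1 / 2) :=
    mellinConvergent_of_re_eq (measurable_discrepancyIncrement _ _) (s := 1 / 2 + Complex.I)
      (by simp) (hasMellin_discrepancyIncrement ha (Real.exp_pos _) (by simp) (by norm_num)
        (by simp)).1
  obtain ⟨hint, heq⟩ := integral_norm_mellin_sq hconv hL2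
  have h1T : (1 : ℝ) ≤ T := by linarith
  calc ∫ t in (1 : ℝ)..T, ‖hurwitzZetaTail a (1 / 2 + t * Complex.I)‖ ^ 2
      ≤ ∫ t in (1 : ℝ)..T, 64 * T ^ 2 *
        ‖mellin (discrepancyIncrement a (Real.exp (1 / (4 * T)))) (1 / 2 + t * Complex.I)‖ ^ 2 :=
        intervalIntegral.integral_mono_on h1T
          (((continuous_hurwitzZetaTail_half_add a).norm.pow 2).intervalIntegrable _ _)
          (hint.const_mul _).intervalIntegrable
          fun t ht ↦ norm_hurwitzZetaTail_sq_le ha hT ht.1 ht.2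
    _ ≤ 64 * T ^ 2 * ∫ t : ℝ,
        ‖mellin (discrepancyIncrement a (Real.exp (1 / (4 * T)))) (1 / 2 + t * Complex.I)‖ ^ 2 := by
        rw [intervalIntegral.integral_const_mul, intervalIntegral.integral_of_le h1T]
        gcongr
        · exact ae_of_all _ fun t ↦ by positivity
        · exact Measure.restrict_le_self
    _ ≤ 64 * T ^ 2 * (2 * Real.pi * (1 / (4 * T) * (8 + 2 * Real.log (2 / (1 / (4 * T)))))) := by
        rw [heq]
        gcongr
    _ = 32 * Real.pi * T * (8 + 2 * Real.log (8 * T)) := by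
        rw [show 2 / (1 / (4 * T)) = 8 * T by field_simp; norm_num]
        field_simp
        ring

theorem sum_dirichletCharacter_mul_conj {r : ℕ} [NeZero r] (a : ZMod r) {b : ZMod r}
    (hb : IsUnit b) :
    ∑ χ : DirichletCharacter ℂ r, χ a * (starRingEnd ℂ) (χ b) =
      if b = a then (Nat.totient r : ℂ) else 0 := by
  rw [← DirichletCharacter.sum_char_inv_mul_char_eq ℂ hb a]
  refine Finset.sum_congr rfl fun χ _ ↦ ?_
  obtain ⟨u, rfl⟩ := hb
  rw [starRingEnd_apply, MulChar.star_apply', MulChar.inv_apply, Ring.inverse_unit,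
    ZMod.inv_coe_unit, mul_comm]

theorem sum_norm_sum_dirichletCharacter_mul_sq (r : ℕ) [NeZero r] (h : ZMod r → ℂ) :
    ∑ χ : DirichletCharacter ℂ r, ‖∑ a, χ a * h a‖ ^ 2 ≤
      (Nat.totient r : ℝ) * ∑ a, ‖h a‖ ^ 2 := by
  have hsq : ∀ χ : DirichletCharacter ℂ r, ((‖∑ a, χ a * h a‖ ^ 2 : ℝ) : ℂ) =
      ∑ b : ZMod r, ∑ a : ZMod r, (χ a * (starRingEnd ℂ) (χ b)) *
        (h a * (starRingEnd ℂ) (h b)) := fun χ ↦ by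
    rw [Complex.ofReal_pow, ← Complex.mul_conj', map_sum, Finset.sum_mul_sum, Finset.sum_comm]
    refine Finset.sum_congr rfl fun b _ ↦ Finset.sum_congr rfl fun a _ ↦ ?_
    rw [map_mul]
    ring
  have key : ((∑ χ : DirichletCharacter ℂ r, ‖∑ a, χ a * h a‖ ^ 2 : ℝ) : ℂ) =
      ((∑ b : ZMod r, if IsUnit b then (Nat.totient r : ℝ) * ‖h b‖ ^ 2 else 0 : ℝ) : ℂ) := by
    rw [Complex.ofReal_sum, Finset.sum_congr rfl fun χ _ ↦ hsq χ, Finset.sum_comm,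
      Complex.ofReal_sum]
    refine Finset.sum_congr rfl fun b _ ↦ ?_
    rw [Finset.sum_comm]
    split_ifs with hb
    · simp_rw [← Finset.sum_mul, sum_dirichletCharacter_mul_conj _ hb]
      simp [Complex.mul_conj']
    · rw [Complex.ofReal_zero]
      exact Finset.sum_eq_zero fun a _ ↦ Finset.sum_eq_zero fun χ _ ↦ by
        rw [χ.map_nonunit hb, map_zero, mul_zero, zero_mul]
  rw [Complex.ofReal_inj.1 key, Finset.mul_sum]
  refine Finset.sum_le_sum fun b _ ↦ ?_
  split_ifs
  · exact le_rfl
  · positivity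

theorem sum_inv_val_le (r : ℕ) [NeZero r] :
    ∑ j : ZMod r, (j.val : ℝ)⁻¹ ≤ 1 + Real.log r := by
  obtain ⟨n, rfl⟩ := Nat.exists_eq_succ_of_ne_zero (NeZero.ne r)
  have h1 : ∑ j : ZMod (n + 1), (j.val : ℝ)⁻¹ = ∑ k ∈ Finset.range (n + 1), (k : ℝ)⁻¹ :=
    Fin.sum_univ_eq_sum_range (fun k ↦ (k : ℝ)⁻¹) (n + 1)
  have h2 := harmonic_le_one_add_log (n + 1)
  rw [harmonic] at h2
  push_cast at h2
  rw [Finset.sum_range_succ] at h2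
  have h3 : 0 ≤ ((n : ℝ) + 1)⁻¹ := by positivity
  refine h1.le.trans ?_
  rw [Finset.sum_range_succ']
  push_cast
  simp only [inv_zero]
  linarith

theorem norm_hurwitzZeta_sq_le {a : ℝ} (ha : 0 ≤ a) (t : ℝ) :
    ‖HurwitzZeta.hurwitzZeta (a : UnitAddCircle) (1 / 2 + t * Complex.I)‖ ^ 2 ≤
      2 * ‖hurwitzZetaTail a (1 / 2 + t * Complex.I)‖ ^ 2 + 2 * a⁻¹ := by
  set s : ℂ := 1 / 2 + t * Complex.I with hs
  have hre : s.re = 1 / 2 := by simp [hs]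
  have hs0 : s ≠ 0 := fun h ↦ by simp [h] at hre
  have hcpow : ‖(a : ℂ) ^ (-s)‖ ^ 2 = a⁻¹ := by
    rcases ha.eq_or_lt with rfl | ha
    · simp [hs0]
    · rw [Complex.norm_cpow_eq_rpow_re_of_pos ha, Complex.neg_re, hre, ← Real.rpow_natCast,
        ← Real.rpow_mul ha.le, ← Real.rpow_neg_one]
      norm_num
  have h := norm_add_le (hurwitzZetaTail a s) ((a : ℂ) ^ (-s))
  rw [hurwitzZetaTail, sub_add_cancel, ← hurwitzZetaTail] at h
  have h2 := pow_le_pow_left₀ (norm_nonneg _) h 2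
  rw [← hcpow]
  nlinarith [sq_nonneg (‖hurwitzZetaTail a s‖ - ‖(a : ℂ) ^ (-s)‖)]

theorem continuous_hurwitzZeta_half_add (x : UnitAddCircle) :
    Continuous fun t : ℝ ↦ HurwitzZeta.hurwitzZeta x (1 / 2 + t * Complex.I) := by
  refine continuous_iff_continuousAt.2 fun t ↦ ?_
  have h := (HurwitzZeta.differentiableAt_hurwitzZeta x (s := 1 / 2 + t * Complex.I)
    (fun h ↦ by simpa using congrArg Complex.re h)).continuousAt
  exact ContinuousAt.comp (f := fun t : ℝ ↦ (1 / 2 + t * Complex.I : ℂ)) h (by fun_prop)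

theorem integral_norm_hurwitzZeta_sq_le {a T : ℝ} (ha : a ∈ Set.Icc 0 1) (hT : 2 ≤ T) :
    ∫ t in (1 : ℝ)..T, ‖HurwitzZeta.hurwitzZeta (a : UnitAddCircle) (1 / 2 + t * Complex.I)‖ ^ 2 ≤
      64 * Real.pi * T * (8 + 2 * Real.log (8 * T)) + 2 * T * a⁻¹ := by
  have h1T : (1 : ℝ) ≤ T := by linarith
  have hint : IntervalIntegrable
      (fun t : ℝ ↦ 2 * ‖hurwitzZetaTail a (1 / 2 + t * Complex.I)‖ ^ 2) volume 1 T :=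
    (((continuous_hurwitzZetaTail_half_add a).norm.pow 2).const_mul 2).intervalIntegrable _ _
  have hint' : IntervalIntegrable (fun t : ℝ ↦
      ‖HurwitzZeta.hurwitzZeta (a : UnitAddCircle) (1 / 2 + t * Complex.I)‖ ^ 2) volume 1 T :=
    ((continuous_hurwitzZeta_half_add a).norm.pow 2).intervalIntegrable _ _
  have h := intervalIntegral.integral_mono_on h1T hint'
    (hint.add (intervalIntegrable_const (c := 2 * a⁻¹)))
    fun t _ ↦ norm_hurwitzZeta_sq_le ha.1 t
  rw [intervalIntegral.integral_add hint intervalIntegrable_const,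
    intervalIntegral.integral_const_mul, intervalIntegral.integral_const, smul_eq_mul] at h
  have h2 := integral_norm_hurwitzZetaTail_sq_le ha hT
  have h3 : 0 ≤ a⁻¹ := inv_nonneg.2 ha.1
  linarith

theorem norm_LFunction_half_add_sq {r : ℕ} [NeZero r] (χ : DirichletCharacter ℂ r) (t : ℝ) :
    ‖DirichletCharacter.LFunction χ (1 / 2 + t * Complex.I)‖ ^ 2 = (r : ℝ)⁻¹ *
      ‖∑ j : ZMod r, χ j *
        HurwitzZeta.hurwitzZeta (ZMod.toAddCircle j) (1 / 2 + t * Complex.I)‖ ^ 2 := by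
  have hr : 0 < (r : ℝ) := Nat.cast_pos.2 (NeZero.pos r)
  rw [DirichletCharacter.LFunction, ZMod.LFunction, norm_mul, mul_pow,
    Complex.norm_natCast_cpow_of_pos (NeZero.pos r), ← Real.rpow_natCast, ← Real.rpow_mul hr.le,
    ← Real.rpow_neg_one]
  norm_num

theorem sum_integral_norm_LFunction_sq_le (r : ℕ) [NeZero r] {T : ℝ} (hT : 2 ≤ T) :
    ∑ χ : DirichletCharacter ℂ r,
        ∫ t in (1 : ℝ)..T, ‖DirichletCharacter.LFunction χ (1 / 2 + t * Complex.I)‖ ^ 2 ≤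
      Nat.totient r * (64 * Real.pi * T * (8 + 2 * Real.log (8 * T)) +
        2 * T * (1 + Real.log r)) := by
  have h1T : (1 : ℝ) ≤ T := by linarith
  have hr : 0 < (r : ℝ) := Nat.cast_pos.2 (NeZero.pos r)
  have hcont : ∀ χ : DirichletCharacter ℂ r, Continuous fun t : ℝ ↦
      ‖DirichletCharacter.LFunction χ (1 / 2 + t * Complex.I)‖ ^ 2 := fun χ ↦ by
    simp_rw [norm_LFunction_half_add_sq]
    exact ((continuous_finsetSum _ fun j _ ↦
      (continuous_hurwitzZeta_half_add _).const_mul _).norm.pow 2).const_mul _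
  have hcont' : ∀ j : ZMod r, Continuous fun t : ℝ ↦
      ‖HurwitzZeta.hurwitzZeta (ZMod.toAddCircle j) (1 / 2 + t * Complex.I)‖ ^ 2 := fun j ↦
    (continuous_hurwitzZeta_half_add _).norm.pow 2
  have hterm : ∀ j : ZMod r, ∫ t in (1 : ℝ)..T,
      ‖HurwitzZeta.hurwitzZeta (ZMod.toAddCircle j) (1 / 2 + t * Complex.I)‖ ^ 2 ≤
        64 * Real.pi * T * (8 + 2 * Real.log (8 * T)) + 2 * T * r * (j.val : ℝ)⁻¹ := fun j ↦ by
    have hmem : (j.val / r : ℝ) ∈ Set.Icc (0 : ℝ) 1 :=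
      ⟨by positivity, div_le_one_of_le₀ (by exact_mod_cast j.val_lt.le) hr.le⟩
    have h := integral_norm_hurwitzZeta_sq_le hmem hT
    rw [ZMod.toAddCircle_apply]
    refine h.trans_eq ?_
    rw [inv_div]
    ring
  calc _ = ∫ t in (1 : ℝ)..T, ∑ χ : DirichletCharacter ℂ r,
          ‖DirichletCharacter.LFunction χ (1 / 2 + t * Complex.I)‖ ^ 2 :=
        (intervalIntegral.integral_finsetSum fun χ _ ↦ (hcont χ).intervalIntegrable _ _).symm
    _ ≤ ∫ t in (1 : ℝ)..T, (r : ℝ)⁻¹ * (Nat.totient r * ∑ j : ZMod r,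
          ‖HurwitzZeta.hurwitzZeta (ZMod.toAddCircle j) (1 / 2 + t * Complex.I)‖ ^ 2) := by
        refine intervalIntegral.integral_mono_on h1T
          ((continuous_finsetSum _ fun χ _ ↦ hcont χ).intervalIntegrable _ _)
          ((((continuous_finsetSum _ fun j _ ↦ hcont' j).const_mul _).const_mul
            _).intervalIntegrable _ _) fun t _ ↦ ?_
        simp_rw [norm_LFunction_half_add_sq, ← Finset.mul_sum]
        gcongr
        exact sum_norm_sum_dirichletCharacter_mul_sq r _
    _ = (r : ℝ)⁻¹ * (Nat.totient r * ∑ j : ZMod r, ∫ t in (1 : ℝ)..T,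
          ‖HurwitzZeta.hurwitzZeta (ZMod.toAddCircle j) (1 / 2 + t * Complex.I)‖ ^ 2) := by
        rw [intervalIntegral.integral_const_mul, intervalIntegral.integral_const_mul,
          intervalIntegral.integral_finsetSum fun j _ ↦ (hcont' j).intervalIntegrable _ _]
    _ ≤ (r : ℝ)⁻¹ * (Nat.totient r * (r * (64 * Real.pi * T * (8 + 2 * Real.log (8 * T))) +
          2 * T * r * (1 + Real.log r))) := by
        gcongr
        refine (Finset.sum_le_sum fun j _ ↦ hterm j).trans ?_
        rw [Finset.sum_add_distrib, Finset.sum_const, Finset.card_univ, ZMod.card, nsmul_eq_mul,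
          ← Finset.mul_sum]
        exact add_le_add le_rfl (mul_le_mul_of_nonneg_left (sum_inv_val_le r) (by positivity))
    _ = _ := by
        field_simp

theorem second_moment_LFunction :
    ∃ C : ℝ, 0 < C ∧
      ∀ (r : ℕ) [NeZero r] (T : ℝ), 2 ≤ T →
        ∑ χ : DirichletCharacter ℂ r,
            ∫ t in (1 : ℝ)..T, ‖DirichletCharacter.LFunction χ (1 / 2 + t * Complex.I)‖ ^ 2 ≤
          C * (Nat.totient r : ℝ) * T * Real.log ((r : ℝ) * T) := by
  refine ⟨64 * Real.pi * 20 + 6, by positivity, fun r _ T hT ↦ ?_⟩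
  refine (sum_integral_norm_LFunction_sq_le r hT).trans ?_
  have hr : (1 : ℝ) ≤ r := by exact_mod_cast NeZero.one_le (n := r)
  have hlog2 := Real.log_two_gt_d9
  have hT2 : Real.log 2 ≤ Real.log T := Real.log_le_log (by norm_num) hT
  have hlogr : 0 ≤ Real.log r := Real.log_nonneg hr
  have hmul : Real.log (r * T) = Real.log r + Real.log T :=
    Real.log_mul (by positivity) (by positivity)
  have h8 : Real.log (8 * T) = 3 * Real.log 2 + Real.log T := by
    rw [Real.log_mul (by norm_num) (by positivity), show (8 : ℝ) = 2 ^ 3 by norm_num,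
      Real.log_pow]
    norm_num
  have h1 : 8 + 2 * Real.log (8 * T) ≤ 20 * Real.log (r * T) := by
    rw [h8, hmul]
    linarith
  have h2 : 1 + Real.log r ≤ 3 * Real.log (r * T) := by
    rw [hmul]
    linarith
  calc (Nat.totient r : ℝ) * (64 * Real.pi * T * (8 + 2 * Real.log (8 * T)) +
        2 * T * (1 + Real.log r))
      ≤ Nat.totient r * (64 * Real.pi * T * (20 * Real.log (r * T)) +
        2 * T * (3 * Real.log (r * T))) := by gcongr
    _ = (64 * Real.pi * 20 + 6) * (Nat.totient r : ℝ) * T * Real.log (r * T) := by ring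
end

section
/- One has limsup_{n → ∞} (log a(n))·(log log n)/(log n) = (log 5)/4. -/
/-- `abelianCount n` is the number of isomorphism classes of abelian groups of order `n`:
the multiplicative function with `abelianCount (p^α) = P(α)`, the number of partitions of `α`. -/
def abelianCount (n : ℕ) : ℕ :=
  n.factorization.prod fun _ α => Fintype.card (Nat.Partition α)

open Finset in
theorem Nat.Partition.card_filter_le_count {n k j m : ℕ} (hm : j * k = m) :
    #{π : n.Partition | j ≤ π.parts.count k} ≤ Fintype.card (n - m).Partition := by
  classical
  let f : n.Partition → (n - m).Partition := fun π =>
    if h : j ≤ π.parts.count k then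
      { parts := π.parts - Multiset.replicate j k
        parts_pos := fun {i} hi =>
          π.parts_pos (Multiset.mem_of_le (Multiset.sub_le_self _ _) hi)
        parts_sum := by
          have h1 := Multiset.le_count_iff_replicate_le.mp h
          have h2 := congrArg Multiset.sum (Multiset.sub_add_cancel h1)
          rw [Multiset.sum_add, π.parts_sum, Multiset.sum_replicate, smul_eq_mul, hm] at h2
          omega }
    else Nat.Partition.indiscrete _
  refine Finset.card_le_card_of_injOn f (fun _ _ => Finset.mem_univ _) ?_
  intro π hπ ρ hρ hf
  simp only [coe_filter, mem_univ, true_and, Set.mem_ofPred_eq] at hπ hρ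
  simp only [f, hπ, hρ, dif_pos, Nat.Partition.mk.injEq] at hf
  ext1
  rw [← Multiset.sub_add_cancel (Multiset.le_count_iff_replicate_le.mp hπ), hf,
    Multiset.sub_add_cancel (Multiset.le_count_iff_replicate_le.mp hρ)]

open Finset in
theorem Nat.Partition.le_sum_divisors {n : ℕ} (π : n.Partition) :
    n ≤ ∑ m ∈ Icc 1 n, ∑ k ∈ m.divisors, if m / k ≤ π.parts.count k then k else 0 := by
  classical
  have hsub : π.parts.toFinset ⊆ Icc 1 n := fun k hk => by
    have hk' := Multiset.mem_toFinset.mp hk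
    exact Finset.mem_Icc.mpr ⟨π.parts_pos hk', π.le_of_mem_parts hk'⟩
  have hn : n = ∑ k ∈ π.parts.toFinset, π.parts.count k * k := by
    conv_lhs => rw [← π.parts_sum, Finset.sum_multiset_count]
    simp
  have hcount : ∀ k ∈ π.parts.toFinset, π.parts.count k * k ≤ n := fun k hk => by
    conv_rhs => rw [hn]
    exact Finset.single_le_sum (f := fun k => π.parts.count k * k) (fun _ _ => Nat.zero_le _) hk
  have hdiv : ∀ m ∈ Icc 1 n,
      (∑ k ∈ m.divisors, if m / k ≤ π.parts.count k then k else 0) =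
        ∑ k ∈ Icc 1 n, if k ∣ m ∧ m / k ≤ π.parts.count k then k else 0 := by
    intro m hm
    rw [Finset.mem_Icc] at hm
    have : m.divisors = (Icc 1 n).filter (· ∣ m) := by
      ext k
      simp only [Nat.mem_divisors, mem_filter, Finset.mem_Icc]
      constructor
      · rintro ⟨h, h'⟩
        exact ⟨⟨Nat.pos_of_dvd_of_pos h (by omega), (Nat.le_of_dvd (by omega) h).trans hm.2⟩, h⟩
      · rintro ⟨_, h⟩
        exact ⟨h, by omega⟩
    rw [this, Finset.sum_filter]
    refine Finset.sum_congr rfl fun k _ => ?_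
    rw [ite_and]
  rw [Finset.sum_congr rfl hdiv, Finset.sum_comm]
  conv_lhs => rw [hn]
  refine (Finset.sum_le_sum fun k hk => ?_).trans
    (Finset.sum_le_sum_of_subset hsub)
  have hk1 : 1 ≤ k := (Finset.mem_Icc.mp (hsub hk)).1
  rw [← Finset.sum_filter, Finset.sum_const, smul_eq_mul]
  refine Nat.mul_le_mul_right _ ?_
  calc π.parts.count k = #(Icc 1 (π.parts.count k)) := by simp
    _ ≤ _ := by
      refine Finset.card_le_card_of_injOn (fun j => k * j) ?_ ?_
      · intro j hj
        simp only [coe_Icc, Set.mem_Icc] at hj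
        simp only [coe_filter, Finset.mem_Icc, Set.mem_ofPred_eq, dvd_mul_right, true_and]
        refine ⟨⟨Nat.mul_pos hk1 hj.1, ?_⟩, ?_⟩
        · rw [mul_comm]
          exact (Nat.mul_le_mul_right _ hj.2).trans (hcount k hk)
        · rw [Nat.mul_div_cancel_left _ hk1]
          exact hj.2
      · intro i _ j _ h
        exact Nat.eq_of_mul_eq_mul_left hk1 h

open Finset ArithmeticFunction in
theorem Nat.Partition.mul_card_le (n : ℕ) :
    n * Fintype.card n.Partition ≤
      ∑ m ∈ Icc 1 n, sigma 1 m * Fintype.card (n - m).Partition := by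
  classical
  calc n * Fintype.card n.Partition = ∑ _π : n.Partition, n := by
        simp [mul_comm]
    _ ≤ ∑ π : n.Partition, ∑ m ∈ Icc 1 n, ∑ k ∈ m.divisors,
          if m / k ≤ π.parts.count k then k else 0 :=
        Finset.sum_le_sum fun π _ => π.le_sum_divisors
    _ = ∑ m ∈ Icc 1 n, ∑ k ∈ m.divisors, ∑ π : n.Partition,
          if m / k ≤ π.parts.count k then k else 0 := by
        rw [Finset.sum_comm]
        exact Finset.sum_congr rfl fun m _ => Finset.sum_comm
    _ ≤ ∑ m ∈ Icc 1 n, ∑ k ∈ m.divisors, k * Fintype.card (n - m).Partition := by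
        refine Finset.sum_le_sum fun m _ => Finset.sum_le_sum fun k hk => ?_
        rw [← Finset.sum_filter, Finset.sum_const, smul_eq_mul, mul_comm]
        exact Nat.mul_le_mul_left _ (card_filter_le_count
          (Nat.div_mul_cancel (Nat.dvd_of_mem_divisors hk)))
    _ = _ := by
        refine Finset.sum_congr rfl fun m _ => ?_
        rw [← Finset.sum_mul, sigma_one_apply]

open Finset ArithmeticFunction in
/-- Exponential bounds for partition numbers propagate as soon as the weighted sum of divisor
sums is small enough. -/
theorem Nat.Partition.card_le_of_sum_sigma_le {n : ℕ} (hn : n ≠ 0) {A x y : ℝ} (hA : 0 ≤ A)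
    (hy : 0 ≤ y) (hxy : x * y = 1)
    (hlt : ∀ k < n, (Fintype.card k.Partition : ℝ) ≤ A * y ^ k)
    (hsum : ∑ m ∈ Icc 1 n, (sigma 1 m : ℝ) * x ^ m ≤ n) :
    (Fintype.card n.Partition : ℝ) ≤ A * y ^ n := by
  have hn' : (0 : ℝ) < n := by positivity
  have h := Nat.Partition.mul_card_le n
  have h' : (n : ℝ) * Fintype.card n.Partition ≤
      ∑ m ∈ Icc 1 n, (sigma 1 m : ℝ) * Fintype.card (n - m).Partition := by exact_mod_cast h
  refine le_of_mul_le_mul_left (h'.trans ?_) hn'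
  calc ∑ m ∈ Icc 1 n, (sigma 1 m : ℝ) * Fintype.card (n - m).Partition
      ≤ ∑ m ∈ Icc 1 n, ((sigma 1 m : ℝ) * x ^ m) * (A * y ^ n) := by
        refine Finset.sum_le_sum fun m hm => ?_
        rw [Finset.mem_Icc] at hm
        have e : x ^ m * y ^ n = y ^ (n - m) := by
          conv_lhs => rw [← Nat.add_sub_cancel' hm.2, pow_add, ← mul_assoc, ← mul_pow, hxy]
          simp
        rw [mul_assoc]
        refine mul_le_mul_of_nonneg_left ?_ (Nat.cast_nonneg _)
        calc (Fintype.card (n - m).Partition : ℝ) ≤ A * y ^ (n - m) := hlt _ (by omega)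
          _ = x ^ m * (A * y ^ n) := by rw [← e]; ring
    _ = (∑ m ∈ Icc 1 n, (sigma 1 m : ℝ) * x ^ m) * (A * y ^ n) := by rw [Finset.sum_mul]
    _ ≤ n * (A * y ^ n) := mul_le_mul_of_nonneg_right hsum (by positivity)

theorem sq_mul_pow_le_one {k : ℕ} (hk : 13 ≤ k) : (k : ℝ) ^ 2 * (669 / 1000) ^ k ≤ 1 := by
  induction k, hk using Nat.le_induction with
  | base => norm_num
  | succ k hk ih =>
    have hk' : (13 : ℝ) ≤ k := by exact_mod_cast hk
    refine le_trans ?_ ih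
    rw [pow_succ _ k, mul_comm (_ ^ k), ← mul_assoc]
    refine mul_le_mul_of_nonneg_right ?_ (by positivity)
    push_cast
    nlinarith

open Finset ArithmeticFunction in
theorem sum_sigma_mul_pow_le {n : ℕ} (hn : 13 ≤ n) :
    ∑ m ∈ Icc 1 n, (sigma 1 m : ℝ) * (669 / 1000) ^ m ≤ n := by
  induction n, hn using Nat.le_induction with
  | base =>
    have h : ∀ m : ℕ, (sigma 1 m : ℝ) = ((∑ d ∈ m.divisors, d : ℕ) : ℝ) := fun m => by
      rw [sigma_one_apply]
    simp only [h]
    have e : (Icc 1 13 : Finset ℕ) = {1, 2, 3, 4, 5, 6, 7, 8, 9, 10, 11, 12, 13} := by decide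
    rw [e]
    have d1 : ∑ d ∈ Nat.divisors 1, d = 1 := by decide
    have d2 : ∑ d ∈ Nat.divisors 2, d = 3 := by decide
    have d3 : ∑ d ∈ Nat.divisors 3, d = 4 := by decide
    have d4 : ∑ d ∈ Nat.divisors 4, d = 7 := by decide
    have d5 : ∑ d ∈ Nat.divisors 5, d = 6 := by decide
    have d6 : ∑ d ∈ Nat.divisors 6, d = 12 := by decide
    have d7 : ∑ d ∈ Nat.divisors 7, d = 8 := by decide
    have d8 : ∑ d ∈ Nat.divisors 8, d = 15 := by decide
    have d9 : ∑ d ∈ Nat.divisors 9, d = 13 := by decide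
    have d10 : ∑ d ∈ Nat.divisors 10, d = 18 := by decide
    have d11 : ∑ d ∈ Nat.divisors 11, d = 12 := by decide
    have d12 : ∑ d ∈ Nat.divisors 12, d = 28 := by decide
    have d13 : ∑ d ∈ Nat.divisors 13, d = 14 := by decide
    simp only [sum_insert, sum_singleton, mem_insert, mem_singleton, not_false_eq_true,
      Nat.reduceEqDiff, or_self, OfNat.one_ne_ofNat, d1, d2, d3, d4, d5, d6, d7, d8, d9, d10, d11,
      d12, d13]
    norm_num
  | succ n hn ih =>
    rw [Finset.sum_Icc_succ_top (by omega)]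
    have h1 : (sigma 1 (n + 1) : ℝ) ≤ ((n + 1 : ℕ) : ℝ) ^ 2 := by
      exact_mod_cast sigma_le_pow_succ 1 (n + 1)
    have h2 := sq_mul_pow_le_one (k := n + 1) (by omega)
    have h3 : (sigma 1 (n + 1) : ℝ) * (669 / 1000) ^ (n + 1) ≤ 1 :=
      (mul_le_mul_of_nonneg_right h1 (by positivity)).trans h2
    push_cast
    linarith

open Finset ArithmeticFunction in
theorem Nat.Partition.card_pow_four_le_of_lt {n : ℕ} (hn : n < 13) :
    Fintype.card n.Partition ^ 4 ≤ 5 ^ n := by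
  have key := Nat.Partition.mul_card_le
  simp only [sigma_one_apply] at key
  have d1 : ∑ d ∈ Nat.divisors 1, d = 1 := by decide
  have d2 : ∑ d ∈ Nat.divisors 2, d = 3 := by decide
  have d3 : ∑ d ∈ Nat.divisors 3, d = 4 := by decide
  have d4 : ∑ d ∈ Nat.divisors 4, d = 7 := by decide
  have d5 : ∑ d ∈ Nat.divisors 5, d = 6 := by decide
  have d6 : ∑ d ∈ Nat.divisors 6, d = 12 := by decide
  have d7 : ∑ d ∈ Nat.divisors 7, d = 8 := by decide
  have d8 : ∑ d ∈ Nat.divisors 8, d = 15 := by decide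
  have d9 : ∑ d ∈ Nat.divisors 9, d = 13 := by decide
  have d10 : ∑ d ∈ Nat.divisors 10, d = 18 := by decide
  have d11 : ∑ d ∈ Nat.divisors 11, d = 12 := by decide
  have d12 : ∑ d ∈ Nat.divisors 12, d = 28 := by decide
  have p0 : Fintype.card (Nat.Partition 0) ≤ 1 := by simp
  have k1 := key 1
  have k2 := key 2
  have k3 := key 3
  have k4 := key 4
  have k5 := key 5
  have k6 := key 6
  have k7 := key 7
  have k8 := key 8
  have k9 := key 9
  have k10 := key 10
  have k11 := key 11
  have k12 := key 12
  simp only [Finset.sum_Icc_succ_top, Nat.reduceLeDiff, Finset.Icc_self, Finset.sum_singleton,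
    Nat.reduceSub, d1, d2, d3, d4, d5, d6, d7, d8, d9, d10, d11, d12,
    Nat.reduceAdd] at k1 k2 k3 k4 k5 k6 k7 k8 k9 k10 k11 k12
  have p1 : Fintype.card (Nat.Partition 1) ≤ 1 := by omega
  have p2 : Fintype.card (Nat.Partition 2) ≤ 2 := by omega
  have p3 : Fintype.card (Nat.Partition 3) ≤ 3 := by omega
  have p4 : Fintype.card (Nat.Partition 4) ≤ 5 := by omega
  have p5 : Fintype.card (Nat.Partition 5) ≤ 7 := by omega
  have p6 : Fintype.card (Nat.Partition 6) ≤ 11 := by omega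
  have p7 : Fintype.card (Nat.Partition 7) ≤ 15 := by omega
  have p8 : Fintype.card (Nat.Partition 8) ≤ 22 := by omega
  have p9 : Fintype.card (Nat.Partition 9) ≤ 30 := by omega
  have p10 : Fintype.card (Nat.Partition 10) ≤ 42 := by omega
  have p11 : Fintype.card (Nat.Partition 11) ≤ 56 := by omega
  have p12 : Fintype.card (Nat.Partition 12) ≤ 77 := by omega
  interval_cases n
  · exact (Nat.pow_le_pow_left p0 4).trans (by norm_num)
  · exact (Nat.pow_le_pow_left p1 4).trans (by norm_num)
  · exact (Nat.pow_le_pow_left p2 4).trans (by norm_num)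
  · exact (Nat.pow_le_pow_left p3 4).trans (by norm_num)
  · exact (Nat.pow_le_pow_left p4 4).trans (by norm_num)
  · exact (Nat.pow_le_pow_left p5 4).trans (by norm_num)
  · exact (Nat.pow_le_pow_left p6 4).trans (by norm_num)
  · exact (Nat.pow_le_pow_left p7 4).trans (by norm_num)
  · exact (Nat.pow_le_pow_left p8 4).trans (by norm_num)
  · exact (Nat.pow_le_pow_left p9 4).trans (by norm_num)
  · exact (Nat.pow_le_pow_left p10 4).trans (by norm_num)
  · exact (Nat.pow_le_pow_left p11 4).trans (by norm_num)
  · exact (Nat.pow_le_pow_left p12 4).trans (by norm_num)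

open Finset ArithmeticFunction in
theorem Nat.Partition.card_le_pow {c : ℝ} (hc : 0 < c) (hc4 : c ^ 4 = 5) (n : ℕ) :
    (Fintype.card n.Partition : ℝ) ≤ c ^ n := by
  induction n using Nat.strong_induction_on with
  | _ n ih =>
    rcases lt_or_ge n 13 with hn | hn
    · refine le_of_pow_le_pow_left₀ (n := 4) (by norm_num) (by positivity) ?_
      rw [← pow_mul, mul_comm, pow_mul, hc4]
      exact_mod_cast card_pow_four_le_of_lt hn
    · have hx : c⁻¹ ≤ 669 / 1000 := by
        rw [inv_le_comm₀ hc (by norm_num)]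
        refine le_of_pow_le_pow_left₀ (n := 4) (by norm_num) hc.le ?_
        rw [hc4]
        norm_num
      have := card_le_of_sum_sigma_le (n := n) (A := 1) (x := c⁻¹) (y := c) (by omega)
        zero_le_one hc.le (inv_mul_cancel₀ hc.ne') (by simpa using ih)
        (le_trans (Finset.sum_le_sum fun m _ => ?_) (sum_sigma_mul_pow_le hn))
      · simpa using this
      · gcongr

theorem Nat.Partition.card_pos (n : ℕ) : 0 < Fintype.card n.Partition := Fintype.card_pos

theorem Nat.Partition.log_card_le (n : ℕ) :
    Real.log (Fintype.card n.Partition) ≤ n * (Real.log 5 / 4) := by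
  have h := card_le_pow (c := Real.exp (Real.log 5 / 4)) (Real.exp_pos _)
    (by rw [← Real.exp_nat_mul, Nat.cast_ofNat, mul_div_cancel₀ _ (by norm_num),
      Real.exp_log (by norm_num)]) n
  rw [← Real.exp_nat_mul] at h
  exact (Real.log_le_iff_le_exp (by exact_mod_cast card_pos n)).mpr h

theorem log_five_div_four_le_one : Real.log 5 / 4 ≤ 1 := by
  have := Real.log_le_sub_one_of_pos (x := 5) (by norm_num)
  linarith

open Finset in
theorem sum_sq_mul_exp_le {t : ℝ} (ht : 0 < t) (n : ℕ) :
    ∑ m ∈ Icc 1 n, (m : ℝ) ^ 2 * Real.exp (-t) ^ m ≤ 16 / t ^ 3 := by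
  set q := Real.exp (-t / 2) with hq
  have hq0 : 0 < q := Real.exp_pos _
  have hq1 : q * (1 + t / 2) ≤ 1 := by
    have h1 := Real.add_one_le_exp (t / 2)
    have h2 : q * Real.exp (t / 2) = 1 := by
      rw [hq, ← Real.exp_add]
      ring_nf
      exact Real.exp_zero
    nlinarith
  have hgeom : ∑ m ∈ Icc 1 n, q ^ m ≤ (1 - q ^ n) * (2 / t) := by
    induction n with
    | zero => simp
    | succ n ih =>
      rw [Finset.sum_Icc_succ_top (by omega)]
      have : q ^ n * q ≤ (q ^ n - q ^ n * q) * (2 / t) := by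
        rw [mul_div_assoc', le_div_iff₀ ht]
        have := mul_le_mul_of_nonneg_left hq1 (pow_nonneg hq0.le n)
        nlinarith
      rw [pow_succ]
      nlinarith
  have hterm : ∀ m : ℕ, (m : ℝ) ^ 2 * Real.exp (-t) ^ m ≤ 8 / t ^ 2 * q ^ m := by
    intro m
    have e : Real.exp (-t) = q * q := by
      rw [hq, ← Real.exp_add]
      ring_nf
    have h1 := Real.quadratic_le_exp_of_nonneg (x := m * (t / 2)) (by positivity)
    have h2 : q ^ m * Real.exp (m * (t / 2)) = 1 := by
      rw [hq, ← Real.exp_nat_mul, ← Real.exp_add]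
      ring_nf
      exact Real.exp_zero
    have h3 : (m : ℝ) ^ 2 * q ^ m ≤ 8 / t ^ 2 := by
      rw [le_div_iff₀ (by positivity)]
      have h4 : (m * (t / 2)) ^ 2 / 2 ≤ Real.exp (m * (t / 2)) := by
        have : 0 ≤ (m : ℝ) * (t / 2) := by positivity
        linarith
      have := mul_le_mul_of_nonneg_left h4 (pow_nonneg hq0.le m)
      nlinarith
    rw [e, mul_pow, ← mul_assoc]
    exact mul_le_mul_of_nonneg_right h3 (by positivity)
  calc ∑ m ∈ Icc 1 n, (m : ℝ) ^ 2 * Real.exp (-t) ^ m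
      ≤ 8 / t ^ 2 * ∑ m ∈ Icc 1 n, q ^ m := by
        rw [Finset.mul_sum]
        exact Finset.sum_le_sum fun m _ => hterm m
    _ ≤ 8 / t ^ 2 * (1 * (2 / t)) := by
        refine mul_le_mul_of_nonneg_left (hgeom.trans ?_) (by positivity)
        refine mul_le_mul_of_nonneg_right ?_ (by positivity)
        linarith [pow_pos hq0 n]
    _ = 16 / t ^ 3 := by
        field_simp
        norm_num

open Finset ArithmeticFunction in
/-- Partition numbers grow subexponentially. -/
theorem Nat.Partition.log_card_le_mul_add {t : ℝ} (ht : 0 < t) (n : ℕ) :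
    Real.log (Fintype.card n.Partition) ≤ t * n + 16 / t ^ 3 := by
  suffices h : (Fintype.card n.Partition : ℝ) ≤ Real.exp (16 / t ^ 3) * Real.exp t ^ n by
    rw [Real.log_le_iff_le_exp (by exact_mod_cast card_pos n), add_comm, Real.exp_add, mul_comm t,
      Real.exp_nat_mul]
    exact h
  induction n using Nat.strong_induction_on with
  | _ n ih =>
    rcases lt_or_ge (n : ℝ) (16 / t ^ 3) with hn | hn
    · have h1 : Real.log (Fintype.card n.Partition) ≤ 16 / t ^ 3 := by
        have := log_card_le n
        have h2 := mul_le_mul_of_nonneg_left log_five_div_four_le_one (Nat.cast_nonneg (α := ℝ) n)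
        linarith
      rw [Real.log_le_iff_le_exp (by exact_mod_cast card_pos n)] at h1
      exact h1.trans (le_mul_of_one_le_right (Real.exp_pos _).le
        (one_le_pow₀ (Real.one_le_exp ht.le)))
    · refine card_le_of_sum_sigma_le (x := Real.exp (-t)) ?_ (Real.exp_pos _).le (Real.exp_pos _).le
        (by rw [← Real.exp_add]; simp) ih ?_
      · rintro rfl
        have : 0 < 16 / t ^ 3 := by positivity
        simp only [CharP.cast_eq_zero] at hn
        linarith
      · refine (Finset.sum_le_sum fun m _ => ?_).trans ((sum_sq_mul_exp_le ht n).trans hn)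
        refine mul_le_mul_of_nonneg_right ?_ (by positivity)
        exact_mod_cast sigma_le_pow_succ 1 m

theorem Nat.Partition.five_le_card_four : 5 ≤ Fintype.card (Nat.Partition 4) := by
  let s : Finset (Nat.Partition 4) :=
    {⟨{4}, by decide, rfl⟩, ⟨{3, 1}, by decide, rfl⟩, ⟨{2, 2}, by decide, rfl⟩,
      ⟨{2, 1, 1}, by decide, rfl⟩, ⟨{1, 1, 1, 1}, by decide, rfl⟩}
  have hs : s.card = 5 := by decide
  exact hs ▸ s.card_le_univ

theorem log_abelianCount (n : ℕ) :
    Real.log (abelianCount n) =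
      ∑ p ∈ n.primeFactors, Real.log (Fintype.card (n.factorization p).Partition) := by
  rw [abelianCount, Finsupp.prod, Nat.cast_prod, Real.log_prod, Nat.support_factorization]
  intro p _
  exact_mod_cast (Nat.Partition.card_pos _).ne'

theorem log_eq_sum_primeFactors (n : ℕ) :
    Real.log n = ∑ p ∈ n.primeFactors, n.factorization p * Real.log p := by
  rw [Real.log_nat_eq_sum_factorization, Finsupp.sum, Nat.support_factorization]

open Finset in
theorem log_abelianCount_le {s : ℝ} (hs : 0 < s) {Y : ℕ}
    (hY : ∀ p : ℕ, Y < p → Real.log 5 / 4 ≤ s * Real.log p) (n : ℕ) :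
    Real.log (abelianCount n) ≤ s * Real.log n + Y * (128 / s ^ 3) := by
  have hp : ∀ p ∈ n.primeFactors, Real.log (Fintype.card (n.factorization p).Partition) ≤
      s * (n.factorization p * Real.log p) + if p ≤ Y then 128 / s ^ 3 else 0 := by
    intro p hp
    split_ifs with h
    · have h2 : 1 / 2 ≤ Real.log p := by
        have h2 : (2 : ℝ) ≤ p := by exact_mod_cast (Nat.prime_of_mem_primeFactors hp).two_le
        have h3 := Real.log_le_log (by norm_num) h2
        linarith [Real.log_two_gt_d9]
      have h1 := Nat.Partition.log_card_le_mul_add (half_pos hs) (n.factorization p)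
      have h3 : 16 / (s / 2) ^ 3 = 128 / s ^ 3 := by
        field_simp
        norm_num
      have h4 := mul_le_mul_of_nonneg_left h2
        (mul_nonneg hs.le (Nat.cast_nonneg (α := ℝ) (n.factorization p)))
      rw [h3] at h1
      linarith
    · have h1 := Nat.Partition.log_card_le (n.factorization p)
      have h2 := mul_le_mul_of_nonneg_left (hY p (not_le.mp h))
        (Nat.cast_nonneg (α := ℝ) (n.factorization p))
      linarith
  rw [log_abelianCount, log_eq_sum_primeFactors, Finset.mul_sum]
  refine (Finset.sum_le_sum hp).trans ?_
  rw [Finset.sum_add_distrib, ← Finset.sum_filter, Finset.sum_const, nsmul_eq_mul]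
  gcongr
  calc #{p ∈ n.primeFactors | p ≤ Y} ≤ #(Icc 1 Y) := by
        refine Finset.card_le_card fun p hp => ?_
        rw [Finset.mem_filter] at hp
        exact Finset.mem_Icc.mpr ⟨(Nat.prime_of_mem_primeFactors hp.1).one_le, hp.2⟩
    _ = Y := by simp

open Filter Topology in
theorem tendsto_log_pow_mul_rpow_neg {δ : ℝ} (hδ : 0 < δ) :
    Tendsto (fun x : ℝ => Real.log x ^ 4 * x ^ (-δ)) atTop (𝓝 0) := by
  have h := (isLittleO_log_rpow_rpow_atTop 4 hδ).tendsto_div_nhds_zero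
  refine h.congr' ?_
  filter_upwards [eventually_gt_atTop 0] with x hx
  rw [Real.rpow_neg hx.le, div_eq_mul_inv]
  norm_cast

open Filter Topology in
theorem eventually_log_abelianCount_le {b : ℝ} (hb : Real.log 5 / 4 < b) :
    ∀ᶠ n : ℕ in atTop,
      Real.log (abelianCount n) * Real.log (Real.log n) / Real.log n ≤ b := by
  have h5 : 0 < Real.log 5 / 4 := by
    have := Real.log_pos (x := 5) (by norm_num)
    positivity
  set β := Real.log 5 / 4 with hβ
  obtain ⟨B, hB1, hB2⟩ := exists_between hb
  have hB0 : 0 < B := h5.trans hB1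
  have hδ : 0 < 1 - β / B := by
    rw [sub_pos, div_lt_one hB0]
    exact hB1
  have hlim : Tendsto (fun x : ℝ => B + 128 / B ^ 3 * (Real.log x ^ 4 * x ^ (-(1 - β / B))))
      atTop (𝓝 B) := by
    simpa using ((tendsto_log_pow_mul_rpow_neg hδ).const_mul (128 / B ^ 3)).const_add B
  have hlog : Tendsto (fun n : ℕ => Real.log n) atTop atTop :=
    Real.tendsto_log_atTop.comp tendsto_natCast_atTop_atTop
  filter_upwards [hlog.eventually (hlim.eventually_le_const hB2),
    hlog.eventually (eventually_gt_atTop 1)] with n hn hL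
  refine le_trans ?_ hn
  set L := Real.log n with hLdef
  have hL0 : 0 < L := by linarith
  have hl : 0 < Real.log L := Real.log_pos hL
  have hY : ∀ p : ℕ, ⌊L ^ (β / B)⌋₊ < p → β ≤ B / Real.log L * Real.log p := by
    intro p hp
    have h1 : L ^ (β / B) ≤ p := ((Nat.floor_lt (by positivity)).mp hp).le
    have h2 := Real.log_le_log (by positivity) h1
    rw [Real.log_rpow hL0] at h2
    calc β = B / Real.log L * (β / B * Real.log L) := by field_simp
      _ ≤ _ := mul_le_mul_of_nonneg_left h2 (by positivity)
  have h := log_abelianCount_le (div_pos hB0 hl) hY n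
  rw [← hLdef] at h
  have hfl : (⌊L ^ (β / B)⌋₊ : ℝ) ≤ L ^ (β / B) := Nat.floor_le (by positivity)
  have h' : Real.log (abelianCount n) ≤
      B / Real.log L * L + L ^ (β / B) * (128 / (B / Real.log L) ^ 3) :=
    h.trans (by gcongr)
  have e : L ^ (-(1 - β / B)) = L ^ (β / B) / L := by
    rw [neg_sub, Real.rpow_sub hL0, Real.rpow_one]
  rw [e]
  calc Real.log (abelianCount n) * Real.log L / L
      ≤ (B / Real.log L * L + L ^ (β / B) * (128 / (B / Real.log L) ^ 3)) * Real.log L / L := by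
        gcongr
    _ = _ := by field_simp

theorem factorization_primorial_pow (N k : ℕ) {p : ℕ} (hp : p ∈ N.primesLE) :
    (primorial N ^ k).factorization p = k := by
  have hp' := Nat.mem_primesLE.mp hp
  have h : (primorial N).factorization p = 1 := by
    rw [primorial_eq_prod_primesLE, Nat.factorization_prod_apply fun q hq =>
      (Nat.mem_primesLE.mp hq).2.ne_zero, Finset.sum_eq_single p]
    · exact hp'.2.factorization_self
    · intro q hq hqp
      rw [(Nat.mem_primesLE.mp hq).2.factorization, Finsupp.single_apply, if_neg hqp]
    · exact fun h => (h hp).elim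
  rw [Nat.factorization_pow, Finsupp.smul_apply, h, smul_eq_mul, mul_one]

theorem primeCounting_mul_log_five_le (N : ℕ) :
    N.primeCounting * Real.log 5 ≤ Real.log (abelianCount (primorial N ^ 4)) := by
  rw [log_abelianCount]
  have hsub : N.primesLE ⊆ (primorial N ^ 4).primeFactors := by
    intro p hp
    rw [← Nat.support_factorization, Finsupp.mem_support_iff, factorization_primorial_pow N 4 hp]
    norm_num
  calc N.primeCounting * Real.log 5
      = ∑ p ∈ N.primesLE, Real.log 5 := by
        rw [Finset.sum_const, nsmul_eq_mul]
        simp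
    _ ≤ ∑ p ∈ N.primesLE,
          Real.log (Fintype.card ((primorial N ^ 4).factorization p).Partition) := by
        refine Finset.sum_le_sum fun p hp => ?_
        rw [factorization_primorial_pow N 4 hp]
        exact Real.log_le_log (by norm_num) (by exact_mod_cast Nat.Partition.five_le_card_four)
    _ ≤ _ := Finset.sum_le_sum_of_subset_of_nonneg hsub fun p _ _ => Real.log_natCast_nonneg _

open Filter in
theorem eventually_le_four_mul_theta :
    ∀ᶠ N : ℕ in atTop, (N : ℝ) ≤ 4 * Chebyshev.theta N := by
  have h1 := (isLittleO_log_rpow_atTop (r := 1 / 4) (by norm_num)).bound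
    (c := 1 / 100) (by norm_num)
  have h2 : Tendsto (fun x : ℝ => x ^ (1 / 4 : ℝ)) atTop atTop := tendsto_rpow_atTop (by norm_num)
  have h3 := tendsto_natCast_atTop_atTop (R := ℝ)
  filter_upwards [h3.eventually h1, h3.eventually (h2.eventually_ge_atTop 10),
    eventually_ge_atTop 1] with N hN hN' hN1
  have hN1' : (1 : ℝ) ≤ N := by exact_mod_cast hN1
  have hθ := Chebyshev.theta_ge N
  rw [Real.norm_of_nonneg (Real.log_nonneg hN1'), Real.norm_of_nonneg (by positivity)] at hN
  have e2 : √(N : ℝ) = ((N : ℝ) ^ (1 / 4 : ℝ)) ^ 2 := by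
    rw [Real.sqrt_eq_rpow, ← Real.rpow_mul_natCast (by positivity)]
    norm_num
  have e4 : (N : ℝ) = ((N : ℝ) ^ (1 / 4 : ℝ)) ^ 4 := by
    rw [← Real.rpow_mul_natCast (by positivity)]
    norm_num
  have hl : Real.log (N + 1) ≤ Real.log 2 + Real.log N := by
    rw [← Real.log_mul (by norm_num) (by positivity)]
    exact Real.log_le_log (by positivity) (by linarith)
  rw [e2] at hθ
  set u := (N : ℝ) ^ (1 / 4 : ℝ) with hu
  have h4 : u ^ 2 * Real.log N ≤ u ^ 2 * (1 / 100 * u) := by gcongr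
  have h5 : 100 * u ≤ u ^ 3 := by nlinarith
  have h6 : 10 * u ^ 3 ≤ N := by rw [e4]; nlinarith [pow_nonneg (by linarith : 0 ≤ u) 3]
  have h7 := mul_le_mul_of_nonneg_left Real.log_two_gt_d9.le (by positivity : (0 : ℝ) ≤ N)
  have h8 := Real.log_two_lt_d9
  nlinarith

open Filter in
theorem frequently_le_log_abelianCount :
    ∃ᶠ n : ℕ in atTop, Real.log 5 / 4 ≤
      Real.log (abelianCount n) * Real.log (Real.log n) / Real.log n := by
  have hlogn : ∀ N : ℕ, Real.log ((primorial N ^ 4 : ℕ) : ℝ) = 4 * Chebyshev.theta N := by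
    intro N
    rw [Chebyshev.theta_eq_log_primorial, Nat.floor_natCast, Nat.cast_pow, Real.log_pow]
    norm_num
  have hlim : Tendsto (fun N : ℕ => primorial N ^ 4) atTop atTop := by
    refine tendsto_atTop_mono' _ ?_ tendsto_id
    filter_upwards [eventually_le_four_mul_theta] with N hN
    rw [← hlogn] at hN
    have := hN.trans (Real.log_le_self (by positivity))
    exact_mod_cast this
  refine hlim.frequently (Eventually.frequently ?_)
  filter_upwards [eventually_le_four_mul_theta, eventually_ge_atTop 2] with N hN hN2
  have hN2' : (2 : ℝ) ≤ N := by exact_mod_cast hN2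
  have hlogN : 0 < Real.log N := Real.log_pos (by linarith)
  rw [hlogn]
  set T := Chebyshev.theta N
  have hT : 0 < T := by linarith
  have h1 := primeCounting_mul_log_five_le N
  have h2 : T ≤ N.primeCounting * Real.log N := Chebyshev.theta_le_pi_mul_log N
  have h3 : Real.log N ≤ Real.log (4 * T) := Real.log_le_log (by linarith) hN
  have h5 : 0 < Real.log 5 := Real.log_pos (by norm_num)
  rw [le_div_iff₀ (by positivity)]
  calc Real.log 5 / 4 * (4 * T) = Real.log 5 * T := by ring
    _ ≤ Real.log 5 * (N.primeCounting * Real.log N) := by gcongr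
    _ = N.primeCounting * Real.log 5 * Real.log N := by ring
    _ ≤ _ := mul_le_mul h1 h3 hlogN.le ((by positivity : (0 : ℝ) ≤ _).trans h1)

open Filter in
theorem limsup_log_abelianCount :
    Filter.limsup
        (fun n : ℕ =>
          Real.log (abelianCount n) * Real.log (Real.log n) / Real.log n)
        atTop = Real.log 5 / 4 := by
  refine le_antisymm (le_of_forall_gt_imp_ge_of_dense fun b hb => ?_) ?_
  · exact limsup_le_of_le (IsCoboundedUnder.of_frequently_ge frequently_le_log_abelianCount)
      (eventually_log_abelianCount_le hb)
  · exact le_limsup_of_frequently_le frequently_le_log_abelianCount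
      ⟨_, eventually_log_abelianCount_le (lt_add_one _)⟩
end

section
/- There is an absolute constant C > 0 such that for every positive integer r and every real T with 2 ≤ r ≤ T, one has (1/φ(r))·Σ_{χ mod r} ∫_1^T |L(1/2 + it, χ)| (dt/t) ≤ C·(log T)^{3/2}, where the sum runs over all Dirichlet characters χ modulo r, L(·,χ) is the Dirichlet L-function of χ, and φ is Euler's totient function. -/
open Complex Set Filter Topology MeasureTheory

lemma norm_one_add_cpow_neg_sub_le {s : ℂ} (hs : 0 ≤ s.re) {a b : ℝ} (ha : 0 ≤ a) (hb : 0 ≤ b) :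
    ‖(1 + a : ℂ) ^ (-s) - (1 + b : ℂ) ^ (-s)‖ ≤ ‖s‖ * |a - b| := by
  have hd : ∀ v ∈ Ici (0 : ℝ), HasDerivWithinAt (fun v : ℝ ↦ (1 + v : ℂ) ^ (-s))
      (-s * (1 + v : ℂ) ^ (-s - 1)) (Ici 0) v := by
    intro v hv
    have hv' : (0 : ℝ) < 1 + v := by have := mem_Ici.1 hv; linarith
    have h1 : HasDerivAt (fun z : ℂ ↦ (1 + z) ^ (-s)) (-s * (1 + (v : ℂ)) ^ (-s - 1) * 1) (v : ℂ) :=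
      ((hasDerivAt_id (v : ℂ)).const_add 1).cpow_const (by
        simp only [id]; exact_mod_cast ofReal_mem_slitPlane.2 hv')
    simpa using (h1.comp_ofReal).hasDerivWithinAt
  refine (Convex.norm_image_sub_le_of_norm_hasDerivWithin_le hd (C := ‖s‖) ?_ (convex_Ici 0)
    (mem_Ici.2 hb) (mem_Ici.2 ha))
  intro v hv
  have hv0 := mem_Ici.1 hv
  have hv' : (0 : ℝ) < 1 + v := by linarith
  rw [norm_mul, norm_neg]
  refine mul_le_of_le_one_right (norm_nonneg _) ?_
  have : ((1 : ℂ) + v) = ((1 + v : ℝ) : ℂ) := by push_cast; ring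
  rw [this, norm_cpow_eq_rpow_re_of_pos hv']
  apply Real.rpow_le_one_of_one_le_of_nonpos (by linarith)
  simp; linarith

/-- The average of `(1 + v) ^ (-s)` over `0 ≤ v ≤ u`. -/
noncomputable def cpowAverage (s : ℂ) (u : ℝ) : ℂ := ∫ w in (0 : ℝ)..1, (1 + (u * w : ℝ) : ℂ) ^ (-s)

lemma continuousOn_one_add_mul_cpow (s : ℂ) {u : ℝ} (hu : 0 ≤ u) :
    ContinuousOn (fun w : ℝ ↦ (1 + (u * w : ℝ) : ℂ) ^ (-s)) (Icc 0 1) := by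
  refine ContinuousOn.cpow_const (by fun_prop) ?_
  intro w hw
  have : 0 < 1 + u * w := by have := mul_nonneg hu hw.1; linarith
  exact_mod_cast ofReal_mem_slitPlane.2 this

lemma intervalIntegrable_one_add_mul_cpow (s : ℂ) {u : ℝ} (hu : 0 ≤ u) :
    IntervalIntegrable (fun w : ℝ ↦ (1 + (u * w : ℝ) : ℂ) ^ (-s)) volume 0 1 :=
  ContinuousOn.intervalIntegrable (by
    rw [uIcc_of_le zero_le_one]; exact continuousOn_one_add_mul_cpow s hu)

lemma norm_cpowAverage_sub_le {s : ℂ} (hs : 0 ≤ s.re) {a b : ℝ} (ha : 0 ≤ a) (hb : 0 ≤ b) :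
    ‖cpowAverage s a - cpowAverage s b‖ ≤ ‖s‖ * |a - b| := by
  unfold cpowAverage
  rw [← intervalIntegral.integral_sub (intervalIntegrable_one_add_mul_cpow s ha)
    (intervalIntegrable_one_add_mul_cpow s hb)]
  refine (intervalIntegral.norm_integral_le_of_norm_le_const (C := ‖s‖ * |a - b|) ?_).trans
    (by simp)
  intro w hw
  rw [uIoc_of_le zero_le_one] at hw
  refine (norm_one_add_cpow_neg_sub_le hs (mul_nonneg ha hw.1.le)
    (mul_nonneg hb hw.1.le)).trans ?_
  rw [← sub_mul, abs_mul, abs_of_pos hw.1]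
  gcongr
  exact mul_le_of_le_one_right (abs_nonneg _) hw.2

lemma cpowAverage_zero (s : ℂ) : cpowAverage s 0 = 1 := by
  simp [cpowAverage]

lemma one_half_le_norm_cpowAverage {s : ℂ} (hs : 0 ≤ s.re) {u : ℝ} (hu : 0 ≤ u)
    (h : 2 * (‖s‖ * u) ≤ 1) : 1 / 2 ≤ ‖cpowAverage s u‖ := by
  have h1 := norm_cpowAverage_sub_le hs hu le_rfl
  rw [cpowAverage_zero, sub_zero, abs_of_nonneg hu, ← norm_neg] at h1
  have h2 := norm_sub_norm_le (1 : ℂ) (1 - cpowAverage s u)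
  rw [neg_sub] at h1
  simp only [sub_sub_cancel, norm_one] at h2
  linarith

lemma mul_cpowAverage (s : ℂ) {u : ℝ} (hu : 0 < u) :
    (1 - s) * u * cpowAverage s u = (1 + u : ℂ) ^ (1 - s) - 1 := by
  have key : ∫ w in (0 : ℝ)..1, ((1 - s) * u) * (1 + (u * w : ℝ) : ℂ) ^ (-s) =
      (1 + (u * 1 : ℝ) : ℂ) ^ (1 - s) - (1 + (u * 0 : ℝ) : ℂ) ^ (1 - s) := by
    refine intervalIntegral.integral_eq_sub_of_hasDerivAt
      (f := fun w : ℝ ↦ (1 + (u * w : ℝ) : ℂ) ^ (1 - s)) ?_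
      ((intervalIntegrable_one_add_mul_cpow s hu.le).const_mul _)
    intro w hw
    rw [uIcc_of_le zero_le_one] at hw
    have hpos : 0 < 1 + u * w := by have := mul_nonneg hu.le hw.1; linarith
    have h0 : HasDerivAt (fun z : ℂ ↦ 1 + (u : ℂ) * z) (u : ℂ) (w : ℂ) := by
      simpa using ((hasDerivAt_id (w : ℂ)).const_mul (u : ℂ)).const_add 1
    have h1 := (h0.cpow_const (c := 1 - s) (by
      exact_mod_cast ofReal_mem_slitPlane.2 hpos)).comp_ofReal
    have h2 := h1.congr_deriv (show _ = (1 - s) * u * (1 + (u * w : ℂ)) ^ (-s) by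
      rw [show 1 - s - 1 = -s by ring]; ring)
    simpa only [ofReal_mul] using h2
  rw [intervalIntegral.integral_const_mul] at key
  unfold cpowAverage
  rw [key]; simp

/-- The summand correcting a truncation of `∑ y ^ (-s)`, so that `y ^ (-s)` is close to its
forward difference. -/
noncomputable def cpowPrimitive (s : ℂ) (y : ℝ) : ℂ :=
  (y : ℂ) ^ (-s) / ((1 + (y⁻¹ : ℝ) : ℂ) ^ (1 - s) - 1)

lemma cpowPrimitive_eq {s : ℂ} (hs : s ≠ 1) {y : ℝ} (hy : 0 < y) :
    cpowPrimitive s y = (y : ℂ) ^ (1 - s) / ((1 - s) * cpowAverage s y⁻¹) := by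
  have hy' : (y : ℂ) ≠ 0 := by exact_mod_cast hy.ne'
  have h1 : (y : ℂ) ^ (1 - s) = y * (y : ℂ) ^ (-s) := by
    rw [sub_eq_add_neg, cpow_add _ _ hy', cpow_one]
  rw [cpowPrimitive, ← mul_cpowAverage s (inv_pos.2 hy), h1]
  push_cast
  field_simp

lemma one_half_le_norm_cpowAverage_inv {s : ℂ} (hs : 0 ≤ s.re) {y : ℝ} (hy : 0 < y)
    (h : 2 * ‖s‖ ≤ y) : 1 / 2 ≤ ‖cpowAverage s y⁻¹‖ := by
  refine one_half_le_norm_cpowAverage hs (inv_nonneg.2 hy.le) ?_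
  rw [← mul_assoc, ← div_eq_mul_inv]
  exact (div_le_one hy).2 h

lemma norm_cpowPrimitive_le {s : ℂ} (hs : 0 ≤ s.re) {y : ℝ} (hy : 0 < y)
    (h : 2 * ‖s‖ ≤ y) (hs1 : s ≠ 1) :
    ‖cpowPrimitive s y‖ ≤ 2 * y ^ (1 - s.re) / ‖1 - s‖ := by
  have hJ := one_half_le_norm_cpowAverage_inv hs hy h
  have h1 : 0 < ‖1 - s‖ := norm_pos_iff.2 (sub_ne_zero.2 hs1.symm)
  rw [cpowPrimitive_eq hs1 hy, norm_div, norm_mul, norm_cpow_eq_rpow_re_of_pos hy]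
  simp only [sub_re, one_re]
  have h2 : 0 ≤ y ^ (1 - s.re) := by positivity
  rw [div_le_div_iff₀ (by positivity) h1]
  have := mul_le_mul_of_nonneg_left hJ (mul_nonneg h2 h1.le)
  nlinarith

lemma norm_cpow_neg_sub_cpowPrimitive_sub_le {s : ℂ} (hs : 0 ≤ s.re) {y : ℝ} (hy : 0 < y)
    (h : 2 * ‖s‖ ≤ y) (hs1 : s ≠ 1) :
    ‖(y : ℂ) ^ (-s) - (cpowPrimitive s (y + 1) - cpowPrimitive s y)‖ ≤
      4 * ‖s‖ / ‖1 - s‖ * ((y + 1) ^ (1 - s.re) / y ^ 2) := by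
  have hJ := one_half_le_norm_cpowAverage_inv hs hy h
  have hJ' := one_half_le_norm_cpowAverage_inv hs (y := y + 1) (by linarith) (by linarith)
  have h1 : 0 < ‖1 - s‖ := norm_pos_iff.2 (sub_ne_zero.2 hs1.symm)
  have hy' : (y : ℂ) ≠ 0 := by exact_mod_cast hy.ne'
  have hy1 : 0 < y + 1 := by linarith
  have hJ0 : cpowAverage s y⁻¹ ≠ 0 := norm_pos_iff.1 (by linarith)
  have hJ0' : cpowAverage s (y + 1)⁻¹ ≠ 0 := norm_pos_iff.1 (by linarith)
  have hs1' : 1 - s ≠ 0 := sub_ne_zero.2 hs1.symm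
  have e1 : (y : ℂ) ^ (1 - s) = y * (y : ℂ) ^ (-s) := by
    rw [sub_eq_add_neg, cpow_add _ _ hy', cpow_one]
  have e2 : ((y + 1 : ℝ) : ℂ) ^ (1 - s) =
      (y : ℂ) ^ (1 - s) * (1 + (1 - s) * (y⁻¹ : ℝ) * cpowAverage s y⁻¹) := by
    rw [mul_cpowAverage s (inv_pos.2 hy)]
    have : ((y + 1 : ℝ) : ℂ) = (y : ℂ) * ((1 + y⁻¹ : ℝ) : ℂ) := by
      rw [← ofReal_mul]; congr 1; field_simp
    rw [this, mul_cpow_ofReal_nonneg hy.le (by positivity)]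
    push_cast; ring
  have e3 : (y : ℂ) ^ (-s) - (cpowPrimitive s (y + 1) - cpowPrimitive s y) =
      ((y + 1 : ℝ) : ℂ) ^ (1 - s) * (cpowAverage s (y + 1)⁻¹ - cpowAverage s y⁻¹) /
        ((1 - s) * cpowAverage s y⁻¹ * cpowAverage s (y + 1)⁻¹) := by
    have e4 : (y : ℂ) ^ (-s) = (((y + 1 : ℝ) : ℂ) ^ (1 - s) - (y : ℂ) ^ (1 - s)) /
        ((1 - s) * cpowAverage s y⁻¹) := by
      rw [e2, e1, ofReal_inv]
      generalize cpowAverage s y⁻¹ = J at hJ0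
      field_simp; ring
    rw [cpowPrimitive_eq hs1 hy, cpowPrimitive_eq hs1 hy1, e4]
    generalize cpowAverage s y⁻¹ = J at hJ0
    generalize cpowAverage s (y + 1)⁻¹ = J' at hJ0'
    field_simp; ring
  rw [e3, norm_div, norm_mul, norm_mul, norm_mul, norm_cpow_eq_rpow_re_of_pos hy1]
  simp only [sub_re, one_re]
  have h2 : 0 ≤ (y + 1) ^ (1 - s.re) := by positivity
  have h3 : ‖cpowAverage s (y + 1)⁻¹ - cpowAverage s y⁻¹‖ ≤ ‖s‖ * (1 / y ^ 2) := by
    refine (norm_cpowAverage_sub_le hs (by positivity) (by positivity)).trans ?_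
    gcongr
    rw [abs_sub_comm, abs_of_nonneg (sub_nonneg.2 (by gcongr; linarith))]
    rw [inv_sub_inv hy.ne' hy1.ne', add_sub_cancel_left]
    gcongr; nlinarith
  have h4 : ‖1 - s‖ * (1 / 4) ≤ ‖1 - s‖ * ‖cpowAverage s y⁻¹‖ * ‖cpowAverage s (y + 1)⁻¹‖ := by
    rw [mul_assoc]; gcongr; nlinarith
  calc _ ≤ (y + 1) ^ (1 - s.re) * (‖s‖ * (1 / y ^ 2)) / (‖1 - s‖ * (1 / 4)) := by gcongr
    _ = _ := by field_simp

/-- The open region on which the truncated Hurwitz series is continued. -/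
def truncationRegion (R : ℝ) : Set ℂ := {s | 1 / 4 < s.re ∧ 1 / 2 < s.im ∧ 2 * ‖s‖ < R}

lemma isOpen_truncationRegion (R : ℝ) : IsOpen (truncationRegion R) :=
  (isOpen_lt continuous_const continuous_re).inter
    ((isOpen_lt continuous_const continuous_im).inter
      (isOpen_lt (continuous_const.mul continuous_norm) continuous_const))

lemma convex_truncationRegion (R : ℝ) : Convex ℝ (truncationRegion R) := by
  refine (convex_halfSpace_re_gt _).inter ((convex_halfSpace_im_gt _).inter ?_)
  have : {s : ℂ | 2 * ‖s‖ < R} = Metric.ball 0 (R / 2) := by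
    ext s; simp only [mem_ofPred_eq, Metric.mem_ball, dist_zero_right]
    constructor <;> intro h <;> linarith
  change Convex ℝ {s : ℂ | 2 * ‖s‖ < R}
  rw [this]; exact convex_ball _ _

lemma norm_le_three_mul_norm_one_sub {s : ℂ} (hs : 1 / 2 < s.im) : ‖s‖ ≤ 3 * ‖1 - s‖ := by
  have h1 : 1 / 2 ≤ ‖1 - s‖ := by
    refine le_trans ?_ (abs_im_le_norm _)
    simp only [sub_im, one_im, zero_sub, abs_neg]; exact hs.le.trans (le_abs_self _)
  have h2 : ‖s‖ ≤ ‖(1 : ℂ)‖ + ‖1 - s‖ := by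
    have := norm_sub_le (1 : ℂ) (1 - s); rwa [sub_sub_cancel] at this
  rw [norm_one] at h2
  linarith

lemma ne_one_of_one_half_lt_im {s : ℂ} (hs : 1 / 2 < s.im) : s ≠ 1 := by
  rintro rfl; norm_num at hs

lemma norm_cpow_neg_sub_cpowPrimitive_sub_le_rpow {R y : ℝ} (hy : 1 ≤ y) (hR : R ≤ y) {s : ℂ}
    (hs : s ∈ truncationRegion R) :
    ‖(y : ℂ) ^ (-s) - (cpowPrimitive s (y + 1) - cpowPrimitive s y)‖ ≤
      24 * y ^ (-(5 / 4) : ℝ) := by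
  obtain ⟨h1, h2, h3⟩ := hs
  have hs1 := ne_one_of_one_half_lt_im h2
  have hpos : 0 < ‖1 - s‖ := norm_pos_iff.2 (sub_ne_zero.2 hs1.symm)
  refine (norm_cpow_neg_sub_cpowPrimitive_sub_le (by linarith) (by linarith) (by linarith)
    hs1).trans ?_
  have h4 : 4 * ‖s‖ / ‖1 - s‖ ≤ 12 := by
    rw [div_le_iff₀ hpos]; linarith [norm_le_three_mul_norm_one_sub h2]
  have h5 : (y + 1) ^ (1 - s.re) ≤ 2 * y ^ (3 / 4 : ℝ) := by
    calc (y + 1) ^ (1 - s.re) ≤ (y + 1) ^ (3 / 4 : ℝ) :=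
          Real.rpow_le_rpow_of_exponent_le (by linarith) (by linarith)
      _ ≤ (2 * y) ^ (3 / 4 : ℝ) := by gcongr; linarith
      _ = 2 ^ (3 / 4 : ℝ) * y ^ (3 / 4 : ℝ) := Real.mul_rpow (by norm_num) (by linarith)
      _ ≤ 2 ^ (1 : ℝ) * y ^ (3 / 4 : ℝ) := by
          gcongr
          · norm_num
          · norm_num
      _ = _ := by rw [Real.rpow_one]
  calc _ ≤ 12 * (2 * y ^ (3 / 4 : ℝ) / y ^ 2) := by gcongr
    _ = 24 * (y ^ (3 / 4 : ℝ) / y ^ (2 : ℝ)) := by rw [Real.rpow_two]; ring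
    _ = _ := by rw [← Real.rpow_sub (by linarith)]; norm_num

lemma differentiableOn_cpowPrimitive {R y : ℝ} (hy : 0 < y) (hR : R ≤ y) :
    DifferentiableOn ℂ (fun s ↦ cpowPrimitive s y) (truncationRegion R) := by
  rintro s ⟨h1, h2, h3⟩
  have hs1 := ne_one_of_one_half_lt_im h2
  have hy' : (y : ℂ) ≠ 0 := by exact_mod_cast hy.ne'
  have hy2 : (1 + (y⁻¹ : ℝ) : ℂ) ≠ 0 := by
    have : (0 : ℝ) < 1 + y⁻¹ := by positivity
    exact_mod_cast this.ne'
  have hden : (1 + (y⁻¹ : ℝ) : ℂ) ^ (1 - s) - 1 ≠ 0 := by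
    rw [← mul_cpowAverage s (inv_pos.2 hy)]
    have hJ := one_half_le_norm_cpowAverage_inv (s := s) (by linarith) hy (by linarith)
    refine mul_ne_zero (mul_ne_zero (sub_ne_zero.2 hs1.symm) ?_) (norm_pos_iff.1 (by linarith))
    exact_mod_cast (inv_pos.2 hy).ne'
  unfold cpowPrimitive
  refine DifferentiableAt.differentiableWithinAt (DifferentiableAt.div ?_ ?_ hden)
  · exact (differentiableAt_id.neg).const_cpow (.inl hy')
  · exact ((differentiableAt_id.const_sub 1).const_cpow (.inl hy2)).sub_const 1

lemma summable_rpow_neg_five_fourths :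
    Summable fun k : ℕ ↦ 24 * ((k : ℝ) + 1) ^ (-(5 / 4) : ℝ) := by
  have h := (Real.summable_nat_rpow (p := -(5 / 4))).2 (by norm_num)
  have := (summable_nat_add_iff 1).2 h
  push_cast at this
  exact this.mul_left 24

lemma norm_cpow_neg_sub_cpowPrimitive_sub_le_nat {R y : ℝ} (hy : 1 ≤ y) (hR : R ≤ y) {s : ℂ}
    (hs : s ∈ truncationRegion R) (k : ℕ) :
    ‖((y + k : ℝ) : ℂ) ^ (-s) - (cpowPrimitive s (y + k + 1) - cpowPrimitive s (y + k))‖ ≤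
      24 * ((k : ℝ) + 1) ^ (-(5 / 4) : ℝ) := by
  have hk : (0 : ℝ) ≤ k := k.cast_nonneg
  refine (norm_cpow_neg_sub_cpowPrimitive_sub_le_rpow (y := y + k) (by linarith) (by linarith)
    hs).trans ?_
  gcongr 24 * ?_
  exact Real.rpow_le_rpow_of_nonpos (by positivity) (by linarith) (by norm_num)

lemma tendsto_cpowPrimitive_atTop {R y : ℝ} (hy : 1 ≤ y) (hR : R ≤ y) {s : ℂ}
    (hs : s ∈ truncationRegion R) (h1 : 1 < s.re) :
    Tendsto (fun k : ℕ ↦ cpowPrimitive s (y + k)) atTop (𝓝 0) := by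
  have hs1 := ne_one_of_one_half_lt_im hs.2.1
  refine squeeze_zero_norm (a := fun k : ℕ ↦ 2 * (y + k) ^ (1 - s.re) / ‖1 - s‖) (fun k ↦ ?_) ?_
  · have hk : (0 : ℝ) ≤ k := k.cast_nonneg
    exact norm_cpowPrimitive_le (by linarith) (by linarith) (by linarith [hs.2.2]) hs1
  · have ht : Tendsto (fun k : ℕ ↦ y + (k : ℝ)) atTop atTop :=
      tendsto_atTop_add_const_left _ _ tendsto_natCast_atTop_atTop
    have := ((tendsto_rpow_neg_atTop (y := s.re - 1) (by linarith)).comp ht)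
    simp only [neg_sub] at this
    simpa using (this.const_mul 2).div_const ‖1 - s‖

lemma hurwitzZeta_eq_truncation_of_one_lt_re {x : ℝ} (hx : x ∈ Ioc (0 : ℝ) 1) {N : ℕ} (hN : 1 ≤ N)
    {s : ℂ} (hs : s ∈ truncationRegion N) (h1 : 1 < s.re) :
    HurwitzZeta.hurwitzZeta x s = ∑ n ∈ Finset.range N, ((n + x : ℝ) : ℂ) ^ (-s)
      - cpowPrimitive s (N + x)
      + ∑' k : ℕ, (((N + x + k : ℝ) : ℂ) ^ (-s)
        - (cpowPrimitive s (N + x + k + 1) - cpowPrimitive s (N + x + k))) := by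
  have hN' : (1 : ℝ) ≤ N := by exact_mod_cast hN
  have hsum := HurwitzZeta.hasSum_hurwitzZeta_of_one_lt_re (Ioc_subset_Icc_self hx) h1
  have hf : (fun n : ℕ ↦ 1 / ((n : ℂ) + x) ^ s) = fun n : ℕ ↦ ((n + x : ℝ) : ℂ) ^ (-s) := by
    ext n; rw [cpow_neg, one_div]; push_cast; rfl
  rw [hf] at hsum
  rw [← hsum.tsum_eq, ← hsum.summable.sum_add_tsum_nat_add N]
  have hshift : (fun k : ℕ ↦ (((k + N : ℕ) + x : ℝ) : ℂ) ^ (-s)) =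
      fun k : ℕ ↦ ((N + x + k : ℝ) : ℂ) ^ (-s) := by
    ext k; congr 2; push_cast; ring
  have hs1 := (summable_nat_add_iff N).2 hsum.summable
  rw [hshift] at hs1 ⊢
  have hD : Summable fun k : ℕ ↦ (((N + x + k : ℝ) : ℂ) ^ (-s)
        - (cpowPrimitive s (N + x + k + 1) - cpowPrimitive s (N + x + k))) :=
    Summable.of_norm_bounded summable_rpow_neg_five_fourths fun k ↦
      norm_cpow_neg_sub_cpowPrimitive_sub_le_nat (y := N + x) (by linarith [hx.1])
        (by linarith [hx.1]) hs k
  have hE := hs1.sub hD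
  simp only [sub_sub_cancel] at hE
  have htel : ∑' k : ℕ, (cpowPrimitive s (N + x + k + 1) - cpowPrimitive s (N + x + k)) =
      - cpowPrimitive s (N + x) := by
    refine tendsto_nhds_unique hE.hasSum.tendsto_sum_nat ?_
    have h2 : ∀ K : ℕ, ∑ k ∈ Finset.range K,
        (cpowPrimitive s (N + x + k + 1) - cpowPrimitive s (N + x + k)) =
        cpowPrimitive s (N + x + K) - cpowPrimitive s (N + x) := by
      intro K
      have := Finset.sum_range_sub (fun k : ℕ ↦ cpowPrimitive s (N + x + k)) K
      simpa [add_assoc] using this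
    simp only [h2]
    simpa using (tendsto_cpowPrimitive_atTop (y := N + x) (by linarith [hx.1])
      (by linarith [hx.1]) hs h1).sub_const (cpowPrimitive s (N + x))
  rw [hs1.tsum_sub hE, htel]
  ring

lemma hurwitzZeta_eq_truncation {x : ℝ} (hx : x ∈ Ioc (0 : ℝ) 1) {N : ℕ} (hN : 4 ≤ N)
    {s : ℂ} (hs : s ∈ truncationRegion N) :
    HurwitzZeta.hurwitzZeta x s = ∑ n ∈ Finset.range N, ((n + x : ℝ) : ℂ) ^ (-s)
      - cpowPrimitive s (N + x)
      + ∑' k : ℕ, (((N + x + k : ℝ) : ℂ) ^ (-s)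
        - (cpowPrimitive s (N + x + k + 1) - cpowPrimitive s (N + x + k))) := by
  have hN' : (4 : ℝ) ≤ N := by exact_mod_cast hN
  have hNx : (N : ℝ) ≤ N + x := by linarith [hx.1]
  have hopen := isOpen_truncationRegion N
  have hpow : ∀ y : ℝ, 0 < y →
      DifferentiableOn ℂ (fun s : ℂ ↦ (y : ℂ) ^ (-s)) (truncationRegion N) := by
    intro y hy s _
    exact ((differentiableAt_id.neg).const_cpow
      (.inl (by exact_mod_cast hy.ne'))).differentiableWithinAt
  let p : ℂ := ⟨3 / 2, 1⟩
  have hp : p ∈ truncationRegion N := by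
    refine ⟨by norm_num [p], by norm_num [p], ?_⟩
    have : ‖p‖ < 2 := by
      rw [← abs_of_nonneg (norm_nonneg p), ← abs_of_pos (two_pos : (0 : ℝ) < 2), ← sq_lt_sq,
        ← normSq_eq_norm_sq, normSq_apply]
      norm_num [p]
    linarith
  refine AnalyticOnNhd.eqOn_of_preconnected_of_eventuallyEq (𝕜 := ℂ)
    (f := HurwitzZeta.hurwitzZeta x)
    (g := fun s ↦ ∑ n ∈ Finset.range N, ((n + x : ℝ) : ℂ) ^ (-s)
      - cpowPrimitive s (N + x)
      + ∑' k : ℕ, (((N + x + k : ℝ) : ℂ) ^ (-s)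
        - (cpowPrimitive s (N + x + k + 1) - cpowPrimitive s (N + x + k))))
    ?_ ?_ (convex_truncationRegion N).isPreconnected hp ?_ hs
  · refine DifferentiableOn.analyticOnNhd (fun s hs ↦ ?_) hopen
    exact (HurwitzZeta.differentiableAt_hurwitzZeta _
      (ne_one_of_one_half_lt_im hs.2.1)).differentiableWithinAt
  · refine DifferentiableOn.analyticOnNhd ?_ hopen
    refine DifferentiableOn.add (DifferentiableOn.sub (DifferentiableOn.fun_sum fun n _ ↦ ?_) ?_) ?_
    · exact hpow _ (by have := hx.1; positivity)
    · exact differentiableOn_cpowPrimitive (by linarith) hNx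
    · refine differentiableOn_tsum_of_summable_norm summable_rpow_neg_five_fourths (fun k ↦ ?_)
        hopen fun k s hs ↦ norm_cpow_neg_sub_cpowPrimitive_sub_le_nat (by linarith) hNx hs k
      have hk : (0 : ℝ) ≤ k := k.cast_nonneg
      exact (hpow _ (by linarith)).sub
        ((differentiableOn_cpowPrimitive (by linarith) (by linarith)).sub
          (differentiableOn_cpowPrimitive (by linarith) (by linarith)))
  · have hmem : truncationRegion N ∩ {s | 1 < s.re} ∈ 𝓝 p :=
      (hopen.inter (isOpen_lt continuous_const continuous_re)).mem_nhds ⟨hp, by norm_num [p]⟩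
    filter_upwards [hmem] with z hz
    exact hurwitzZeta_eq_truncation_of_one_lt_re hx (by omega) hz.1 hz.2

lemma exists_norm_hurwitzZeta_sub_sum_le : ∃ C : ℝ, 0 ≤ C ∧ ∀ x ∈ Ioc (0 : ℝ) 1, ∀ t : ℝ, 1 ≤ t →
    ∀ N : ℕ, 5 * t ≤ N → N ≤ 10 * t →
      ‖HurwitzZeta.hurwitzZeta x (1 / 2 + t * I)
        - ∑ n ∈ Finset.range N, ((n + x : ℝ) : ℂ) ^ (-(1 / 2 + t * I))‖ ≤ C := by
  have hnn : 0 ≤ ∑' k : ℕ, 24 * ((k : ℝ) + 1) ^ (-(5 / 4) : ℝ) :=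
    tsum_nonneg fun k ↦ by positivity
  refine ⟨22 + ∑' k : ℕ, 24 * ((k : ℝ) + 1) ^ (-(5 / 4) : ℝ), by linarith, ?_⟩
  intro x hx t ht N h5 h10
  have hre : (1 / 2 + t * I : ℂ).re = 1 / 2 := by simp
  have him : (1 / 2 + t * I : ℂ).im = t := by simp
  have hnorm : ‖(1 / 2 + t * I : ℂ)‖ ≤ 1 / 2 + t := by
    refine (norm_add_le _ _).trans ?_
    simp [abs_of_pos (by linarith : 0 < t)]
  set s : ℂ := 1 / 2 + t * I with hsdef
  have hs : s ∈ truncationRegion N := ⟨by rw [hre]; norm_num, by rw [him]; linarith, by linarith⟩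
  have hN4 : 4 ≤ N := by
    have : (4 : ℝ) ≤ N := by linarith
    exact_mod_cast this
  have hNx : (N : ℝ) ≤ N + x := by linarith [hx.1]
  rw [hurwitzZeta_eq_truncation hx hN4 hs]
  have hs1 := ne_one_of_one_half_lt_im hs.2.1
  have hH : ‖cpowPrimitive s (N + x)‖ ≤ 22 := by
    refine (norm_cpowPrimitive_le (by rw [hre]; norm_num) (by linarith) (by linarith)
      hs1).trans ?_
    have h1 : t ≤ ‖1 - s‖ := by
      refine le_trans ?_ (abs_im_le_norm _)
      simp only [sub_im, one_im, zero_sub, abs_neg, him]; exact le_abs_self _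
    rw [div_le_iff₀ (by linarith), hre]
    have h2 : ((N : ℝ) + x) ^ (1 - 1 / 2 : ℝ) ≤ (N + x) ^ (1 : ℝ) :=
      Real.rpow_le_rpow_of_exponent_le (by linarith) (by norm_num)
    rw [Real.rpow_one] at h2
    linarith [hx.2]
  have hT : ‖∑' k : ℕ, (((N + x + k : ℝ) : ℂ) ^ (-s)
        - (cpowPrimitive s (N + x + k + 1) - cpowPrimitive s (N + x + k)))‖ ≤
      ∑' k : ℕ, 24 * ((k : ℝ) + 1) ^ (-(5 / 4) : ℝ) :=
    tsum_of_norm_bounded summable_rpow_neg_five_fourths.hasSum fun k ↦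
      norm_cpow_neg_sub_cpowPrimitive_sub_le_nat (by linarith) hNx hs k
  calc _ = ‖-cpowPrimitive s (N + x) + ∑' k : ℕ, (((N + x + k : ℝ) : ℂ) ^ (-s)
        - (cpowPrimitive s (N + x + k + 1) - cpowPrimitive s (N + x + k)))‖ := by
        congr 1; ring
    _ ≤ _ := (norm_add_le _ _).trans (by rw [norm_neg]; exact add_le_add hH hT)

lemma inv_sqrt_mul_inv_sqrt_mul_two_div_log_sub_le {a b : ℝ} (ha : 0 < a) (hab : a < b) :
    (√a)⁻¹ * (√b)⁻¹ * (2 / (Real.log b - Real.log a)) ≤ 2 / (b - a) + 1 / a := by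
  have hb : 0 < b := ha.trans hab
  have hlog : (b - a) / b ≤ Real.log b - Real.log a := by
    have := Real.one_sub_inv_le_log_of_pos (div_pos hb ha)
    rw [Real.log_div hb.ne' ha.ne'] at this
    rwa [sub_div, div_self hb.ne', ← inv_div b a]
  have hba : 0 < b - a := sub_pos.2 hab
  calc _ ≤ (√a)⁻¹ * (√b)⁻¹ * (2 / ((b - a) / b)) := by gcongr
    _ = 2 * √b / (√a * (b - a)) := by
        have := Real.mul_self_sqrt hb.le
        have h1 := Real.sqrt_pos.2 hb
        have h2 := Real.sqrt_pos.2 ha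
        field_simp
        linarith
    _ ≤ _ := by
        have h1 := Real.sqrt_pos.2 hb
        have h2 := Real.sqrt_pos.2 ha
        have e1 := Real.mul_self_sqrt hb.le
        have e2 := Real.mul_self_sqrt ha.le
        rw [div_add_div _ _ hba.ne' ha.ne', div_le_div_iff₀ (by positivity) (by positivity)]
        have h3 : 2 * √b * √a ≤ a + b := by nlinarith [sq_nonneg (√a - √b)]
        have h4 : 0 ≤ √a * (b - a) := by positivity
        calc 2 * √b * ((b - a) * a) = (√a * (b - a)) * (2 * √b * √a) := by
              linear_combination (-2 * √b * (b - a)) * e2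
          _ ≤ (√a * (b - a)) * (a + b) := by gcongr
          _ = _ := by ring

lemma intervalIntegral_cos_mul_le {w : ℝ} (hw : w ≠ 0) (a b : ℝ) :
    ∫ t in a..b, Real.cos (t * w) ≤ 2 / |w| := by
  rw [intervalIntegral.integral_comp_mul_right _ hw, integral_cos, smul_eq_mul]
  refine (le_abs_self _).trans ?_
  rw [abs_mul, abs_inv, div_eq_inv_mul]
  gcongr
  exact (abs_sub _ _).trans (by linarith [Real.abs_sin_le_one (b * w), Real.abs_sin_le_one (a * w)])

lemma norm_sum_cpow_sq_eq {ι : Type*} (S : Finset ι) (y : ι → ℝ) (hy : ∀ i ∈ S, 0 < y i) (t : ℝ) :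
    ‖∑ i ∈ S, (y i : ℂ) ^ (-(1 / 2 + t * I))‖ ^ 2 =
      ∑ i ∈ S, ∑ j ∈ S, (√(y i))⁻¹ * (√(y j))⁻¹ *
        Real.cos (t * (Real.log (y j) - Real.log (y i))) := by
  have hterm : ∀ i ∈ S, (y i : ℂ) ^ (-(1 / 2 + t * I)) =
      ⟨(√(y i))⁻¹ * Real.cos (t * Real.log (y i)), -((√(y i))⁻¹ * Real.sin (t * Real.log (y i)))⟩ := by
    intro i hi
    have h0 := hy i hi
    have h1 : (y i : ℂ) ≠ 0 := by exact_mod_cast h0.ne'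
    have h2 : (√(y i))⁻¹ = Real.exp (-(1 / 2) * Real.log (y i)) := by
      rw [Real.sqrt_eq_rpow, ← Real.rpow_neg h0.le, Real.rpow_def_of_pos h0, mul_comm]
    rw [cpow_def_of_ne_zero h1, ← ofReal_log h0.le, h2]
    apply Complex.ext
    · rw [exp_re]
      simp [mul_comm]
    · rw [exp_im]
      simp [mul_comm]
  rw [Finset.sum_congr rfl hterm, ← normSq_eq_norm_sq, normSq_apply, re_sum, im_sum]
  simp only [Finset.sum_neg_distrib, neg_mul_neg]
  rw [Finset.sum_mul_sum, Finset.sum_mul_sum, ← Finset.sum_add_distrib]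
  refine Finset.sum_congr rfl fun i _ ↦ ?_
  rw [← Finset.sum_add_distrib]
  refine Finset.sum_congr rfl fun j _ ↦ ?_
  rw [mul_sub, Real.cos_sub]
  ring

lemma sum_range_inv_succ_le_one_add_log (n : ℕ) :
    ∑ i ∈ Finset.range n, ((i : ℝ) + 1)⁻¹ ≤ 1 + Real.log n := by
  have := harmonic_le_one_add_log n
  simpa [harmonic] using this

lemma sum_range_inv_abs_sub_le {M n : ℕ} (hn : n < M) :
    ∑ m ∈ Finset.range M, |(m : ℝ) - n|⁻¹ ≤ 2 * ∑ i ∈ Finset.range M, ((i : ℝ) + 1)⁻¹ := by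
  have hmono : ∀ K ≤ M, ∑ i ∈ Finset.range K, ((i : ℝ) + 1)⁻¹ ≤
      ∑ i ∈ Finset.range M, ((i : ℝ) + 1)⁻¹ := fun K hK ↦
    Finset.sum_le_sum_of_subset_of_nonneg (Finset.range_mono hK) fun i _ _ ↦ by positivity
  obtain ⟨k, rfl⟩ : ∃ k, M = n + (k + 1) := ⟨M - n - 1, by omega⟩
  rw [Finset.sum_range_add, two_mul]
  refine add_le_add ?_ ?_
  · rw [← Finset.sum_range_reflect]
    refine le_trans (le_of_eq (Finset.sum_congr rfl fun j hj ↦ ?_)) (hmono n (by omega))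
    have hj' := Finset.mem_range.1 hj
    have : ((n - 1 - j : ℕ) : ℝ) = (n : ℝ) - 1 - j := by
      rw [Nat.cast_sub (by omega), Nat.cast_sub (by omega)]; simp
    rw [this, abs_sub_comm, abs_of_nonneg] <;> [ring_nf; skip]
    have := j.cast_nonneg (α := ℝ)
    linarith
  · rw [Finset.sum_range_succ']
    refine le_trans (le_of_eq ?_) (hmono k (by omega))
    simp only [Nat.cast_add, Nat.cast_one, add_sub_cancel_left, add_zero, sub_self,
      abs_zero, inv_zero]
    refine Finset.sum_congr rfl fun j _ ↦ ?_
    rw [abs_of_nonneg (by positivity)]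

lemma integral_norm_sum_cpow_sq_le {x : ℝ} (hx : 0 ≤ x) (M : ℕ) {a b : ℝ} (hab : a ≤ b) :
    ∫ t in a..b, ‖∑ n ∈ Finset.range M, ((n + 1 + x : ℝ) : ℂ) ^ (-(1 / 2 + t * I))‖ ^ 2 ≤
      (b - a + 6 * M) * (1 + Real.log M) := by
  have hy : ∀ n : ℕ, (0 : ℝ) < n + 1 + x := fun n ↦ by positivity
  have hinv : ∀ n : ℕ, ((n : ℝ) + 1 + x)⁻¹ ≤ ((n : ℝ) + 1)⁻¹ := fun n ↦
    inv_anti₀ (by positivity) (by linarith)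
  have hcont : ∀ w : ℝ, Continuous fun t : ℝ ↦ Real.cos (t * w) := fun w ↦ by fun_prop
  simp_rw [norm_sum_cpow_sq_eq (Finset.range M) (fun n : ℕ ↦ (n + 1 + x : ℝ)) (fun n _ ↦ hy n)]
  rw [intervalIntegral.integral_finsetSum fun i _ ↦ Continuous.intervalIntegrable (by fun_prop) _ _]
  simp_rw [intervalIntegral.integral_finsetSum fun i _ ↦
    Continuous.intervalIntegrable (((hcont _).const_mul _)) _ _,
    intervalIntegral.integral_const_mul]
  have hlt : ∀ m n : ℕ, m < n → ∀ w : ℝ, |w| = Real.log (n + 1 + x) - Real.log (m + 1 + x) →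
      (√(m + 1 + x))⁻¹ * (√(n + 1 + x))⁻¹ * ∫ t in a..b, Real.cos (t * w) ≤
        2 * |(n : ℝ) - m|⁻¹ + ((m : ℝ) + 1)⁻¹ := by
    intro m n hmn w hw
    have hmn' : (m : ℝ) < n := by exact_mod_cast hmn
    have hlt : (m : ℝ) + 1 + x < n + 1 + x := by linarith
    have hw0 : w ≠ 0 := by
      rw [← abs_pos, hw, sub_pos]; exact Real.log_lt_log (hy m) hlt
    calc _ ≤ (√(m + 1 + x))⁻¹ * (√(n + 1 + x))⁻¹ * (2 / |w|) := by
          gcongr; exact intervalIntegral_cos_mul_le hw0 a b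
      _ ≤ _ := by
          rw [hw]
          refine (inv_sqrt_mul_inv_sqrt_mul_two_div_log_sub_le (hy m) hlt).trans ?_
          rw [abs_of_pos (by linarith), one_div, div_eq_mul_inv,
            show (n : ℝ) + 1 + x - (m + 1 + x) = n - m by ring]
          exact add_le_add le_rfl (hinv m)
  have hle : ∀ m n : ℕ, m < n → 0 ≤ Real.log (n + 1 + x) - Real.log (m + 1 + x) := by
    intro m n hmn
    have hmn' : (m : ℝ) < n := by exact_mod_cast hmn
    exact sub_nonneg.2 (Real.log_le_log (hy m) (by linarith))
  have hpair : ∀ m n : ℕ, (√(m + 1 + x))⁻¹ * (√(n + 1 + x))⁻¹ *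
      (∫ t in a..b, Real.cos (t * (Real.log (n + 1 + x) - Real.log (m + 1 + x)))) ≤
        2 * |(n : ℝ) - m|⁻¹ + ((m : ℝ) + 1)⁻¹ + ((n : ℝ) + 1)⁻¹ +
          if m = n then (b - a) * ((m : ℝ) + 1)⁻¹ else 0 := by
    intro m n
    have hm : 0 ≤ ((m : ℝ) + 1)⁻¹ := by positivity
    have hn : 0 ≤ ((n : ℝ) + 1)⁻¹ := by positivity
    rcases lt_trichotomy m n with h | h | h
    · rw [if_neg h.ne]
      linarith [hlt m n h _ (abs_of_nonneg (hle m n h))]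
    · subst h
      simp only [sub_self, mul_zero, Real.cos_zero, if_true, abs_zero, inv_zero]
      rw [intervalIntegral.integral_const, smul_eq_mul, mul_one, ← mul_inv,
        Real.mul_self_sqrt (hy m).le]
      have := mul_le_mul_of_nonneg_right (hinv m) (sub_nonneg.2 hab)
      linarith
    · rw [if_neg h.ne', mul_comm (√(m + 1 + x))⁻¹, abs_sub_comm]
      linarith [hlt n m h _ (by rw [abs_sub_comm]; exact abs_of_nonneg (hle n m h))]
  refine (Finset.sum_le_sum fun m _ ↦ Finset.sum_le_sum fun n _ ↦ hpair m n).trans ?_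
  set H := ∑ i ∈ Finset.range M, ((i : ℝ) + 1)⁻¹ with hH
  have hHlog : H ≤ 1 + Real.log M := sum_range_inv_succ_le_one_add_log M
  simp only [Finset.sum_add_distrib, Finset.sum_ite_eq, Finset.sum_const, Finset.card_range,
    nsmul_eq_mul, ← Finset.mul_sum]
  rw [← hH]
  have h1 : ∑ m ∈ Finset.range M, ∑ n ∈ Finset.range M, |(n : ℝ) - m|⁻¹ ≤ M * (2 * H) := by
    refine (Finset.sum_le_card_nsmul _ _ (2 * H) fun m hm ↦
      sum_range_inv_abs_sub_le (Finset.mem_range.1 hm)).trans (by simp)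
  have h2 : ∑ m ∈ Finset.range M, (if m ∈ Finset.range M then (b - a) * ((m : ℝ) + 1)⁻¹ else 0) =
      (b - a) * H := by
    rw [hH, Finset.mul_sum]
    exact Finset.sum_congr rfl fun m hm ↦ if_pos hm
  rw [h2]
  calc _ ≤ 2 * (M * (2 * H)) + M * H + M * H + (b - a) * H := by gcongr
    _ = (b - a + 6 * M) * H := by ring
    _ ≤ _ := by
      have := sub_nonneg.2 hab
      gcongr

lemma continuousOn_hurwitzZeta_half_add (x : UnitAddCircle) :
    ContinuousOn (fun t : ℝ ↦ HurwitzZeta.hurwitzZeta x (1 / 2 + t * I)) (Ici 1) := by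
  intro t ht
  have h0 : (1 / 2 + t * I : ℂ) ≠ 1 := by
    intro h
    have := congrArg Complex.im h
    simp only [add_im, mul_im, ofReal_re, I_im, ofReal_im, I_re, one_im] at this
    norm_num at this
    linarith [mem_Ici.1 ht]
  have h1 : ContinuousAt (fun t : ℝ ↦ (1 / 2 + t * I : ℂ)) t := by fun_prop
  exact (ContinuousAt.comp (f := fun t : ℝ ↦ (1 / 2 + t * I : ℂ))
    (HurwitzZeta.differentiableAt_hurwitzZeta x h0).continuousAt h1).continuousWithinAt

lemma exists_integral_norm_hurwitzZeta_sq_le : ∃ C : ℝ, 0 ≤ C ∧ ∀ x ∈ Ioc (0 : ℝ) 1, ∀ U : ℕ, 1 ≤ U →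
    ∫ t in (U : ℝ)..(2 * U), ‖HurwitzZeta.hurwitzZeta x (1 / 2 + t * I)‖ ^ 2 ≤
      3 * U * (1 / x + 61 * (1 + Real.log (10 * U)) + C) := by
  obtain ⟨C, hC0, hC⟩ := exists_norm_hurwitzZeta_sub_sum_le
  refine ⟨C ^ 2, sq_nonneg C, fun x hx U hU ↦ ?_⟩
  have hU' : (1 : ℝ) ≤ U := by exact_mod_cast hU
  have hx0 := hx.1
  set S : ℝ → ℂ := fun t ↦
    ∑ n ∈ Finset.range (10 * U - 1), ((n + 1 + x : ℝ) : ℂ) ^ (-(1 / 2 + t * I)) with hS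
  have hScont : Continuous S := by
    refine continuous_finsetSum _ fun n _ ↦ ?_
    have : ((n + 1 + x : ℝ) : ℂ) ≠ 0 := by
      have : (0 : ℝ) < n + 1 + x := by positivity
      exact_mod_cast this.ne'
    exact Continuous.const_cpow (by fun_prop) (.inl this)
  have hpt : ∀ t ∈ Icc (U : ℝ) (2 * U), ‖HurwitzZeta.hurwitzZeta x (1 / 2 + t * I)‖ ^ 2 ≤
      3 * (1 / x + ‖S t‖ ^ 2 + C ^ 2) := by
    intro t ht
    have h1 := hC x hx t (hU'.trans ht.1) (10 * U) (by push_cast; linarith [ht.2])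
      (by push_cast; linarith [ht.1])
    have h2 : ∑ n ∈ Finset.range (10 * U), ((n + x : ℝ) : ℂ) ^ (-(1 / 2 + t * I)) =
        S t + (x : ℂ) ^ (-(1 / 2 + t * I)) := by
      rw [show 10 * U = 10 * U - 1 + 1 by omega, Finset.sum_range_succ']
      simp [hS]
    have h3 : ‖(x : ℂ) ^ (-(1 / 2 + t * I))‖ ^ 2 = 1 / x := by
      rw [norm_cpow_eq_rpow_re_of_pos hx0, ← Real.rpow_natCast, ← Real.rpow_mul hx0.le]
      simp [Real.rpow_neg_one]
    rw [h2] at h1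
    have h4 : ‖HurwitzZeta.hurwitzZeta x (1 / 2 + t * I)‖ ≤
        ‖(x : ℂ) ^ (-(1 / 2 + t * I))‖ + ‖S t‖ + C := by
      have h5 := norm_le_norm_add_norm_sub
        (S t + (x : ℂ) ^ (-(1 / 2 + t * I))) (HurwitzZeta.hurwitzZeta x (1 / 2 + t * I))
      have h6 := norm_add_le (S t) ((x : ℂ) ^ (-(1 / 2 + t * I)))
      rw [norm_sub_rev] at h5
      linarith
    rw [← h3]
    have h7 := pow_le_pow_left₀ (norm_nonneg _) h4 2
    nlinarith [sq_nonneg (‖(x : ℂ) ^ (-(1 / 2 + t * I))‖ - ‖S t‖), sq_nonneg (‖S t‖ - C),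
      sq_nonneg (‖(x : ℂ) ^ (-(1 / 2 + t * I))‖ - C)]
  have hUU : (U : ℝ) ≤ 2 * U := by linarith
  have hint1 : IntervalIntegrable (fun t : ℝ ↦ ‖HurwitzZeta.hurwitzZeta x (1 / 2 + t * I)‖ ^ 2)
      volume U (2 * U) := by
    refine ContinuousOn.intervalIntegrable ?_
    rw [uIcc_of_le hUU]
    exact ((continuousOn_hurwitzZeta_half_add x).mono
      (fun t ht ↦ mem_Ici.2 (hU'.trans ht.1))).norm.pow 2
  have hint2 : ∀ a b : ℝ, IntervalIntegrable (fun t : ℝ ↦ ‖S t‖ ^ 2) volume a b := fun a b ↦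
    Continuous.intervalIntegrable (by fun_prop) _ _
  refine (intervalIntegral.integral_mono_on hUU hint1
    (Continuous.intervalIntegrable (by fun_prop) _ _) hpt).trans ?_
  rw [intervalIntegral.integral_const_mul, intervalIntegral.integral_add
    (Continuous.intervalIntegrable (by fun_prop) _ _) (by simp), intervalIntegral.integral_add (by simp) (hint2 _ _),
    intervalIntegral.integral_const, intervalIntegral.integral_const]
  have hmean := integral_norm_sum_cpow_sq_le hx0.le (10 * U - 1) hUU
  have hM : ((10 * U - 1 : ℕ) : ℝ) ≤ 10 * U := by
    have : 10 * U - 1 ≤ 10 * U := Nat.sub_le _ _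
    exact_mod_cast this
  have hMpos : (0 : ℝ) < ((10 * U - 1 : ℕ) : ℝ) := by
    have : 0 < 10 * U - 1 := by omega
    exact_mod_cast this
  have hM1 : 0 ≤ Real.log ((10 * U - 1 : ℕ) : ℝ) := Real.log_natCast_nonneg _
  have hlog : Real.log ((10 * U - 1 : ℕ) : ℝ) ≤ Real.log (10 * U) := Real.log_le_log hMpos hM
  have h8 : (2 * U - U + 6 * ((10 * U - 1 : ℕ) : ℝ)) * (1 + Real.log ((10 * U - 1 : ℕ) : ℝ)) ≤
      (61 * U) * (1 + Real.log (10 * U)) := by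
    gcongr
    linarith
  have h9 := hmean.trans h8
  simp only [smul_eq_mul]
  linarith

lemma sum_norm_sum_character_mul_sq {r : ℕ} [NeZero r] (f : ZMod r → ℂ) :
    ∑ χ : DirichletCharacter ℂ r, ‖∑ j, χ j * f j‖ ^ 2 =
      r.totient * ∑ j with IsUnit j, ‖f j‖ ^ 2 := by
  have hstar : ∀ (χ : DirichletCharacter ℂ r) (k : ZMod r), IsUnit k →
      (starRingEnd ℂ) (χ k) = χ k⁻¹ := by
    intro χ k hk
    obtain ⟨u, rfl⟩ := hk
    have h := MulChar.star_apply' χ (u : ZMod r)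
    rw [← starRingEnd_apply] at h
    rw [h, MulChar.inv_apply, Ring.inverse_unit, ZMod.inv_coe_unit]
  have hC : ∀ χ : DirichletCharacter ℂ r, ((‖∑ j, χ j * f j‖ ^ 2 : ℝ) : ℂ) =
      ∑ k with IsUnit k, ∑ j, (starRingEnd ℂ) (f k) * f j * (χ k⁻¹ * χ j) := by
    intro χ
    have h1 : ∑ j, χ j * f j = ∑ j with IsUnit j, χ j * f j := by
      rw [Finset.sum_filter]
      refine Finset.sum_congr rfl fun j _ ↦ ?_
      split_ifs with h
      · rfl
      · rw [MulChar.map_nonunit χ h, zero_mul]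
    push_cast
    rw [← conj_mul']
    nth_rw 1 [h1]
    rw [map_sum, Finset.sum_mul_sum]
    refine Finset.sum_congr rfl fun k hk ↦ Finset.sum_congr rfl fun j _ ↦ ?_
    rw [map_mul, hstar χ k (Finset.mem_filter.1 hk).2]
    ring
  have key : ((∑ χ : DirichletCharacter ℂ r, ‖∑ j, χ j * f j‖ ^ 2 : ℝ) : ℂ) =
      ((r.totient * ∑ j with IsUnit j, ‖f j‖ ^ 2 : ℝ) : ℂ) := by
    rw [ofReal_sum, Finset.sum_congr rfl fun χ _ ↦ hC χ, Finset.sum_comm]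
    push_cast
    rw [Finset.mul_sum]
    refine Finset.sum_congr rfl fun k hk ↦ ?_
    rw [Finset.sum_comm]
    simp_rw [← Finset.mul_sum,
      DirichletCharacter.sum_char_inv_mul_char_eq ℂ (Finset.mem_filter.1 hk).2]
    simp only [mul_ite, mul_zero, Finset.sum_ite_eq, Finset.mem_univ, if_true]
    rw [← conj_mul']
    ring
  exact_mod_cast key

lemma sum_norm_LFunction_sq_eq {r : ℕ} [NeZero r] {s : ℂ} (hs : s.re = 1 / 2) :
    ∑ χ : DirichletCharacter ℂ r, ‖DirichletCharacter.LFunction χ s‖ ^ 2 =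
      r.totient * ((r : ℝ)⁻¹ *
        ∑ j : ZMod r with IsUnit j, ‖HurwitzZeta.hurwitzZeta (ZMod.toAddCircle j) s‖ ^ 2) := by
  have hr : (0 : ℝ) < r := by exact_mod_cast NeZero.pos r
  have h1 : ‖(r : ℂ) ^ (-s)‖ ^ 2 = (r : ℝ)⁻¹ := by
    rw [← ofReal_natCast, norm_cpow_eq_rpow_re_of_pos hr, ← Real.rpow_natCast,
      ← Real.rpow_mul hr.le, neg_re, hs]
    norm_num [Real.rpow_neg_one]
  unfold DirichletCharacter.LFunction ZMod.LFunction
  simp_rw [norm_mul, mul_pow, ← Finset.mul_sum, sum_norm_sum_character_mul_sq, h1]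
  ring

lemma sum_isUnit_inv_val_le {r : ℕ} [NeZero r] (hr : 2 ≤ r) :
    ∑ j : ZMod r with IsUnit j, ((j.val : ℝ))⁻¹ ≤ 1 + Real.log r := by
  refine le_trans ?_ (sum_range_inv_succ_le_one_add_log r)
  have h0 : ∀ j : ZMod r, IsUnit j → 1 ≤ j.val := by
    intro j hj
    have : Fact (1 < r) := ⟨by omega⟩
    rw [Nat.one_le_iff_ne_zero, ne_eq, ZMod.val_eq_zero]
    exact hj.ne_zero
  have hinj : Set.InjOn (fun j : ZMod r ↦ j.val - 1)
      (Finset.univ.filter fun j : ZMod r ↦ IsUnit j) := by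
    intro i hi j hj hij
    have hi' := h0 i (by simpa using hi)
    have hj' := h0 j (by simpa using hj)
    apply ZMod.val_injective r
    simp only at hij
    omega
  calc ∑ j : ZMod r with IsUnit j, ((j.val : ℝ))⁻¹
      = ∑ j : ZMod r with IsUnit j, (((j.val - 1 : ℕ) : ℝ) + 1)⁻¹ := by
        refine Finset.sum_congr rfl fun j hj ↦ ?_
        rw [Nat.cast_sub (h0 j (Finset.mem_filter.1 hj).2)]; simp
    _ = ∑ i ∈ (Finset.univ.filter fun j : ZMod r ↦ IsUnit j).image (fun j : ZMod r ↦ j.val - 1),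
          ((i : ℝ) + 1)⁻¹ := (Finset.sum_image (f := fun i : ℕ ↦ ((i : ℝ) + 1)⁻¹) hinj).symm
    _ ≤ _ := by
        refine Finset.sum_le_sum_of_subset_of_nonneg ?_ fun i _ _ ↦ by positivity
        intro i hi
        obtain ⟨j, _, rfl⟩ := Finset.mem_image.1 hi
        have := ZMod.val_lt j
        exact Finset.mem_range.2 (by omega)

lemma continuousOn_LFunction_half_add {r : ℕ} [NeZero r] (χ : DirichletCharacter ℂ r) :
    ContinuousOn (fun t : ℝ ↦ DirichletCharacter.LFunction χ (1 / 2 + t * I)) (Ici 1) := by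
  unfold DirichletCharacter.LFunction ZMod.LFunction
  refine ContinuousOn.mul ?_ (continuousOn_finsetSum _ fun j _ ↦
    (continuousOn_hurwitzZeta_half_add _).const_mul _)
  refine Continuous.continuousOn (Continuous.const_cpow (by fun_prop) (.inl ?_))
  exact_mod_cast NeZero.ne r

lemma continuousOn_norm_LFunction_div {r : ℕ} [NeZero r] (χ : DirichletCharacter ℂ r) :
    ContinuousOn (fun t : ℝ ↦ ‖DirichletCharacter.LFunction χ (1 / 2 + t * I)‖ / t) (Ici 1) :=
  (continuousOn_LFunction_half_add χ).norm.div continuousOn_id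
    fun _ ht ↦ (zero_lt_one.trans_le (mem_Ici.1 ht)).ne'

lemma ContinuousOn.intervalIntegrable_of_one_le {f : ℝ → ℝ} (hf : ContinuousOn f (Ici 1)) {a b : ℝ}
    (ha : 1 ≤ a) (hb : 1 ≤ b) : IntervalIntegrable f volume a b :=
  (hf.mono fun _ ht ↦ (le_min ha hb).trans ht.1).intervalIntegrable

lemma exists_sum_integral_norm_LFunction_sq_le : ∃ C : ℝ, 0 ≤ C ∧ ∀ (r : ℕ) [NeZero r], 2 ≤ r →
    ∀ U : ℕ, 1 ≤ U →
      ∑ χ : DirichletCharacter ℂ r,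
        ∫ t in (U : ℝ)..(2 * U), ‖DirichletCharacter.LFunction χ (1 / 2 + t * I)‖ ^ 2 ≤
      r.totient * (3 * U * (1 + Real.log r + 61 * (1 + Real.log (10 * U)) + C)) := by
  obtain ⟨C, hC0, hC⟩ := exists_integral_norm_hurwitzZeta_sq_le
  refine ⟨C, hC0, fun r _ hr U hU ↦ ?_⟩
  have hU' : (1 : ℝ) ≤ U := by exact_mod_cast hU
  have hU2 : (1 : ℝ) ≤ 2 * U := by linarith
  have hr0 : (0 : ℝ) < r := by exact_mod_cast NeZero.pos r
  have hre : ∀ t : ℝ, (1 / 2 + t * I : ℂ).re = 1 / 2 := fun t ↦ by simp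
  have hL : ∀ χ : DirichletCharacter ℂ r, IntervalIntegrable
      (fun t : ℝ ↦ ‖DirichletCharacter.LFunction χ (1 / 2 + t * I)‖ ^ 2) volume U (2 * U) :=
    fun χ ↦ ((continuousOn_LFunction_half_add χ).norm.pow 2).intervalIntegrable_of_one_le hU' hU2
  have hζ : ∀ x : UnitAddCircle, IntervalIntegrable
      (fun t : ℝ ↦ ‖HurwitzZeta.hurwitzZeta x (1 / 2 + t * I)‖ ^ 2) volume U (2 * U) :=
    fun x ↦ ((continuousOn_hurwitzZeta_half_add x).norm.pow 2).intervalIntegrable_of_one_le hU' hU2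
  rw [← intervalIntegral.integral_finsetSum fun χ _ ↦ hL χ]
  simp_rw [sum_norm_LFunction_sq_eq (hre _)]
  rw [intervalIntegral.integral_const_mul, intervalIntegral.integral_const_mul,
    intervalIntegral.integral_finsetSum fun j _ ↦ hζ _]
  refine mul_le_mul_of_nonneg_left ?_ (Nat.cast_nonneg _)
  set B : ℝ := 61 * (1 + Real.log (10 * U)) + C with hB
  have hB0 : 0 ≤ B := by
    have : 0 ≤ Real.log (10 * U) := Real.log_nonneg (by linarith)
    positivity
  have hj : ∀ j ∈ Finset.univ.filter (fun j : ZMod r ↦ IsUnit j),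
      ∫ t in (U : ℝ)..(2 * U),
        ‖HurwitzZeta.hurwitzZeta (ZMod.toAddCircle j) (1 / 2 + t * I)‖ ^ 2 ≤
        3 * U * (r * (j.val : ℝ)⁻¹ + B) := by
    intro j hj
    have : Fact (1 < r) := ⟨by omega⟩
    have hval : 0 < j.val := by
      rw [Nat.pos_iff_ne_zero, ne_eq, ZMod.val_eq_zero]
      exact (Finset.mem_filter.1 hj).2.ne_zero
    have hval' : (0 : ℝ) < j.val := by exact_mod_cast hval
    have hlt : (j.val : ℝ) ≤ r := by exact_mod_cast (ZMod.val_lt j).le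
    rw [ZMod.toAddCircle_apply]
    refine (hC (j.val / r) ⟨by positivity, (div_le_one hr0).2 hlt⟩ U hU).trans (le_of_eq ?_)
    rw [hB, one_div_div, div_eq_mul_inv]
    ring
  have hcard : (((Finset.univ.filter fun j : ZMod r ↦ IsUnit j).card : ℕ) : ℝ) ≤ r := by
    have := Finset.card_filter_le (Finset.univ : Finset (ZMod r)) (fun j ↦ IsUnit j)
    rw [Finset.card_univ, ZMod.card] at this
    exact_mod_cast this
  calc (r : ℝ)⁻¹ * _ ≤ (r : ℝ)⁻¹ * ∑ j : ZMod r with IsUnit j,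
        3 * U * (r * (j.val : ℝ)⁻¹ + B) := by gcongr with j hj'; exact hj j hj'
    _ = 3 * U * ((∑ j : ZMod r with IsUnit j, (j.val : ℝ)⁻¹) +
          (Finset.univ.filter fun j : ZMod r ↦ IsUnit j).card / r * B) := by
        rw [← Finset.mul_sum, Finset.sum_add_distrib, ← Finset.mul_sum, Finset.sum_const,
          nsmul_eq_mul]
        field_simp
    _ ≤ 3 * U * ((1 + Real.log r) + 1 * B) := by
        gcongr
        · exact sum_isUnit_inv_val_le hr
        · exact (div_le_one hr0).2 hcard
    _ = _ := by rw [hB]; ring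

lemma exists_sum_integral_norm_LFunction_div_le : ∃ C : ℝ, 0 ≤ C ∧ ∀ (r : ℕ) [NeZero r], 2 ≤ r →
    ∀ U : ℕ, 1 ≤ U → ∀ A : ℝ, 0 < A →
      ∑ χ : DirichletCharacter ℂ r,
        ∫ t in (U : ℝ)..(2 * U), ‖DirichletCharacter.LFunction χ (1 / 2 + t * I)‖ / t ≤
      r.totient * (A / 2 +
        3 / (2 * A) * (1 + Real.log r + 61 * (1 + Real.log (10 * U)) + C)) := by
  obtain ⟨C, hC0, hC⟩ := exists_sum_integral_norm_LFunction_sq_le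
  refine ⟨C, hC0, fun r _ hr U hU A hA ↦ ?_⟩
  have hU' : (1 : ℝ) ≤ U := by exact_mod_cast hU
  have hU2 : (1 : ℝ) ≤ 2 * U := by linarith
  have hsq : ∀ χ : DirichletCharacter ℂ r, IntervalIntegrable
      (fun t : ℝ ↦ ‖DirichletCharacter.LFunction χ (1 / 2 + t * I)‖ ^ 2) volume U (2 * U) :=
    fun χ ↦ ((continuousOn_LFunction_half_add χ).norm.pow 2).intervalIntegrable_of_one_le hU' hU2
  have hcard : (Fintype.card (DirichletCharacter ℂ r) : ℝ) = r.totient := by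
    rw [← Nat.card_eq_fintype_card,
      DirichletCharacter.card_eq_totient_of_hasEnoughRootsOfUnity ℂ r]
  have hone : ∀ χ : DirichletCharacter ℂ r,
      ∫ t in (U : ℝ)..(2 * U), ‖DirichletCharacter.LFunction χ (1 / 2 + t * I)‖ / t ≤
      A / 2 + 1 / (2 * A * U) *
        ∫ t in (U : ℝ)..(2 * U), ‖DirichletCharacter.LFunction χ (1 / 2 + t * I)‖ ^ 2 := by
    intro χ
    calc _ ≤ ∫ t in (U : ℝ)..(2 * U), (A / (2 * U) +
          1 / (2 * A * U) * ‖DirichletCharacter.LFunction χ (1 / 2 + t * I)‖ ^ 2) := by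
          refine intervalIntegral.integral_mono_on (by linarith)
            ((continuousOn_norm_LFunction_div χ).intervalIntegrable_of_one_le hU' hU2)
            (IntervalIntegrable.add (by simp) ((hsq χ).const_mul _)) fun t ht ↦ ?_
          have h1 : ‖DirichletCharacter.LFunction χ (1 / 2 + t * I)‖ / t ≤
              ‖DirichletCharacter.LFunction χ (1 / 2 + t * I)‖ / U := by
            gcongr; exact ht.1
          refine h1.trans ?_
          generalize ‖DirichletCharacter.LFunction χ (1 / 2 + t * I)‖ = L
          rw [div_add' _ _ _ (by positivity), div_le_div_iff₀ (by positivity) (by positivity)]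
          have h2 : 0 ≤ (U : ℝ) * (A - L) ^ 2 / A := by positivity
          have h3 : (A + 1 / (2 * A * U) * L ^ 2 * (2 * U)) * U - L * (2 * U) =
              (U : ℝ) * (A - L) ^ 2 / A := by
            field_simp; ring
          linarith
      _ = _ := by
          rw [intervalIntegral.integral_add (by simp) ((hsq χ).const_mul _),
            intervalIntegral.integral_const_mul, intervalIntegral.integral_const, smul_eq_mul]
          congr 1
          field_simp
          ring
  refine (Finset.sum_le_sum fun χ _ ↦ hone χ).trans ?_
  rw [Finset.sum_add_distrib, Finset.sum_const, Finset.card_univ, nsmul_eq_mul, hcard,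
    ← Finset.mul_sum]
  calc _ ≤ (r.totient : ℝ) * (A / 2) + 1 / (2 * A * U) *
        (r.totient * (3 * U * (1 + Real.log r + 61 * (1 + Real.log (10 * U)) + C))) := by
        gcongr; exact hC r hr U hU
    _ = _ := by field_simp

theorem first_moment_LFunction_weighted :
    ∃ C : ℝ, 0 < C ∧
      ∀ (r : ℕ) [NeZero r] (T : ℝ), 2 ≤ (r : ℝ) → (r : ℝ) ≤ T →
        (1 / (Nat.totient r : ℝ)) *
            ∑ χ : DirichletCharacter ℂ r,
              ∫ t in (1 : ℝ)..T,
                ‖DirichletCharacter.LFunction χ (1 / 2 + t * Complex.I)‖ / t ≤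
          C * Real.log T ^ ((3 : ℝ) / 2) := by
  obtain ⟨C, hC0, hC⟩ := exists_sum_integral_norm_LFunction_div_le
  refine ⟨4 * (1 / 2 + 3 / 2 * (430 + 2 * C)), by positivity, fun r _ T hr hrT ↦ ?_⟩
  have hr2 : 2 ≤ r := by exact_mod_cast hr
  have hT2 : 2 ≤ T := hr.trans hrT
  have hlog2 : 0.69 < Real.log 2 := by linarith [Real.log_two_gt_d9]
  have hlogT : Real.log 2 ≤ Real.log T := Real.log_le_log (by norm_num) hT2
  set l := Real.log T with hl
  have hl0 : 0 < l := by linarith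
  obtain ⟨n, hn1, hn2⟩ := exists_nat_pow_near (by linarith : 1 ≤ T) (one_lt_two : (1 : ℝ) < 2)
  have hn : ((n + 1 : ℕ) : ℝ) ≤ 4 * l := by
    have h1 : n * Real.log 2 ≤ l := by
      rw [← Real.log_pow]; exact Real.log_le_log (by positivity) hn1
    have h2 : (0 : ℝ) ≤ n := n.cast_nonneg
    push_cast
    nlinarith
  have hφ : (0 : ℝ) < r.totient := by exact_mod_cast Nat.totient_pos.2 (by omega)
  have hpow : ∀ k : ℕ, (1 : ℝ) ≤ 2 ^ k := fun k ↦ one_le_pow₀ one_le_two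
  have hA : 0 < √l := Real.sqrt_pos.2 hl0
  have hblock : ∀ k ∈ Finset.range (n + 1), ∑ χ : DirichletCharacter ℂ r,
      ∫ t in ((2 : ℝ) ^ k)..(2 ^ (k + 1)),
        ‖DirichletCharacter.LFunction χ (1 / 2 + t * Complex.I)‖ / t ≤
      r.totient * ((1 / 2 + 3 / 2 * (430 + 2 * C)) * √l) := by
    intro k hk
    have hkn : k ≤ n := Nat.lt_succ_iff.1 (Finset.mem_range.1 hk)
    have h := hC r hr2 (2 ^ k) Nat.one_le_two_pow (√l) hA
    push_cast at h
    rw [pow_succ']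
    refine h.trans ?_
    have hlogr : Real.log r ≤ l := Real.log_le_log (by linarith) hrT
    have hlogU : Real.log (10 * 2 ^ k) ≤ 4 * Real.log 2 + l := by
      have h1 : (2 : ℝ) ^ k ≤ T := (pow_le_pow_right₀ one_le_two hkn).trans hn1
      have h2 : Real.log (2 ^ 4 * T) = 4 * Real.log 2 + l := by
        rw [Real.log_mul (by norm_num) (by linarith), Real.log_pow]; norm_num; exact hl.symm
      rw [← h2]
      exact Real.log_le_log (by positivity) (by nlinarith)
    have hCl : C ≤ 2 * C * l := by nlinarith
    have hbd : 1 + Real.log r + 61 * (1 + Real.log (10 * 2 ^ k)) + C ≤ (430 + 2 * C) * l := by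
      nlinarith
    gcongr
    calc _ ≤ √l / 2 + 3 / (2 * √l) * ((430 + 2 * C) * (√l * √l)) := by
          rw [Real.mul_self_sqrt hl0.le]; gcongr
      _ = _ := by field_simp
  have hχ : ∀ χ : DirichletCharacter ℂ r,
      ∫ t in (1 : ℝ)..T, ‖DirichletCharacter.LFunction χ (1 / 2 + t * Complex.I)‖ / t ≤
      ∑ k ∈ Finset.range (n + 1), ∫ t in ((2 : ℝ) ^ k)..(2 ^ (k + 1)),
        ‖DirichletCharacter.LFunction χ (1 / 2 + t * Complex.I)‖ / t := by
    intro χ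
    have hc := continuousOn_norm_LFunction_div χ
    rw [intervalIntegral.sum_integral_adjacent_intervals fun k _ ↦
      hc.intervalIntegrable_of_one_le (hpow k) (hpow (k + 1)), pow_zero]
    refine intervalIntegral.integral_mono_interval le_rfl (by linarith) hn2.le ?_
      (hc.intervalIntegrable_of_one_le le_rfl (hpow _))
    filter_upwards [ae_restrict_mem measurableSet_Ioc] with t ht
    have : 0 < t := zero_lt_one.trans ht.1
    simp only [Pi.zero_apply]
    positivity
  calc _ ≤ 1 / (r.totient : ℝ) * ∑ χ : DirichletCharacter ℂ r,
        ∑ k ∈ Finset.range (n + 1), ∫ t in ((2 : ℝ) ^ k)..(2 ^ (k + 1)),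
          ‖DirichletCharacter.LFunction χ (1 / 2 + t * Complex.I)‖ / t := by
        gcongr with χ; exact hχ χ
    _ ≤ 1 / (r.totient : ℝ) * ∑ k ∈ Finset.range (n + 1),
          r.totient * ((1 / 2 + 3 / 2 * (430 + 2 * C)) * √l) := by
        rw [Finset.sum_comm]
        gcongr with k hk; exact hblock k hk
    _ = ((n + 1 : ℕ) : ℝ) * ((1 / 2 + 3 / 2 * (430 + 2 * C)) * √l) := by
        rw [Finset.sum_const, Finset.card_range, nsmul_eq_mul]
        field_simp
    _ ≤ 4 * l * ((1 / 2 + 3 / 2 * (430 + 2 * C)) * √l) := by gcongr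
    _ = _ := by
        rw [show (3 : ℝ) / 2 = 1 + 1 / 2 by norm_num, Real.rpow_add hl0, Real.rpow_one,
          ← Real.sqrt_eq_rpow]
        ring
end
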